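/- arXiv:2502.09830 — 3 statements merged into one kernel-verified Lean document; each statement's English description precedes it below -/
import Mathlib

section
/- Let ℓ ≥ 3 and let F = C_ℓ be the cycle of length ℓ. For every forest 𝒻 of copies of F there exists an integer r ≥ 2 such that every graph G satisfying G →nni (F)_r contains a subgraph isomorphic to ⋃𝒻. -/
open SimpleGraph

/-- `G →nni (F)_r` : every `r`-colouring of the edges of `G` yields a monochromatic
(not necessarily induced) subgraph of `G` isomorphic to `F`, i.e. a monochromatic
injective graph homomorphism from `F` to `G`. -/
def ArrowNNI {V α : Type*} (G : SimpleGraph V) (F : SimpleGraph α) (r : ℕ) : Prop :=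
  ∀ c : Sym2 V → Fin r, ∃ f : F →g G, Function.Injective f ∧
    ∃ k : Fin r, ∀ x y, F.Adj x y → c s(f x, f y) = k

/-- The condition that an enumeration `F 0, F 1, …` of graphs (given as subgraphs of an
ambient graph `G`) forms a forest of copies. -/
def ForestCond {V : Type*} {G : SimpleGraph V} {m : ℕ} (F : Fin m → G.Subgraph) : Prop :=
  ∀ j : Fin m, (j : ℕ) ≠ 0 →
    ((F j).verts ∩ ⋃ (i : Fin m) (_ : i < j), (F i).verts) = ∅ ∨
    (∃ v, ((F j).verts ∩ ⋃ (i : Fin m) (_ : i < j), (F i).verts) = {v}) ∨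
    (∃ x y, (F j).Adj x y ∧ (∃ i : Fin m, i < j ∧ (F i).Adj x y) ∧
      ((F j).verts ∩ ⋃ (i : Fin m) (_ : i < j), (F i).verts) = {x, y})

/-- A set of graphs (given as subgraphs of an ambient graph) is a *forest of copies*
if it admits an enumeration satisfying `ForestCond`. -/
def IsForestOfCopies {V : Type*} {G : SimpleGraph V} (𝒻 : Set G.Subgraph) : Prop :=
  ∃ (m : ℕ) (F : Fin m → G.Subgraph), Function.Injective F ∧
    (∀ H, H ∈ 𝒻 ↔ ∃ i, F i = H) ∧ ForestCond F

/-- A finite set carrying a digraph whose out-degrees are at most `D` can be coloured with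
`2 * D + 1` colours so that distinct adjacent elements receive distinct colours. -/
lemma exists_coloring_finset_of_card_out_le {X : Type*} [DecidableEq X] (D : ℕ)
    (out : X → Finset X) (hout : ∀ x, (out x).card ≤ D) (s : Finset X) :
    ∃ c : X → Fin (2 * D + 1), ∀ x ∈ s, ∀ y ∈ s, y ∈ out x → y ≠ x → c x ≠ c y := by
  induction s using Finset.strongInduction with
  | H s ih =>
  rcases s.eq_empty_or_nonempty with rfl | hs
  · exact ⟨fun _ => 0, by simp⟩
  have hin : ∑ x ∈ s, (s.filter fun y => x ∈ out y).card ≤ s.card * D := by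
    have := Finset.sum_card_bipartiteAbove_eq_sum_card_bipartiteBelow (s := s) (t := s)
      (fun x y => x ∈ out y)
    simp only [Finset.bipartiteAbove, Finset.bipartiteBelow] at this
    rw [this]
    refine Finset.sum_le_card_nsmul _ _ _ fun x _ => (Finset.card_le_card ?_).trans (hout x)
    intro y hy
    exact (Finset.mem_filter.1 hy).2
  obtain ⟨x, hx, hxD⟩ := Finset.exists_le_of_sum_le hs
    (hin.trans_eq (by simp : s.card * D = ∑ _x ∈ s, D))
  obtain ⟨c, hc⟩ := ih (s.erase x) (Finset.erase_ssubset hx)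
  obtain ⟨k, hk⟩ : ∃ k, k ∉ (out x ∪ s.filter fun y => x ∈ out y).image c := by
    by_contra! h
    have h1 := Finset.card_le_card (fun k _ => h k : Finset.univ ⊆ _)
    have h2 := (h1.trans Finset.card_image_le).trans (Finset.card_union_le _ _)
    have h3 := hout x
    simp only [Finset.card_univ, Fintype.card_fin] at h2
    omega
  refine ⟨Function.update c x k, fun a ha b hb hab hne => ?_⟩
  simp only [Finset.mem_image, Finset.mem_union, Finset.mem_filter, not_exists, not_and] at hk
  by_cases hax : a = x
  · subst hax
    rw [Function.update_self, Function.update_of_ne hne]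
    exact fun h => hk b (Or.inl hab) h.symm
  · rw [Function.update_of_ne hax]
    by_cases hbx : b = x
    · subst hbx
      rw [Function.update_self]
      exact hk a (Or.inr ⟨ha, hab⟩)
    · rw [Function.update_of_ne hbx]
      exact hc a (by simp [hax, ha]) b (by simp [hbx, hb]) hab hne

/-- A digraph whose out-degrees are at most `D` has a proper colouring with `2 * D + 1` colours. -/
lemma exists_coloring_of_card_out_le {X : Type*} (D : ℕ)
    (out : X → Finset X) (hout : ∀ x, (out x).card ≤ D) :
    ∃ c : X → Fin (2 * D + 1), ∀ x, ∀ y ∈ out x, y ≠ x → c x ≠ c y := by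
  classical
  have key := nonempty_hom_of_forall_finite_subgraph_hom
    (G := SimpleGraph.fromRel fun x y => y ∈ out x) (F := (⊤ : SimpleGraph (Fin (2 * D + 1))))
    (fun G' hG' =>
      have h := exists_coloring_finset_of_card_out_le D out hout hG'.toFinset
      { toFun := fun x => h.choose x
        map_rel' := by
          rintro ⟨a, ha⟩ ⟨b, hb⟩ hab
          have hab' := G'.adj_sub hab
          have ha' := hG'.mem_toFinset.2 ha
          have hb' := hG'.mem_toFinset.2 hb
          rcases hab' with ⟨hne, hab' | hab'⟩
          · exact h.choose_spec a ha' b hb' hab' hne.symm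
          · exact (h.choose_spec b hb' a ha' hab' hne).symm })
  obtain ⟨f⟩ := key
  refine ⟨f, fun x y hy hne => ?_⟩
  exact f.map_rel (show (SimpleGraph.fromRel fun x y => y ∈ out x).Adj x y from
    ⟨hne.symm, Or.inl hy⟩)

/-- `v` runs injectively once around a cycle of length `ℓ` in `G`. -/
structure IsCycleMap {V : Type*} (G : SimpleGraph V) (ℓ : ℕ) (v : ZMod ℓ → V) : Prop where
  inj : Function.Injective v
  adj : ∀ i, G.Adj (v i) (v (i + 1))

namespace IsCycleMap

variable {V : Type*} {G G' : SimpleGraph V} {ℓ : ℕ} {v : ZMod ℓ → V}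

lemma mono (h : IsCycleMap G ℓ v) (hG : G ≤ G') : IsCycleMap G' ℓ v :=
  ⟨h.inj, fun i => hG (h.adj i)⟩

lemma rotate (h : IsCycleMap G ℓ v) (k : ZMod ℓ) : IsCycleMap G ℓ fun i => v (i + k) :=
  ⟨fun i j hij => add_right_cancel (h.inj hij), fun i => by
    simpa only [add_right_comm] using h.adj (i + k)⟩

lemma reflect (h : IsCycleMap G ℓ v) (k : ZMod ℓ) : IsCycleMap G ℓ fun i => v (k - i) :=
  ⟨fun i j hij => sub_right_injective (h.inj hij), fun i => by
    have := (h.adj (k - (i + 1))).symm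
    rwa [show k - (i + 1) + 1 = k - i by ring] at this⟩

/-- A closed injective sequence of `ℓ` successively adjacent vertices is a cycle. -/
lemma of_nat [NeZero ℓ] (hℓ : 2 ≤ ℓ) (g : ℕ → V) (hinj : ∀ i < ℓ, ∀ j < ℓ, g i = g j → i = j)
    (hadj : ∀ i, i + 1 < ℓ → G.Adj (g i) (g (i + 1))) (hlast : G.Adj (g (ℓ - 1)) (g 0)) :
    IsCycleMap G ℓ fun i => g i.val := by
  refine ⟨fun i j hij => ZMod.val_injective _ (hinj _ i.val_lt _ j.val_lt hij), fun i => ?_⟩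
  have : Fact (1 < ℓ) := ⟨hℓ⟩
  have hi := i.val_lt
  rw [ZMod.val_add, ZMod.val_one]
  rcases Nat.lt_or_ge (i.val + 1) ℓ with h | h
  · rw [Nat.mod_eq_of_lt h]
    exact hadj _ h
  · have : i.val + 1 = ℓ := by omega
    rw [this, Nat.mod_self, show i.val = ℓ - 1 by omega]
    exact hlast

lemma natCast_inj (h : IsCycleMap G ℓ v) {i j : ℕ} (hi : i < ℓ) (hj : j < ℓ)
    (hij : v i = v j) : i = j := by
  have := (ZMod.natCast_eq_natCast_iff' _ _ _).1 (h.inj hij)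
  rwa [Nat.mod_eq_of_lt hi, Nat.mod_eq_of_lt hj] at this

end IsCycleMap

/-- `p 0, …, p a` are the successive vertices of a path in `G`. -/
structure IsPathMap {V : Type*} (G : SimpleGraph V) (p : ℕ → V) (a : ℕ) : Prop where
  inj : ∀ i ≤ a, ∀ j ≤ a, p i = p j → i = j
  adj : ∀ i < a, G.Adj (p i) (p (i + 1))

/-- `u` and `w` are joined by a path of length `a` even if any `n` vertices are forbidden
as inner vertices. -/
def RobustlyLinked {V : Type*} (G : SimpleGraph V) (n : ℕ) (u w : V) (a : ℕ) : Prop :=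
  ∀ U : Finset V, U.card ≤ n → ∃ p : ℕ → V, IsPathMap G p a ∧ p 0 = u ∧ p a = w ∧
    ∀ i, 0 < i → i < a → p i ∉ U

lemma robustlyLinked_one {V : Type*} {G : SimpleGraph V} {u w : V} (h : G.Adj u w) (n : ℕ) :
    RobustlyLinked G n u w 1 := by
  intro U _
  refine ⟨fun i => if i = 0 then u else w, ⟨?_, ?_⟩, by simp, by simp, by omega⟩
  · intro i hi j hj hij
    have := h.ne
    interval_cases i <;> interval_cases j <;> simp_all
  · intro i hi
    interval_cases i
    simpa using h

/-- Size of the blocking sets in `exists_blocking_finset`. -/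
def blockingBound (ℓ K : ℕ) : ℕ → ℕ
  | 0 => K
  | t + 1 => blockingBound ℓ K t + blockingBound ℓ K t * (blockingBound ℓ K t + ℓ)

lemma blockingBound_mono (ℓ K : ℕ) : Monotone (blockingBound ℓ K) :=
  monotone_nat_of_le_succ fun t => by simp [blockingBound]

/-- If a set of `K` vertices meets every `ℓ`-cycle through the edge `xy` outside of `xy`, then
there is a bounded set `T` such that every such cycle whose first `M` vertices after `x` miss `T`
has a later vertex robustly linked to `x` along the cycle. -/
lemma exists_blocking_finset {V : Type*} {G : SimpleGraph V} {ℓ K : ℕ} {x y : V}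
    (hS : ∃ S : Finset V, S.card ≤ K ∧ ∀ v, IsCycleMap G ℓ v → v 0 = x → v (-1) = y →
      ∃ i : ℕ, 0 < i ∧ i + 2 ≤ ℓ ∧ v i ∈ S) (t : ℕ) :
    ∀ M, M + t + 2 = ℓ → ∃ T : Finset V, T.card ≤ blockingBound ℓ K t ∧
      ∀ v, IsCycleMap G ℓ v → v 0 = x → v (-1) = y →
        (∀ i : ℕ, 0 < i → i ≤ M → v i ∉ T) →
        ∃ j : ℕ, M < j ∧ j + 2 ≤ ℓ ∧
          RobustlyLinked G (blockingBound ℓ K (ℓ - 2 - j) + ℓ) x (v j) j := by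
  classical
  induction t with
  | zero =>
    intro M hM
    obtain ⟨S, hSK, hS⟩ := hS
    refine ⟨S, hSK, fun v hv h0 h1 hav => ?_⟩
    obtain ⟨i, hi, hiℓ, hiS⟩ := hS v hv h0 h1
    exact absurd hiS (hav i hi (by omega))
  | succ t ih =>
    intro M hM
    obtain ⟨T, hT, hTv⟩ := ih (M + 1) (by omega)
    have hH : ∀ w, ∃ H : Finset V, H.card ≤ blockingBound ℓ K t + ℓ ∧
        (¬ RobustlyLinked G (blockingBound ℓ K t + ℓ) x w (M + 1) →
          ∀ p, IsPathMap G p (M + 1) → p 0 = x → p (M + 1) = w →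
            ∃ i, 0 < i ∧ i < M + 1 ∧ p i ∈ H) := by
      intro w
      by_cases hw : RobustlyLinked G (blockingBound ℓ K t + ℓ) x w (M + 1)
      · exact ⟨∅, by simp, fun h => absurd hw h⟩
      · have hw' := hw
        unfold RobustlyLinked at hw'
        push Not at hw'
        obtain ⟨U, hU, hUp⟩ := hw'
        exact ⟨U, hU, fun _ => hUp⟩
    choose H hHcard hH using hH
    refine ⟨T ∪ T.biUnion H, ?_, fun v hv h0 h1 hav => ?_⟩
    · refine (Finset.card_union_le _ _).trans (Nat.add_le_add hT ?_)
      exact (Finset.card_biUnion_le_card_mul _ _ _ fun w _ => hHcard w).trans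
        (Nat.mul_le_mul_right _ hT)
    · by_cases hmem : v (M + 1 : ℕ) ∈ T
      · refine ⟨M + 1, by omega, by omega, ?_⟩
        rw [show ℓ - 2 - (M + 1) = t by omega]
        by_contra hlink
        obtain ⟨i, hi, hiM, hiH⟩ := hH _ hlink (fun i => v i)
          ⟨fun i hi j hj hij => hv.natCast_inj (by omega) (by omega) hij,
            fun i _ => by simpa using hv.adj i⟩ (by simpa using h0) rfl
        refine hav i hi (by omega) ?_
        exact Finset.mem_union_right _ (Finset.mem_biUnion.2 ⟨_, hmem, hiH⟩)
      · obtain ⟨j, hj, hj'⟩ := hTv v hv h0 h1 fun i hi hiM => by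
          rcases Nat.lt_or_ge M i with h | h
          · rwa [show i = M + 1 by omega]
          · exact fun hmem => hav i hi h (Finset.mem_union_left _ hmem)
        exact ⟨j, by omega, hj'⟩

/-- An arc of a cycle can be rerouted along a robust link so as to avoid a given finite set. -/
lemma IsCycleMap.exists_reroute {V : Type*} {G : SimpleGraph V} {ℓ M n : ℕ} [NeZero ℓ]
    {v : ZMod ℓ → V} (hv : IsCycleMap G ℓ v) (hM : M + 2 ≤ ℓ) (hM0 : 0 < M)
    (hlink : RobustlyLinked G (n + ℓ) (v 1) (v (1 + M : ℕ)) M) (T : Finset V) (hT : T.card ≤ n) :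
    ∃ v', IsCycleMap G ℓ v' ∧ v' 0 = v 0 ∧ v' 1 = v 1 ∧
      (∀ j : ℕ, M < j → j < ℓ → v' j = v j) ∧ ∀ i : ℕ, 1 < i → i ≤ M → v' i ∉ T := by
  classical
  obtain ⟨p, hp, hp0, hpM, hpU⟩ := hlink (T ∪ Finset.univ.image v) (by
    refine (Finset.card_union_le _ _).trans (Nat.add_le_add hT ?_)
    exact Finset.card_image_le.trans (by simp [ZMod.card]))
  have hpv : ∀ i, 0 < i → i < M → ∀ k, p i ≠ v k := fun i h1 h2 k hk =>
    hpU i h1 h2 (Finset.mem_union_right _ (Finset.mem_image.2 ⟨k, Finset.mem_univ _, hk.symm⟩))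
  have hpT : ∀ i, 0 < i → i < M → p i ∉ T := fun i h1 h2 h =>
    hpU i h1 h2 (Finset.mem_union_left _ h)
  set g : ℕ → V := fun i => if 1 ≤ i ∧ i ≤ M + 1 then p (i - 1) else v i with hg
  have gin : ∀ i, 1 ≤ i → i ≤ M + 1 → g i = p (i - 1) := fun i h1 h2 => if_pos ⟨h1, h2⟩
  have gout : ∀ i, i = 0 ∨ M + 1 ≤ i → g i = v i := by
    intro i hi
    by_cases h : i = M + 1
    · subst h
      rw [gin _ (by omega) le_rfl, Nat.add_sub_cancel, hpM, add_comm]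
    · exact if_neg (by omega)
  have g1 : g 1 = v 1 := by rw [gin 1 le_rfl (by omega)]; exact hp0
  have hmix : ∀ i < ℓ, ∀ j < ℓ, 1 ≤ i → i ≤ M + 1 → (j = 0 ∨ M + 1 < j) → g i ≠ g j := by
    intro i hi j hj h1 h2 h3 heq
    rw [gout j (by omega)] at heq
    rcases Nat.lt_or_ge 1 i with h4 | h4
    · rcases Nat.lt_or_ge i (M + 1) with h5 | h5
      · rw [gin i h1 h2] at heq
        exact hpv _ (by omega) (by omega) _ heq
      · rw [gout i (by omega)] at heq
        have := hv.natCast_inj hi hj heq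
        omega
    · rw [show i = 1 by omega, g1, ← Nat.cast_one] at heq
      have := hv.natCast_inj (by omega) hj heq
      omega
  have hcyc : IsCycleMap G ℓ fun i => g i.val := by
    refine IsCycleMap.of_nat (by omega) g ?_ ?_ ?_
    · intro i hi j hj hij
      by_cases h1 : 1 ≤ i ∧ i ≤ M + 1 <;> by_cases h2 : 1 ≤ j ∧ j ≤ M + 1
      · rw [gin i h1.1 h1.2, gin j h2.1 h2.2] at hij
        have := hp.inj _ (by omega) _ (by omega) hij
        omega
      · exact absurd hij (hmix i hi j hj h1.1 h1.2 (by omega))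
      · exact absurd hij.symm (hmix j hj i hi h2.1 h2.2 (by omega))
      · rw [gout i (by omega), gout j (by omega)] at hij
        exact hv.natCast_inj hi hj hij
    · intro i hi
      by_cases h1 : 1 ≤ i ∧ i ≤ M
      · rw [gin i h1.1 (by omega), gin (i + 1) (by omega) (by omega)]
        have := hp.adj (i - 1) (by omega)
        rwa [show i - 1 + 1 = i + 1 - 1 by omega] at this
      · rcases Nat.eq_zero_or_pos i with rfl | h0
        · rw [gout 0 (by simp), g1]
          simpa using hv.adj 0
        · rw [gout i (by omega), gout (i + 1) (by omega)]
          simpa using hv.adj i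
    · rw [gout (ℓ - 1) (by omega), gout 0 (by simp)]
      have := hv.adj (ℓ - 1 : ℕ)
      rwa [← Nat.cast_add_one, show ℓ - 1 + 1 = ℓ by omega, ZMod.natCast_self,
        ← Nat.cast_zero] at this
  have hcast : ∀ i : ℕ, i < ℓ → g (i : ZMod ℓ).val = g i := fun i hi => by
    rw [ZMod.val_natCast_of_lt hi]
  refine ⟨_, hcyc, ?_, ?_, fun j hj hjℓ => ?_, fun i hi hiM => ?_⟩
  · simpa using gout 0 (by simp)
  · simpa [g1] using hcast 1 (by omega)
  · exact (hcast j hjℓ).trans (gout j (by omega))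
  · rw [hcast i (by omega), gin i (by omega) (by omega)]
    exact hpT _ (by omega) (by omega)

/-- `G` has an edge colouring with `r` colours without monochromatic `ℓ`-cycles. -/
def CycleColorable {V : Type*} (G : SimpleGraph V) (ℓ r : ℕ) : Prop :=
  ∃ c : Sym2 V → ℕ, (∀ e, c e < r) ∧
    ∀ v, IsCycleMap G ℓ v → ∀ k, ¬ ∀ i, c s(v i, v (i + 1)) = k

/-- If for every edge the `ℓ`-cycles through this edge can be met by `K` further vertices, then
the edges can be coloured with a bounded number of colours without monochromatic `ℓ`-cycles. -/
lemma cycleColorable_of_forall_adj_exists_finset {V : Type*} {G : SimpleGraph V} {ℓ K : ℕ}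
    (hℓ : 3 ≤ ℓ)
    (hS : ∀ x y, G.Adj x y → ∃ S : Finset V, S.card ≤ K ∧
      ∀ v, IsCycleMap G ℓ v → v 0 = x → v (-1) = y → ∃ i : ℕ, 0 < i ∧ i + 2 ≤ ℓ ∧ v i ∈ S) :
    CycleColorable G ℓ (2 * (2 * (ℓ * blockingBound ℓ K ℓ)) + 1) := by
  classical
  have : NeZero ℓ := ⟨by omega⟩
  have hT : ∀ x y M, ∃ T : Finset V, T.card ≤ blockingBound ℓ K ℓ ∧
      (G.Adj x y → ∀ t, M + t + 2 = ℓ → T.card ≤ blockingBound ℓ K t ∧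
        ∀ v, IsCycleMap G ℓ v → v 0 = x → v (-1) = y →
        (∀ i : ℕ, 0 < i → i ≤ M → v i ∉ T) →
        ∃ j : ℕ, M < j ∧ j + 2 ≤ ℓ ∧
          RobustlyLinked G (blockingBound ℓ K (ℓ - 2 - j) + ℓ) x (v j) j) := by
    intro x y M
    by_cases h : G.Adj x y ∧ M + 2 ≤ ℓ
    · obtain ⟨T, hT, hTv⟩ := exists_blocking_finset (hS x y h.1) (ℓ - 2 - M) M (by omega)
      refine ⟨T, hT.trans (blockingBound_mono _ _ (by omega)), fun _ t ht => ?_⟩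
      obtain rfl : t = ℓ - 2 - M := by omega
      exact ⟨hT, hTv⟩
    · exact ⟨∅, by simp, fun h1 t ht => absurd ⟨h1, by omega⟩ h⟩
  choose T hTcard hT using hT
  set A : V → V → Finset V := fun x y => (Finset.range ℓ).biUnion (T x y) with hA
  have hAcard : ∀ x y, (A x y).card ≤ ℓ * blockingBound ℓ K ℓ := fun x y => by
    simpa using Finset.card_biUnion_le_card_mul (Finset.range ℓ) (T x y) _ fun M _ => hTcard x y M
  set star : V → V → Finset (Sym2 V) := fun x y => (A x y).image fun w => s(x, w) with hstar
  have hstarcard : ∀ x y, (star x y).card ≤ ℓ * blockingBound ℓ K ℓ := fun x y =>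
    Finset.card_image_le.trans (hAcard x y)
  set out : Sym2 V → Finset (Sym2 V) := fun e =>
    star (Quot.out e).1 (Quot.out e).2 ∪ star (Quot.out e).2 (Quot.out e).1 with hout
  obtain ⟨c, hc⟩ := exists_coloring_of_card_out_le (2 * (ℓ * blockingBound ℓ K ℓ)) out fun e => by
    have h1 := hstarcard (Quot.out e).1 (Quot.out e).2
    have h2 := hstarcard (Quot.out e).2 (Quot.out e).1
    exact (Finset.card_union_le _ _).trans (by omega)
  have hstar_out : ∀ x y, star x y ⊆ out s(x, y) := by
    intro x y
    have h : s((Quot.out s(x, y)).1, (Quot.out s(x, y)).2) = s(x, y) := Quot.out_eq _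
    rcases Sym2.eq_iff.1 h with ⟨h1, h2⟩ | ⟨h1, h2⟩
    · simp only [hout, h1, h2]
      exact Finset.subset_union_left
    · simp only [hout, h1, h2]
      exact Finset.subset_union_right
  refine ⟨fun e => c e, fun e => (c e).2, fun v hv k hk => ?_⟩
  have hfirst : ∀ v, IsCycleMap G ℓ v → (∀ i, (c s(v i, v (i + 1)) : ℕ) = k) →
      ∀ M < ℓ, v 1 ∉ T (v 0) (v (-1)) M := by
    intro v hv hk M hM hmem
    have h0 := hk 0
    have h1 := hk (-1)
    rw [zero_add] at h0
    rw [neg_add_cancel, Sym2.eq_swap] at h1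
    refine hc s(v 0, v (-1)) s(v 0, v 1) (hstar_out _ _ (Finset.mem_image_of_mem _
      (Finset.mem_biUnion.2 ⟨M, Finset.mem_range.2 hM, hmem⟩))) (fun h => ?_)
      (Fin.ext (h1.trans h0.symm))
    have h2 := hv.inj (Sym2.congr_right.1 h)
    have h3 : ((2 : ℕ) : ZMod ℓ) = 0 := by
      rw [eq_neg_iff_add_eq_zero] at h2
      exact_mod_cast (by simpa [one_add_one_eq_two] using h2 : (2 : ZMod ℓ) = 0)
    have := Nat.le_of_dvd (by omega) ((ZMod.natCast_eq_zero_iff _ _).1 h3)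
    omega
  have hnot : ∀ t M, M + t + 2 = ℓ → 0 < M → ∀ v, IsCycleMap G ℓ v →
      (∀ i, (c s(v i, v (i + 1)) : ℕ) = k) →
      ¬ RobustlyLinked G (blockingBound ℓ K t + ℓ) (v 1) (v (1 + M : ℕ)) M := by
    intro t
    induction t using Nat.strong_induction_on with
    | _ t ih =>
    intro M hM hM0 v hv hk hlink
    have hadj : G.Adj (v 0) (v (-1)) := by simpa using (hv.adj (-1)).symm
    obtain ⟨hTt, hTv⟩ := hT _ _ M hadj t hM
    obtain ⟨v', hv', h0, h1, hsame, havoid⟩ := hv.exists_reroute (by omega) hM0 hlink _ hTt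
    have hneg : ((ℓ - 1 : ℕ) : ZMod ℓ) = -1 := by
      rw [Nat.cast_sub (by omega), ZMod.natCast_self]
      simp
    obtain ⟨j, hMj, hjℓ, hj⟩ := hTv v' hv' h0
      (by rw [← hneg]; exact hsame _ (by omega) (by omega)) fun i hi hiM => by
        rcases Nat.lt_or_ge 1 i with h | h
        · exact havoid i h hiM
        · rw [show i = 1 by omega, Nat.cast_one, h1]
          exact hfirst v hv hk M (by omega)
    rw [hsame j hMj (by omega)] at hj
    refine ih (ℓ - 2 - j) (by omega) j (by omega) (by omega) _ (hv.rotate (-1)) (fun i => ?_) ?_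
    · simpa [add_right_comm] using hk (i + -1)
    · simpa using hj
  refine hnot (ℓ - 3) 1 (by omega) one_pos v hv hk (robustlyLinked_one ?_ _)
  simpa [one_add_one_eq_two] using hv.adj 1

/-- Through the edge `xy` of `G` there are `ℓ`-cycles avoiding any `K` given further vertices. -/
def IsRichPair {V : Type*} (G : SimpleGraph V) (ℓ K : ℕ) (x y : V) : Prop :=
  ∀ S : Finset V, S.card ≤ K → ∃ v, IsCycleMap G ℓ v ∧ v 0 = x ∧ v 1 = y ∧
    ∀ i, i ≠ 0 → i ≠ 1 → v i ∉ S

lemma IsRichPair.symm {V : Type*} {G : SimpleGraph V} {ℓ K : ℕ} {x y : V}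
    (h : IsRichPair G ℓ K x y) : IsRichPair G ℓ K y x := by
  intro S hS
  obtain ⟨v, hv, h0, h1, hvS⟩ := h S hS
  refine ⟨_, hv.reflect 1, by simpa, by simpa, fun i hi0 hi1 => hvS _ ?_ ?_⟩
  · exact sub_ne_zero.2 hi1.symm
  · simpa using hi0

/-- The graph of all edges of `G` that form a rich pair. -/
def richCore {V : Type*} (ℓ K : ℕ) (G : SimpleGraph V) : SimpleGraph V where
  Adj x y := G.Adj x y ∧ IsRichPair G ℓ K x y
  symm := ⟨fun _ _ h => ⟨h.1.symm, h.2.symm⟩⟩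
  loopless := ⟨fun _ h => h.1.ne rfl⟩

lemma richCore_le {V : Type*} (ℓ K : ℕ) (G : SimpleGraph V) : richCore ℓ K G ≤ G :=
  fun _ _ h => h.1

lemma richCore_iterate_le {V : Type*} (ℓ K : ℕ) (d : ℕ) (G : SimpleGraph V) :
    (richCore ℓ K)^[d] G ≤ G := by
  induction d with
  | zero => exact le_rfl
  | succ d ih =>
    rw [Function.iterate_succ_apply']
    exact (richCore_le ℓ K _).trans ih

/-- Number of colours in `cycleColorable_of_forall_adj_exists_finset`. -/
def poorColors (ℓ K : ℕ) : ℕ := 2 * (2 * (ℓ * blockingBound ℓ K ℓ)) + 1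

lemma CycleColorable.of_richCore {V : Type*} {G : SimpleGraph V} {ℓ K r : ℕ} (hℓ : 3 ≤ ℓ)
    (h : CycleColorable (richCore ℓ K G) ℓ r) : CycleColorable G ℓ (poorColors ℓ K + r) := by
  classical
  have : NeZero ℓ := ⟨by omega⟩
  obtain ⟨c₁, hc₁, hc₁v⟩ : CycleColorable (G \ richCore ℓ K G) ℓ (poorColors ℓ K) := by
    refine cycleColorable_of_forall_adj_exists_finset hℓ fun x y hxy => ?_
    have hpoor : ¬ IsRichPair G ℓ K x y := fun h => hxy.2 ⟨hxy.1, h⟩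
    unfold IsRichPair at hpoor
    push Not at hpoor
    obtain ⟨S, hS, hSv⟩ := hpoor
    refine ⟨S, hS, fun v hv h0 h1 => ?_⟩
    obtain ⟨i, hi0, hi1, hiS⟩ := hSv _ ((hv.mono sdiff_le).reflect 0) (by simpa) (by simpa)
    have hval : (((-i).val : ℕ) : ZMod ℓ) = -i := ZMod.natCast_zmod_val _
    refine ⟨(-i).val, ?_, ?_, ?_⟩
    · exact Nat.pos_of_ne_zero fun h => hi0 (by simpa using h)
    · have hlt := (-i).val_lt
      by_contra hcon
      refine hi1 ?_
      have h2 : (-i).val = ℓ - 1 := by omega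
      rw [h2, Nat.cast_sub (by omega), ZMod.natCast_self] at hval
      simpa using hval.symm
    · rw [hval]
      simpa using hiS
  obtain ⟨c₂, hc₂, hc₂v⟩ := h
  refine ⟨fun e => if e ∈ (richCore ℓ K G).edgeSet then poorColors ℓ K + c₂ e else c₁ e,
    fun e => ?_, fun v hv k hk => ?_⟩
  · have := hc₁ e
    have := hc₂ e
    dsimp only
    split_ifs <;> omega
  · dsimp only at hk
    rcases Nat.lt_or_ge k (poorColors ℓ K) with hlt | hge
    · have hout : ∀ i, s(v i, v (i + 1)) ∉ (richCore ℓ K G).edgeSet := fun i hi => by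
        have := hk i
        rw [if_pos hi] at this
        omega
      refine hc₁v v ⟨hv.inj, fun i => ⟨hv.adj i, hout i⟩⟩ k fun i => ?_
      have := hk i
      rwa [if_neg (hout i)] at this
    · have hin : ∀ i, s(v i, v (i + 1)) ∈ (richCore ℓ K G).edgeSet := fun i => by
        by_contra hi
        have := hk i
        rw [if_neg hi] at this
        have := hc₁ s(v i, v (i + 1))
        omega
      refine hc₂v v ⟨hv.inj, hin⟩ (k - poorColors ℓ K) fun i => ?_
      have := hk i
      rw [if_pos (hin i)] at this
      omega

lemma CycleColorable.of_richCore_iterate {V : Type*} {ℓ K r : ℕ} (hℓ : 3 ≤ ℓ) (d : ℕ)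
    {G : SimpleGraph V} (h : CycleColorable ((richCore ℓ K)^[d] G) ℓ r) :
    CycleColorable G ℓ (d * poorColors ℓ K + r) := by
  induction d generalizing G with
  | zero => simpa using h
  | succ d ih =>
    have := CycleColorable.of_richCore hℓ (ih h)
    rwa [show (d + 1) * poorColors ℓ K + r = poorColors ℓ K + (d * poorColors ℓ K + r) by ring]

lemma neg_one_ne_one_zmod {ℓ : ℕ} (hℓ : 3 ≤ ℓ) : (-1 : ZMod ℓ) ≠ 1 := by
  intro h
  have h3 : ((2 : ℕ) : ZMod ℓ) = 0 := by
    rw [eq_comm, eq_neg_iff_add_eq_zero, one_add_one_eq_two] at h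
    exact_mod_cast h
  have := Nat.le_of_dvd (by omega) ((ZMod.natCast_eq_zero_iff _ _).1 h3)
  omega

lemma exists_cycle_through_vertex {V : Type*} {G : SimpleGraph V} {ℓ K : ℕ} (hℓ : 3 ≤ ℓ) {x y : V}
    (h : (richCore ℓ K (richCore ℓ K G)).Adj x y) {U : Finset V} (hU : U.card ≤ K) :
    ∃ v, IsCycleMap G ℓ v ∧ v 0 = x ∧ ∀ i, i ≠ 0 → v i ∉ U := by
  have : Fact (1 < ℓ) := ⟨by omega⟩
  obtain ⟨w, hw, hw0, -, hwU⟩ := h.2 U hU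
  have hadj : (richCore ℓ K G).Adj x (w (-1)) := by simpa [hw0] using (hw.adj (-1)).symm
  obtain ⟨v, hv, hv0, hv1, hvU⟩ := hadj.2 U hU
  refine ⟨v, hv, hv0, fun i hi => ?_⟩
  by_cases hi1 : i = 1
  · rw [hi1, hv1]
    exact hwU _ (by simp) (neg_one_ne_one_zmod hℓ)
  · exact hvU i hi hi1

lemma exists_cycle_avoiding {V : Type*} {G : SimpleGraph V} {ℓ K : ℕ} (hℓ : 3 ≤ ℓ) {x y : V}
    (h : ((richCore ℓ K)^[4] G).Adj x y) {U : Finset V} (hU : U.card ≤ K) :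
    ∃ v, IsCycleMap G ℓ v ∧ ∀ i, v i ∉ U := by
  have : Fact (1 < ℓ) := ⟨by omega⟩
  obtain ⟨w, hw, hw0, hwU⟩ := exists_cycle_through_vertex hℓ
    (G := richCore ℓ K (richCore ℓ K G)) h hU
  obtain ⟨v, hv, hv0, hvU⟩ := exists_cycle_through_vertex hℓ (hw.adj 0).symm hU
  refine ⟨v, hv, fun i => ?_⟩
  by_cases hi : i = 0
  · rw [hi, hv0]
    exact hwU _ (by simp)
  · exact hvU i hi

/-- An injective labelling of the vertices of `F` by residues modulo `ℓ` in which adjacent vertices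
have consecutive labels. -/
structure IsCyclicLabelling {α : Type*} {A : SimpleGraph α} (F : A.Subgraph) (ℓ : ℕ)
    (σ : α → ZMod ℓ) : Prop where
  injOn : Set.InjOn σ F.verts
  adj : ∀ a b, F.Adj a b → σ b = σ a + 1 ∨ σ a = σ b + 1

namespace IsCyclicLabelling

variable {α V : Type*} {A : SimpleGraph α} {F : A.Subgraph} {G : SimpleGraph V} {ℓ : ℕ}
  {σ : α → ZMod ℓ}

lemma sub_const (h : IsCyclicLabelling F ℓ σ) (k : ZMod ℓ) :
    IsCyclicLabelling F ℓ fun a => σ a - k :=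
  ⟨fun a ha b hb hab => h.injOn ha hb (sub_left_injective hab), fun a b hab => by
    rcases h.adj a b hab with h | h
    · exact Or.inl (by rw [h]; ring)
    · exact Or.inr (by rw [h]; ring)⟩

lemma const_sub (h : IsCyclicLabelling F ℓ σ) (k : ZMod ℓ) :
    IsCyclicLabelling F ℓ fun a => k - σ a :=
  ⟨fun a ha b hb hab => h.injOn ha hb (sub_right_injective hab), fun a b hab => by
    rcases h.adj a b hab with h | h
    · exact Or.inr (by rw [h]; ring)
    · exact Or.inl (by rw [h]; ring)⟩

lemma adj_comp (h : IsCyclicLabelling F ℓ σ) {v : ZMod ℓ → V} (hv : IsCycleMap G ℓ v) {a b : α}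
    (hab : F.Adj a b) : G.Adj (v (σ a)) (v (σ b)) := by
  rcases h.adj a b hab with h | h
  · rw [h]
    exact hv.adj _
  · rw [h]
    exact (hv.adj _).symm

end IsCyclicLabelling

/-- A copy of the `ℓ`-cycle attached to a set `W` in at most an edge can be mapped to `G`,
extending a given map on `W`, provided the attachment is mapped into `(richCore ℓ K)^[4] G`. -/
lemma exists_attach_cycle {α V : Type*} [DecidableEq V] {A : SimpleGraph α} {F : A.Subgraph}
    {G : SimpleGraph V} {ℓ K : ℕ} (hℓ : 3 ≤ ℓ) {σ : α → ZMod ℓ} (hσ : IsCyclicLabelling F ℓ σ)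
    {W : Set α} {φ : α → V} {U : Finset V} (hU : U.card ≤ K)
    (hne : ∃ x y, ((richCore ℓ K)^[4] G).Adj x y)
    (hW : ∀ a ∈ W, ∃ y, ((richCore ℓ K)^[4] G).Adj (φ a) y)
    (hF : F.verts ∩ W = ∅ ∨ (∃ a, F.verts ∩ W = {a}) ∨
      ∃ x y, F.Adj x y ∧ ((richCore ℓ K)^[4] G).Adj (φ x) (φ y) ∧ F.verts ∩ W = {x, y}) :
    ∃ ψ : α → V, Set.InjOn ψ F.verts ∧ (∀ a b, F.Adj a b → G.Adj (ψ a) (ψ b)) ∧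
      (∀ a ∈ F.verts, a ∈ W → ψ a = φ a) ∧ ∀ a ∈ F.verts, a ∉ W → ψ a ∉ U := by
  suffices h : ∃ (τ : α → ZMod ℓ) (v : ZMod ℓ → V), IsCyclicLabelling F ℓ τ ∧ IsCycleMap G ℓ v ∧
      (∀ a ∈ F.verts, a ∈ W → v (τ a) = φ a) ∧ ∀ a ∈ F.verts, a ∉ W → v (τ a) ∉ U by
    obtain ⟨τ, v, hτ, hv, h1, h2⟩ := h
    exact ⟨fun a => v (τ a), hv.inj.comp_injOn hτ.injOn, fun a b hab => hτ.adj_comp hv hab, h1, h2⟩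
  rcases hF with hF | ⟨a, hF⟩ | ⟨x, y, hxy, hφ, hF⟩
  · obtain ⟨x, y, hxy⟩ := hne
    obtain ⟨v, hv, hvU⟩ := exists_cycle_avoiding hℓ hxy hU
    refine ⟨σ, v, hσ, hv, fun a ha haW => ?_, fun a _ _ => hvU _⟩
    exact absurd (show a ∈ F.verts ∩ W from ⟨ha, haW⟩) (by simp [hF])
  · have ha : a ∈ F.verts ∩ W := by simp [hF]
    obtain ⟨y, hy⟩ := hW a ha.2
    obtain ⟨v, hv, hv0, hvU⟩ := exists_cycle_through_vertex hℓ
      (richCore_iterate_le ℓ K 2 (richCore ℓ K (richCore ℓ K G)) hy) hU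
    refine ⟨_, v, hσ.sub_const (σ a), hv, fun b hb hbW => ?_, fun b hb hbW => hvU _ fun h => hbW ?_⟩
    · have : b ∈ F.verts ∩ W := ⟨hb, hbW⟩
      obtain rfl : b = a := by simpa [hF] using this
      simpa using hv0
    · rw [hσ.injOn hb ha.1 (sub_eq_zero.1 h)]
      exact ha.2
  · have hx : x ∈ F.verts ∩ W := by simp [hF]
    have hy : y ∈ F.verts ∩ W := by simp [hF]
    obtain ⟨v, hv, hv0, hv1, hvU⟩ := (richCore_iterate_le ℓ K 3 (richCore ℓ K G) hφ).2 U hU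
    obtain ⟨τ, hτ, hτx, hτy⟩ : ∃ τ, IsCyclicLabelling F ℓ τ ∧ τ x = 0 ∧ τ y = 1 := by
      rcases hσ.adj x y hxy with h | h
      · exact ⟨_, hσ.sub_const (σ x), by simp, by simp [h]⟩
      · exact ⟨_, hσ.const_sub (σ x), by simp, by simp [h]⟩
    refine ⟨τ, v, hτ, hv, fun b hb hbW => ?_, fun b hb hbW => hvU _ (fun h => hbW ?_)
      fun h => hbW ?_⟩
    · have : b ∈ F.verts ∩ W := ⟨hb, hbW⟩
      rw [hF] at this
      rcases this with rfl | rfl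
      · rw [hτx, hv0]
      · rw [hτy, hv1]
    · rw [hτ.injOn hb hx.1 (h.trans hτx.symm)]
      exact hx.2
    · rw [hτ.injOn hb hy.1 (h.trans hτy.symm)]
      exact hy.2

lemma exists_cyclicLabelling {α : Type*} {A : SimpleGraph α} {F : A.Subgraph} {n : ℕ}
    (e : F.coe ≃g cycleGraph (n + 3)) : ∃ σ, IsCyclicLabelling F (n + 3) σ := by
  classical
  obtain ⟨σ, hσ⟩ : ∃ σ : α → Fin (n + 3), ∀ a (ha : a ∈ F.verts), σ a = e ⟨a, ha⟩ :=
    ⟨fun a => if h : a ∈ F.verts then e ⟨a, h⟩ else 0, fun a ha => dif_pos ha⟩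
  refine ⟨σ, fun a ha b hb hab => ?_, fun a b hab => ?_⟩
  · exact congrArg Subtype.val (e.injective ((hσ a ha).symm.trans (hab.trans (hσ b hb))))
  · have h : (cycleGraph (n + 3)).Adj (σ a) (σ b) := by
      rw [hσ a (F.edge_vert hab), hσ b (F.edge_vert hab.symm)]
      exact e.map_rel_iff.2 hab
    rcases cycleGraph_adj.1 h with h | h
    · exact Or.inr (eq_add_of_sub_eq' h)
    · exact Or.inl (eq_add_of_sub_eq' h)

lemma exists_adj_of_mem_verts {α : Type*} {A : SimpleGraph α} {F : A.Subgraph} {n : ℕ}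
    (e : F.coe ≃g cycleGraph (n + 3)) {a : α} (ha : a ∈ F.verts) : ∃ b, F.Adj a b := by
  have : (cycleGraph (n + 3)).Adj (e ⟨a, ha⟩) (e ⟨a, ha⟩ + 1) :=
    cycleGraph_adj.2 (Or.inr (by simp))
  refine ⟨e.symm (e ⟨a, ha⟩ + 1), ?_⟩
  have h := e.symm.map_rel_iff.2 this
  rwa [e.symm_apply_apply] at h

/-- If the iterated rich core of `G` has an edge, then every forest of `m` copies of the cycle
embeds into `G`. -/
lemma exists_embedding_of_forestCond {α V : Type*} {A : SimpleGraph α} {m n : ℕ}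
    {F : Fin m → A.Subgraph} (hF : ForestCond F)
    (hcopies : ∀ i, Nonempty ((F i).coe ≃g cycleGraph (n + 3))) {G : SimpleGraph V} {x y : V}
    (hxy : ((richCore (n + 3) (m * (n + 3)))^[4 * m] G).Adj x y) :
    ∃ φ : α → V, Set.InjOn φ (⋃ i, (F i).verts) ∧
      ∀ i a b, (F i).Adj a b → G.Adj (φ a) (φ b) := by
  classical
  set R := richCore (V := V) (n + 3) (m * (n + 3)) with hR
  suffices h : ∀ k ≤ m, ∃ φ : α → V, Set.InjOn φ (⋃ (i : Fin m) (_ : (i : ℕ) < k), (F i).verts) ∧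
      ∀ i : Fin m, (i : ℕ) < k → ∀ a b, (F i).Adj a b →
        (R^[4 * (m - k)] G).Adj (φ a) (φ b) by
    obtain ⟨φ, hφ, hadj⟩ := h m le_rfl
    refine ⟨φ, by simpa using hφ, fun i a b hab => ?_⟩
    simpa using hadj i i.2 a b hab
  intro k
  induction k with
  | zero => exact fun _ => ⟨fun _ => x, by simp⟩
  | succ k ih =>
    intro hk
    obtain ⟨φ, hφ, hadj⟩ := ih (by omega)
    have hlevel : R^[4 * (m - k)] G = R^[4] (R^[4 * (m - (k + 1))] G) := by
      rw [← Function.iterate_add_apply]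
      congr 2
      omega
    rw [hlevel] at hadj
    set G' := R^[4 * (m - (k + 1))] G with hG'
    set j : Fin m := ⟨k, hk⟩ with hj
    set W := ⋃ (i : Fin m) (_ : (i : ℕ) < k), (F i).verts with hW
    have hfin : ∀ i, ∃ s : Finset α, (s : Set α) = (F i).verts ∧ s.card ≤ n + 3 := fun i => by
      obtain ⟨e⟩ := hcopies i
      refine ⟨Finset.univ.image fun z => (e.symm z : α), ?_,
        Finset.card_image_le.trans (by simp)⟩
      ext a
      simp only [Finset.coe_image, Finset.coe_univ, Set.image_univ, Set.mem_range]
      exact ⟨by rintro ⟨z, rfl⟩; exact (e.symm z).2, fun ha => ⟨e ⟨a, ha⟩, by simp⟩⟩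
    choose s hs hscard using hfin
    set U : Finset V := (Finset.univ.biUnion fun i : Fin m => if (i : ℕ) < k then s i else ∅).image φ
      with hU
    have hUcard : U.card ≤ m * (n + 3) := by
      refine Finset.card_image_le.trans ((Finset.card_biUnion_le_card_mul _ _ (n + 3) ?_).trans
        (by simp))
      intro i _
      split_ifs
      · exact hscard i
      · simp
    have hUW : ∀ a ∈ W, φ a ∈ U := by
      intro a ha
      simp only [hW, Set.mem_iUnion] at ha
      obtain ⟨i, hi, hai⟩ := ha
      refine Finset.mem_image_of_mem _ (Finset.mem_biUnion.2 ⟨i, Finset.mem_univ _, ?_⟩)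
      rw [if_pos hi, ← Finset.mem_coe, hs]
      exact hai
    obtain ⟨σ, hσ⟩ := exists_cyclicLabelling (hcopies j).some
    have hne : ∃ x y, (R^[4] G').Adj x y := by
      refine ⟨x, y, ?_⟩
      rw [← hlevel]
      rw [show 4 * m = 4 * k + 4 * (m - k) by omega, Function.iterate_add_apply] at hxy
      exact richCore_iterate_le _ _ _ _ hxy
    have hWadj : ∀ a ∈ W, ∃ y, (R^[4] G').Adj (φ a) y := by
      intro a ha
      simp only [hW, Set.mem_iUnion] at ha
      obtain ⟨i, hi, hai⟩ := ha
      obtain ⟨b, hb⟩ := exists_adj_of_mem_verts (hcopies i).some hai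
      exact ⟨_, hadj i hi a b hb⟩
    have hattach : (F j).verts ∩ W = ∅ ∨ (∃ a, (F j).verts ∩ W = {a}) ∨
        ∃ x y, (F j).Adj x y ∧ (R^[4] G').Adj (φ x) (φ y) ∧ (F j).verts ∩ W = {x, y} := by
      rcases Nat.eq_zero_or_pos k with rfl | hk0
      · left
        simp [hW]
      · rcases hF j hk0.ne' with h | h | ⟨u, w, huw, ⟨i, hi, hiuw⟩, h⟩
        · exact Or.inl h
        · exact Or.inr (Or.inl h)
        · exact Or.inr (Or.inr ⟨u, w, huw, hadj i hi u w hiuw, h⟩)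
    obtain ⟨ψ, hψ, hψadj, hψW, hψU⟩ :=
      exists_attach_cycle (by omega) hσ hUcard hne hWadj hattach
    refine ⟨fun a => if a ∈ (F j).verts then ψ a else φ a, ?_, ?_⟩
    · have hmem : ∀ a ∈ ⋃ (i : Fin m) (_ : (i : ℕ) < k + 1), (F i).verts,
          a ∉ (F j).verts → a ∈ W := by
        intro a ha haj
        simp only [Set.mem_iUnion] at ha
        obtain ⟨i, hi, hai⟩ := ha
        simp only [hW, Set.mem_iUnion]
        refine ⟨i, lt_of_le_of_ne (by omega) fun h => haj ?_, hai⟩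
        rwa [show j = i from Fin.ext h.symm]
      have hmix : ∀ a ∈ (F j).verts, ∀ b ∈ W, b ∉ (F j).verts → ψ a ≠ φ b := by
        intro a ha b hb hbj hab
        by_cases haW : a ∈ W
        · rw [hψW a ha haW] at hab
          exact hbj (hφ haW hb hab ▸ ha)
        · exact hψU a ha haW (hab ▸ hUW b hb)
      intro a ha b hb hab
      dsimp only at hab
      split_ifs at hab with haj hbj hbj
      · exact hψ haj hbj hab
      · exact absurd hab (hmix a haj b (hmem b hb hbj) hbj)
      · exact absurd hab.symm (hmix b hbj a (hmem a ha haj) haj)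
      · exact hφ (hmem a ha haj) (hmem b hb hbj) hab
    · intro i hi a b hab
      dsimp only
      by_cases hij : i = j
      · subst hij
        rw [if_pos ((F _).edge_vert hab), if_pos ((F _).edge_vert hab.symm)]
        exact hψadj a b hab
      · have hik : (i : ℕ) < k :=
          lt_of_le_of_ne (by omega) fun h => hij (Fin.ext h)
        have hext : ∀ a ∈ (F i).verts, (if a ∈ (F j).verts then ψ a else φ a) = φ a := by
          intro a ha
          split_ifs with haj
          · exact hψW a haj (Set.mem_iUnion₂.2 ⟨i, hik, ha⟩)
          · rfl
        rw [hext a ((F i).edge_vert hab), hext b ((F i).edge_vert hab.symm)]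
        exact richCore_iterate_le _ _ 4 G' (hadj i hik a b hab)

lemma ArrowNNI.not_cycleColorable {V : Type*} {G : SimpleGraph V} {n r s : ℕ}
    (h : ArrowNNI G (cycleGraph (n + 3)) r) (hs : s ≤ r) : ¬ CycleColorable G (n + 3) s := by
  rintro ⟨c, hc, hcv⟩
  obtain ⟨f, hf, k, hk⟩ := h fun e => ⟨c e, (hc e).trans_le hs⟩
  have hadj : ∀ i : Fin (n + 3), (cycleGraph (n + 3)).Adj i (i + 1) := fun i =>
    cycleGraph_adj.2 (Or.inr (by simp))
  exact hcv f ⟨hf, fun i => f.map_rel (hadj i)⟩ k fun i => congrArg Fin.val (hk _ _ (hadj i))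

/-- For `F = C_ℓ` the cycle of length `ℓ ≥ 3` and every forest `𝒻` of copies of `F`
(realised as subgraphs of the complete graph on `ℕ`), there is some `r ≥ 2` such that
every graph `G` with `G →nni (F)_r` contains a subgraph isomorphic to `⋃𝒻`. -/
theorem forcing_forests_of_cycles (ℓ : ℕ) (hℓ : 3 ≤ ℓ)
    (𝒻 : Set (Subgraph (⊤ : SimpleGraph ℕ)))
    (hforest : IsForestOfCopies 𝒻)
    (hcopies : ∀ H ∈ 𝒻, Nonempty (H.coe ≃g cycleGraph ℓ)) :
    ∃ r : ℕ, 2 ≤ r ∧ ∀ (V : Type) (G : SimpleGraph V),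
      ArrowNNI G (cycleGraph ℓ) r →
      ∃ f : (sSup 𝒻 : Subgraph (⊤ : SimpleGraph ℕ)).coe →g G, Function.Injective f := by
  obtain ⟨n, rfl⟩ : ∃ n, ℓ = n + 3 := ⟨ℓ - 3, by omega⟩
  obtain ⟨m, F, -, hmem, hF⟩ := hforest
  have hFcopies : ∀ i, Nonempty ((F i).coe ≃g cycleGraph (n + 3)) := fun i =>
    hcopies _ ((hmem _).2 ⟨i, rfl⟩)
  refine ⟨4 * m * poorColors (n + 3) (m * (n + 3)) + 2, by omega, fun V G hG => ?_⟩
  by_cases hne : ∃ x y, ((richCore (n + 3) (m * (n + 3)))^[4 * m] G).Adj x y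
  · obtain ⟨x, y, hxy⟩ := hne
    obtain ⟨φ, hφ, hadj⟩ := exists_embedding_of_forestCond hF hFcopies hxy
    refine ⟨⟨fun a => φ a, ?_⟩, ?_⟩
    · rintro ⟨a, ha⟩ ⟨b, hb⟩ hab
      obtain ⟨H, hH, hab⟩ := Subgraph.sSup_adj.1 hab
      obtain ⟨i, rfl⟩ := (hmem H).1 hH
      exact hadj i a b hab
    · have hverts : ∀ a ∈ (sSup 𝒻 : Subgraph (⊤ : SimpleGraph ℕ)).verts,
          a ∈ ⋃ i, (F i).verts := by
        intro a ha
        rw [Subgraph.verts_sSup] at ha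
        obtain ⟨H, hH, haH⟩ := Set.mem_iUnion₂.1 ha
        obtain ⟨i, rfl⟩ := (hmem H).1 hH
        exact Set.mem_iUnion.2 ⟨i, haH⟩
      rintro ⟨a, ha⟩ ⟨b, hb⟩ hab
      exact Subtype.ext (hφ (hverts a ha) (hverts b hb) hab)
  · refine absurd (CycleColorable.of_richCore_iterate (K := m * (n + 3)) (r := 1) hℓ (4 * m) ?_)
      (hG.not_cycleColorable (by omega))
    exact ⟨fun _ => 0, by simp, fun v hv => absurd ⟨_, _, hv.adj 0⟩ hne⟩
end

section
/- Let F be a balanced complete multipartite graph (a complete multipartite graph all of whose parts have the same size) with at least two edges. For every forest 𝒻 of copies of F there exists an integer r ≥ 2 such that every graph G satisfying G →nni (F)_r contains a subgraph isomorphic to ⋃𝒻. -/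
open SimpleGraph

/-- `IsExtensible F D w`: every arc of `F` can be mapped to any arc of `D` by an embedding of `F`
into `D` whose remaining vertices avoid a prescribed set of at most `w` vertices. -/
def IsExtensible {V α : Type*} (F : SimpleGraph α) (D : SimpleGraph V) (w : ℕ) : Prop :=
  ∀ u v, D.Adj u v → ∀ W : Finset V, W.card ≤ w → ∀ p q, F.Adj p q →
    ∃ g : F →g D, Function.Injective g ∧ g p = u ∧ g q = v ∧ ∀ z, g z ∈ W → z = p ∨ z = q

section Multipartite

variable {t s : ℕ}

theorem exists_adj_of_two_le_ncard
    (hE : 2 ≤ (completeMultipartiteGraph fun _ : Fin t => Fin s).edgeSet.ncard)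
    (p : Σ _ : Fin t, Fin s) :
    ∃ q, (completeMultipartiteGraph fun _ : Fin t => Fin s).Adj p q := by
  obtain ⟨e, he⟩ : (completeMultipartiteGraph fun _ : Fin t => Fin s).edgeSet.Nonempty :=
    Set.nonempty_of_ncard_ne_zero (by omega)
  induction e using Sym2.ind with
  | _ a b =>
    have hab : a.1 ≠ b.1 := he
    by_cases h : p.1 = a.1
    · exact ⟨b, show p.1 ≠ b.1 from h ▸ hab⟩
    · exact ⟨a, h⟩

theorem exists_adj_ne_of_two_le_ncard
    (hE : 2 ≤ (completeMultipartiteGraph fun _ : Fin t => Fin s).edgeSet.ncard)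
    {p q : Σ _ : Fin t, Fin s}
    (hpq : (completeMultipartiteGraph fun _ : Fin t => Fin s).Adj p q) :
    ∃ q', q' ≠ q ∧ (completeMultipartiteGraph fun _ : Fin t => Fin s).Adj p q' := by
  by_contra! hcon
  have hpq' : p.1 ≠ q.1 := hpq
  have hq : ∀ z : Σ _ : Fin t, Fin s, z.1 ≠ p.1 → z = q := fun z hz => by
    by_contra hne
    exact hcon z hne (show p.1 ≠ z.1 from hz.symm)
  have hsnd : ∀ i : Fin s, i = q.2 := fun i => by
    have := hq ⟨q.1, i⟩ hpq'.symm
    rw [Sigma.ext_iff] at this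
    exact eq_of_heq this.2
  have hp : ∀ z : Σ _ : Fin t, Fin s, z.1 = p.1 → z = p := fun z hz =>
    Sigma.ext hz (heq_of_eq ((hsnd _).trans (hsnd _).symm))
  have hsub : (completeMultipartiteGraph fun _ : Fin t => Fin s).edgeSet ⊆ {s(p, q)} := by
    intro e he
    induction e using Sym2.ind with
    | _ a b =>
      have hab : a.1 ≠ b.1 := he
      by_cases ha : a.1 = p.1
      · rw [hp a ha, hq b (fun hb => hab (ha.trans hb.symm))]
        rfl
      · have hb : b.1 = p.1 := by
          by_contra hb
          exact hab (by rw [hq a ha, hq b hb])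
        rw [hp b hb, hq a ha]
        exact Sym2.eq_swap
  have := Set.ncard_le_ncard hsub (Set.finite_singleton _)
  rw [Set.ncard_singleton] at this
  omega

theorem exists_injective_hom_map_arc {p q a b : Σ _ : Fin t, Fin s}
    (hpq : (completeMultipartiteGraph fun _ : Fin t => Fin s).Adj p q)
    (hab : (completeMultipartiteGraph fun _ : Fin t => Fin s).Adj a b) :
    ∃ φ : (completeMultipartiteGraph fun _ : Fin t => Fin s) →g
        (completeMultipartiteGraph fun _ : Fin t => Fin s),
      Function.Injective φ ∧ φ p = a ∧ φ q = b := by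
  have hpq' : p.1 ≠ q.1 := hpq
  have hab' : a.1 ≠ b.1 := hab
  obtain ⟨π, hπp, hπq⟩ : ∃ π : Equiv.Perm (Fin t), π p.1 = a.1 ∧ π q.1 = b.1 := by
    refine ⟨(Equiv.swap p.1 a.1).trans (Equiv.swap (Equiv.swap p.1 a.1 q.1) b.1), ?_, ?_⟩
    · rw [Equiv.trans_apply, Equiv.swap_apply_left]
      refine Equiv.swap_apply_of_ne_of_ne ?_ hab'
      intro h
      have h' := congrArg (Equiv.swap p.1 a.1) h
      rw [Equiv.swap_apply_right, Equiv.swap_apply_self] at h'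
      exact hpq' h'
    · rw [Equiv.trans_apply, Equiv.swap_apply_left]
  let σ : Fin t → Equiv.Perm (Fin s) := fun i =>
    if i = p.1 then Equiv.swap p.2 a.2 else Equiv.swap q.2 b.2
  refine ⟨⟨fun x => ⟨π x.1, σ x.1 x.2⟩, ?_⟩, ?_, ?_, ?_⟩
  · intro x y (hxy : x.1 ≠ y.1)
    exact fun h => hxy (π.injective h)
  · rintro ⟨i, x⟩ ⟨j, y⟩ h
    obtain ⟨h1, h2⟩ := Sigma.ext_iff.1 h
    obtain rfl : i = j := π.injective h1
    obtain rfl : x = y := (σ i).injective (eq_of_heq h2)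
    rfl
  · exact Sigma.ext hπp (heq_of_eq (show σ p.1 p.2 = a.2 by simp [σ]))
  · exact Sigma.ext hπq (heq_of_eq (show σ q.1 q.2 = b.2 by simp [σ, hpq'.symm]))

end Multipartite

section Critical

variable {V α : Type*} {G : SimpleGraph V} {F : SimpleGraph α}

/-- By compactness, the arrow relation is already witnessed by a finite family of copies. -/
theorem ArrowNNI.exists_finset [Finite α] {r : ℕ} (hG : ArrowNNI G F r) :
    ∃ C : Finset {f : F →g G // Function.Injective f}, ∀ c : Sym2 V → Fin r,
      ∃ f ∈ C, ∃ k, ∀ x y, F.Adj x y → c s(f.1 x, f.1 y) = k := by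
  let S : {f : F →g G // Function.Injective f} → Set (Sym2 V → Fin r) := fun f =>
    {c | ¬ ∃ k, ∀ x y, F.Adj x y → c s(f.1 x, f.1 y) = k}
  have hS : ∀ f, IsClosed (S f) := fun f => by
    have hcont : Continuous fun (c : Sym2 V → Fin r) (p : α × α) => c s(f.1 p.1, f.1 p.2) := by
      fun_prop
    exact (isClosed_discrete
      {d : α × α → Fin r | ¬ ∃ k, ∀ x y, F.Adj x y → d (x, y) = k}).preimage hcont
  obtain ⟨C, hC⟩ := isCompact_univ.elim_finite_subfamily_closed S hS (by
    rw [Set.univ_inter, Set.eq_empty_iff_forall_notMem]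
    intro c hc
    obtain ⟨f, hf, hk⟩ := hG c
    exact Set.mem_iInter.1 hc ⟨f, hf⟩ hk)
  refine ⟨C, fun c => ?_⟩
  by_contra! hcon
  rw [Set.univ_inter, Set.eq_empty_iff_forall_notMem] at hC
  refine hC c (Set.mem_iInter₂.2 fun f hf => ?_)
  rintro ⟨k, hk⟩
  obtain ⟨x, y, hxy, hne⟩ := hcon f hf k
  exact hne (hk x y hxy)

/-- A finite critical family of copies: through every edge there are, for a suitable colouring,
copies which are monochromatic in each colour up to that edge. -/
theorem ArrowNNI.exists_critical [Finite α] {r : ℕ} (hr : 0 < r) (hG : ArrowNNI G F r) :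
    ∃ C : Set {f : F →g G // Function.Injective f}, C.Nonempty ∧
      ∀ f₀ ∈ C, ∀ a b, F.Adj a b → ∃ c : Sym2 V → Fin r, ∀ k, ∃ f ∈ C,
        (∃ a' b', F.Adj a' b' ∧ s(f.1 a', f.1 b') = s(f₀.1 a, f₀.1 b)) ∧
        ∀ x y, F.Adj x y → s(f.1 x, f.1 y) ≠ s(f₀.1 a, f₀.1 b) → c s(f.1 x, f.1 y) = k := by
  classical
  obtain ⟨C, hC, hmin⟩ := wellFounded_lt.has_min
    {C : Finset {f : F →g G // Function.Injective f} | ∀ c : Sym2 V → Fin r,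
      ∃ f ∈ C, ∃ k, ∀ x y, F.Adj x y → c s(f.1 x, f.1 y) = k} hG.exists_finset
  refine ⟨C, ?_, fun f₀ hf₀ a b hab => ?_⟩
  · obtain ⟨f, hf, -⟩ := hC fun _ => ⟨0, hr⟩
    exact ⟨f, hf⟩
  · set e := s(f₀.1 a, f₀.1 b) with he
    let C' := C.filter fun f => ∀ x y, F.Adj x y → s(f.1 x, f.1 y) ≠ e
    have hlt : C' < C := by
      refine Finset.filter_ssubset.2 ⟨f₀, hf₀, fun h => h a b hab rfl⟩
    have hC' : ¬ ∀ c : Sym2 V → Fin r,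
        ∃ f ∈ C', ∃ k, ∀ x y, F.Adj x y → c s(f.1 x, f.1 y) = k := fun h => hmin C' h hlt
    push Not at hC'
    obtain ⟨c, hc⟩ := hC'
    refine ⟨c, fun k => ?_⟩
    obtain ⟨f, hf, k', hk'⟩ := hC (Function.update c e k)
    have hmem : ∃ a' b', F.Adj a' b' ∧ s(f.1 a', f.1 b') = e := by
      by_contra! hno
      obtain ⟨x, y, hxy, hne⟩ := hc f (Finset.mem_filter.2 ⟨hf, hno⟩) k'
      have := hk' x y hxy
      rw [Function.update_of_ne (hno x y hxy)] at this
      exact hne this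
    refine ⟨f, hf, hmem, fun x y hxy hne => ?_⟩
    obtain ⟨a', b', hab', he'⟩ := hmem
    have h1 := hk' a' b' hab'
    rw [he', Function.update_self] at h1
    have h2 := hk' x y hxy
    rw [Function.update_of_ne hne] at h2
    exact h2.trans h1.symm

/-- If no vertex of `F` is non-adjacent to both ends of an edge and `F` is arc-transitive, then
a graph arrowing `F` has a subgraph that is extensible. -/
theorem ArrowNNI.exists_isExtensible [Finite α] {w : ℕ}
    (hdom : ∀ a b, F.Adj a b → ∀ z, F.Adj a z ∨ F.Adj b z)
    (htrans : ∀ p q a b, F.Adj p q → F.Adj a b →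
      ∃ φ : F →g F, Function.Injective φ ∧ φ p = a ∧ φ q = b)
    (hF : ∃ a b, F.Adj a b) (hG : ArrowNNI G F (2 * w + 2)) :
    ∃ D ≤ G, (∃ u v, D.Adj u v) ∧ IsExtensible F D w := by
  classical
  obtain ⟨C, ⟨f₁, hf₁⟩, hC⟩ := hG.exists_critical (by omega)
  let D : SimpleGraph V :=
    { Adj := fun u v => ∃ f ∈ C, ∃ a b, F.Adj a b ∧ f.1 a = u ∧ f.1 b = v
      symm := ⟨by
        rintro u v ⟨f, hf, a, b, hab, ha, hb⟩
        exact ⟨f, hf, b, a, hab.symm, hb, ha⟩⟩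
      loopless := ⟨by
        rintro u ⟨f, hf, a, b, hab, ha, hb⟩
        exact hab.ne (f.2 (ha.trans hb.symm))⟩ }
  refine ⟨D, ?_, ?_, ?_⟩
  · rintro u v ⟨f, hf, a, b, hab, rfl, rfl⟩
    exact f.1.map_adj hab
  · obtain ⟨a, b, hab⟩ := hF
    exact ⟨f₁.1 a, f₁.1 b, f₁, hf₁, a, b, hab, rfl, rfl⟩
  · rintro u v ⟨f₀, hf₀, a₀, b₀, hab₀, rfl, rfl⟩ W hW p q hpq
    obtain ⟨c, hc⟩ := hC f₀ hf₀ a₀ b₀ hab₀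
    set u := f₀.1 a₀
    set v := f₀.1 b₀
    have hc' : ∀ k, ∃ f ∈ C, ∃ a b, F.Adj a b ∧ f.1 a = u ∧ f.1 b = v ∧
        ∀ x y, F.Adj x y → s(f.1 x, f.1 y) ≠ s(u, v) → c s(f.1 x, f.1 y) = k := by
      intro k
      obtain ⟨f, hf, ⟨a, b, hab, he⟩, hcol⟩ := hc k
      rcases Sym2.eq_iff.1 he with ⟨h1, h2⟩ | ⟨h1, h2⟩
      · exact ⟨f, hf, a, b, hab, h1, h2, hcol⟩
      · exact ⟨f, hf, b, a, hab.symm, h2, h1, hcol⟩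
    choose f hf a b hab ha hb hcol using hc'
    obtain ⟨k, hk⟩ : ∃ k, ∀ z, (f k).1 z ∈ W → z = a k ∨ z = b k := by
      by_contra! hbad
      choose z hzW hza hzb using hbad
      obtain ⟨k, -, k', -, hkk, heq⟩ := Finset.exists_ne_map_eq_of_card_lt_of_maps_to
        (s := Finset.univ) (t := W ×ˢ (Finset.univ : Finset Bool))
        (f := fun k => ((f k).1 (z k), decide (F.Adj (a k) (z k))))
        (by simp only [Finset.card_product, Finset.card_univ, Fintype.card_bool, Fintype.card_fin]
            omega)
        (fun k _ => by simp [hzW k, em])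
      obtain ⟨hz, hadj⟩ := Prod.ext_iff.1 heq
      have hz : (f k).1 (z k) = (f k').1 (z k') := hz
      have hadj : F.Adj (a k) (z k) ↔ F.Adj (a k') (z k') := decide_eq_decide.1 hadj
      have hu : ∀ i, (f i).1 (z i) ≠ u := fun i h => hza i ((f i).2 (h.trans (ha i).symm))
      have hv : ∀ i, (f i).1 (z i) ≠ v := fun i h => hzb i ((f i).2 (h.trans (hb i).symm))
      have hcu : ∀ i, F.Adj (a i) (z i) → c s(u, (f i).1 (z i)) = i := fun i hi => by
        have h := hcol i _ _ hi
        rw [ha i] at h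
        refine h fun he => ?_
        rcases Sym2.eq_iff.1 he with ⟨-, h2⟩ | ⟨-, h2⟩
        · exact hv i h2
        · exact hu i h2
      have hcv : ∀ i, F.Adj (b i) (z i) → c s(v, (f i).1 (z i)) = i := fun i hi => by
        have h := hcol i _ _ hi
        rw [hb i] at h
        refine h fun he => ?_
        rcases Sym2.eq_iff.1 he with ⟨-, h2⟩ | ⟨-, h2⟩
        · exact hv i h2
        · exact hu i h2
      by_cases h : F.Adj (a k) (z k)
      · exact hkk (by rw [← hcu k h, hz, hcu k' (hadj.1 h)])
      · have h1 := (hdom _ _ (hab k) (z k)).resolve_left h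
        have h2 := (hdom _ _ (hab k') (z k')).resolve_left (mt hadj.2 h)
        exact hkk (by rw [← hcv k h1, hz, hcv k' h2])
    obtain ⟨φ, hφ, hφp, hφq⟩ := htrans p q (a k) (b k) hpq (hab k)
    refine ⟨⟨fun x => (f k).1 (φ x), fun {x y} hxy =>
      ⟨f k, hf k, φ x, φ y, φ.map_adj hxy, rfl, rfl⟩⟩, fun x y h => hφ ((f k).2 h), ?_, ?_, ?_⟩
    · exact (congrArg (f k).1 hφp).trans (ha k)
    · exact (congrArg (f k).1 hφq).trans (hb k)
    · intro z hz
      rcases hk (φ z) hz with h | h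
      · exact Or.inl (hφ (h.trans hφp.symm))
      · exact Or.inr (hφ (h.trans hφq.symm))

end Critical

section Extensible

variable {V α : Type*} {D : SimpleGraph V} {F : SimpleGraph α} {w : ℕ}

theorem IsExtensible.exists_of_vertex (h : IsExtensible F D w) (hdeg : ∀ p, ∃ q, F.Adj p q)
    (hdeg' : ∀ p q, F.Adj p q → ∃ q', q' ≠ q ∧ F.Adj p q') {u v : V} (huv : D.Adj u v)
    {W : Finset V} (hW : W.card ≤ w) (p : α) :
    ∃ g : F →g D, Function.Injective g ∧ g p = u ∧ ∀ z, g z ∈ W → z = p := by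
  obtain ⟨q, hq⟩ := hdeg p
  obtain ⟨q', hne, hq'⟩ := hdeg' p q hq
  obtain ⟨g₁, -, hp₁, -, hW₁⟩ := h u v huv W hW p q hq
  obtain ⟨g₂, hg₂, hp₂, hq₂, hW₂⟩ := h u (g₁ q') (hp₁ ▸ g₁.map_adj hq') W hW p q' hq'
  refine ⟨g₂, hg₂, hp₂, fun z hz => (hW₂ z hz).resolve_right ?_⟩
  rintro rfl
  rw [hq₂] at hz
  rcases hW₁ z hz with h | h
  · exact hq'.ne h.symm
  · exact hne h

theorem IsExtensible.exists_disjoint (h : IsExtensible F D w) (hdeg : ∀ p, ∃ q, F.Adj p q)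
    (hdeg' : ∀ p q, F.Adj p q → ∃ q', q' ≠ q ∧ F.Adj p q') (hF : Nonempty α)
    (hD : ∃ u v, D.Adj u v) {W : Finset V} (hW : W.card ≤ w) :
    ∃ g : F →g D, Function.Injective g ∧ ∀ z, g z ∉ W := by
  obtain ⟨p⟩ := hF
  obtain ⟨u, v, huv⟩ := hD
  obtain ⟨q, hq⟩ := hdeg p
  obtain ⟨g₁, -, -, hW₁⟩ := h.exists_of_vertex hdeg hdeg' huv hW p
  obtain ⟨g₂, hg₂, hq₂, hW₂⟩ :=
    h.exists_of_vertex hdeg hdeg' (g₁.map_adj hq.symm) hW q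
  refine ⟨g₂, hg₂, fun z hz => ?_⟩
  obtain rfl := hW₂ z hz
  rw [hq₂] at hz
  exact hq.ne (hW₁ z hz).symm

/-- An extensible graph contains every forest of copies with at most `w` vertices. -/
theorem IsExtensible.exists_embedding_forest {U : Type*} {K : SimpleGraph U} {m : ℕ}
    {A : Fin m → K.Subgraph} (hA : ForestCond A) (e : ∀ i, (A i).coe ≃g F)
    (h : IsExtensible F D w) (hdeg : ∀ p, ∃ q, F.Adj p q)
    (hdeg' : ∀ p q, F.Adj p q → ∃ q', q' ≠ q ∧ F.Adj p q') (hF : Nonempty α)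
    (hD : ∃ u v, D.Adj u v) {T : Finset U} (hT : ∀ i, (A i).verts ⊆ T) (hTw : T.card ≤ w)
    (n : ℕ) (hn : n ≤ m) :
    ∃ φ : U → V, (∀ i j : Fin m, (i : ℕ) < n → (j : ℕ) < n → ∀ x ∈ (A i).verts,
        ∀ y ∈ (A j).verts, φ x = φ y → x = y) ∧
      ∀ i : Fin m, (i : ℕ) < n → ∀ x y, (A i).Adj x y → D.Adj (φ x) (φ y) := by
  classical
  induction n with
  | zero =>
    obtain ⟨u, -, -⟩ := hD
    exact ⟨fun _ => u, by simp, by simp⟩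
  | succ n ih =>
    obtain ⟨φ, hinj, hadj⟩ := ih (by omega)
    let j : Fin m := ⟨n, by omega⟩
    have hW : (T.image φ).card ≤ w := Finset.card_image_le.trans hTw
    have key : ∃ g : F →g D, Function.Injective g ∧ ∀ x (hx : x ∈ (A j).verts),
        ((∃ i, i < j ∧ x ∈ (A i).verts) → g (e j ⟨x, hx⟩) = φ x) ∧
        (g (e j ⟨x, hx⟩) ∈ T.image φ → ∃ i, i < j ∧ x ∈ (A i).verts) := by
      have hdisj : ((A j).verts ∩ ⋃ (i : Fin m) (_ : i < j), (A i).verts) = ∅ →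
          ∃ g : F →g D, Function.Injective g ∧ ∀ x (hx : x ∈ (A j).verts),
          ((∃ i, i < j ∧ x ∈ (A i).verts) → g (e j ⟨x, hx⟩) = φ x) ∧
          (g (e j ⟨x, hx⟩) ∈ T.image φ → ∃ i, i < j ∧ x ∈ (A i).verts) := by
        intro hempty
        obtain ⟨g, hg, hgW⟩ := h.exists_disjoint hdeg hdeg' hF hD hW
        refine ⟨g, hg, fun x hx => ⟨?_, fun hx' => (hgW _ hx').elim⟩⟩
        rintro ⟨i, hi, hxi⟩
        have : x ∈ (A j).verts ∩ ⋃ (i : Fin m) (_ : i < j), (A i).verts :=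
          ⟨hx, Set.mem_iUnion₂.2 ⟨i, hi, hxi⟩⟩
        rw [hempty] at this
        exact this.elim
      by_cases hj : (j : ℕ) = 0
      · refine hdisj (Set.eq_empty_of_forall_notMem ?_)
        rintro x ⟨-, hx⟩
        obtain ⟨i, hi, -⟩ := Set.mem_iUnion₂.1 hx
        exact absurd (Fin.lt_def.1 hi) (by omega)
      rcases hA j hj with hempty | ⟨v, hv⟩ | ⟨x₀, y₀, hxy, ⟨i₀, hi₀, hxy'⟩, hv⟩
      · exact hdisj hempty
      · have hmem : ∀ x, (x ∈ (A j).verts ∧ ∃ i, i < j ∧ x ∈ (A i).verts) ↔ x = v := by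
          intro x
          have := Set.ext_iff.1 hv x
          simpa using this
        obtain ⟨hvj, i, hi, hvi⟩ := (hmem v).2 rfl
        obtain ⟨q, hq⟩ := hdeg (e i ⟨v, hvi⟩)
        have hq' : (A i).Adj v ((e i).symm q) := by
          have := (e i).symm.map_adj_iff.2 hq
          rw [RelIso.symm_apply_apply] at this
          exact this
        obtain ⟨g, hg, hgv, hgW⟩ :=
          h.exists_of_vertex hdeg hdeg' (hadj i hi _ _ hq') hW (e j ⟨v, hvj⟩)
        refine ⟨g, hg, fun x hx => ⟨fun hx' => ?_, fun hx' => ?_⟩⟩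
        · obtain rfl := (hmem x).1 ⟨hx, hx'⟩
          exact hgv
        · have := congrArg Subtype.val ((e j).injective (hgW _ hx'))
          exact ((hmem x).2 this).2
      · have hmem : ∀ x, (x ∈ (A j).verts ∧ ∃ i, i < j ∧ x ∈ (A i).verts) ↔
            (x = x₀ ∨ x = y₀) := by
          intro x
          have := Set.ext_iff.1 hv x
          simpa using this
        have hadj' : F.Adj (e j ⟨x₀, hxy.fst_mem⟩) (e j ⟨y₀, hxy.snd_mem⟩) :=
          (e j).map_adj_iff.2 hxy
        obtain ⟨g, hg, hgx, hgy, hgW⟩ :=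
          h _ _ (hadj i₀ hi₀ _ _ hxy') _ hW _ _ hadj'
        refine ⟨g, hg, fun x hx => ⟨fun hx' => ?_, fun hx' => ?_⟩⟩
        · rcases (hmem x).1 ⟨hx, hx'⟩ with rfl | rfl
          · exact hgx
          · exact hgy
        · refine ((hmem x).2 ?_).2
          rcases hgW _ hx' with h' | h'
          · exact Or.inl (congrArg Subtype.val ((e j).injective h'))
          · exact Or.inr (congrArg Subtype.val ((e j).injective h'))
    obtain ⟨g, hg, hgφ⟩ := key
    let ψ : U → V := fun x => if hx : x ∈ (A j).verts then g (e j ⟨x, hx⟩) else φ x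
    have hψj : ∀ x (hx : x ∈ (A j).verts), ψ x = g (e j ⟨x, hx⟩) := fun x hx => dif_pos hx
    have hψ : ∀ i : Fin m, i < j → ∀ x ∈ (A i).verts, ψ x = φ x := by
      intro i hi x hx
      by_cases hxj : x ∈ (A j).verts
      · rw [hψj x hxj]
        exact (hgφ x hxj).1 ⟨i, hi, hx⟩
      · exact dif_neg hxj
    have hcases : ∀ i : Fin m, (i : ℕ) < n + 1 → i < j ∨ i = j := by
      intro i hi
      rcases Nat.lt_succ_iff_lt_or_eq.1 hi with h' | h'
      · exact Or.inl h'
      · exact Or.inr (Fin.ext h')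
    have hcross : ∀ i : Fin m, i < j → ∀ x ∈ (A i).verts, ∀ y ∈ (A j).verts,
        ψ x = ψ y → x = y := by
      intro i hi x hx y hy hxy
      have hyW : g (e j ⟨y, hy⟩) ∈ T.image φ := by
        rw [← hψj y hy, ← hxy, hψ i hi x hx]
        exact Finset.mem_image_of_mem φ (hT i hx)
      obtain ⟨i', hi', hy'⟩ := (hgφ y hy).2 hyW
      rw [hψ i hi x hx, hψ i' hi' y hy'] at hxy
      exact hinj i i' hi hi' x hx y hy' hxy
    refine ⟨ψ, fun i i' hi hi' x hx y hy hxy => ?_, fun i hi x y hxy => ?_⟩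
    · rcases hcases i hi with hij | rfl <;> rcases hcases i' hi' with hij' | rfl
      · rw [hψ i hij x hx, hψ i' hij' y hy] at hxy
        exact hinj i i' hij hij' x hx y hy hxy
      · exact hcross i hij x hx y hy hxy
      · exact (hcross i' hij' y hy x hx hxy.symm).symm
      · rw [hψj x hx, hψj y hy] at hxy
        exact congrArg Subtype.val ((e j).injective (hg hxy))
    · rcases hcases i hi with hij | rfl
      · rw [hψ i hij x hxy.fst_mem, hψ i hij y hxy.snd_mem]
        exact hadj i hij x y hxy
      · rw [hψj x hxy.fst_mem, hψj y hxy.snd_mem]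
        exact g.map_adj ((e j).map_adj_iff.2 hxy)

end Extensible

/-- Let `F` be a balanced complete multipartite graph (with `t` parts of size `s`) having
at least two edges.  For every forest `𝒻` of copies of `F` (realised as subgraphs of the
complete graph on `ℕ`) there is some `r ≥ 2` such that every graph `G` with
`G →nni (F)_r` contains a subgraph isomorphic to `⋃𝒻`. -/
theorem forcing_forests_of_balanced_complete_multipartite (t s : ℕ)
    (hE : 2 ≤ (completeMultipartiteGraph fun _ : Fin t => Fin s).edgeSet.ncard)
    (𝒻 : Set (Subgraph (⊤ : SimpleGraph ℕ)))
    (hforest : IsForestOfCopies 𝒻)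
    (hcopies : ∀ H ∈ 𝒻,
      Nonempty (H.coe ≃g completeMultipartiteGraph fun _ : Fin t => Fin s)) :
    ∃ r : ℕ, 2 ≤ r ∧ ∀ (V : Type) (G : SimpleGraph V),
      ArrowNNI G (completeMultipartiteGraph fun _ : Fin t => Fin s) r →
      ∃ f : (sSup 𝒻 : Subgraph (⊤ : SimpleGraph ℕ)).coe →g G, Function.Injective f := by
  classical
  obtain ⟨m, A, -, hmem, hA⟩ := hforest
  have e : ∀ i, (A i).coe ≃g completeMultipartiteGraph fun _ : Fin t => Fin s :=
    fun i => (hcopies _ ((hmem _).2 ⟨i, rfl⟩)).some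
  have hfin : (⋃ i, (A i).verts).Finite := Set.finite_iUnion fun i =>
    Set.finite_coe_iff.1 (Finite.of_equiv _ (e i).symm.toEquiv)
  have hdeg := exists_adj_of_two_le_ncard hE
  obtain ⟨a, b, hab⟩ : ∃ a b, (completeMultipartiteGraph fun _ : Fin t => Fin s).Adj a b := by
    obtain ⟨x, hx⟩ : (completeMultipartiteGraph fun _ : Fin t => Fin s).edgeSet.Nonempty :=
      Set.nonempty_of_ncard_ne_zero (by omega)
    induction x using Sym2.ind with
    | _ a b => exact ⟨a, b, hx⟩
  refine ⟨2 * hfin.toFinset.card + 2, by omega, fun V G hG => ?_⟩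
  obtain ⟨D, hDG, hD, hext⟩ := hG.exists_isExtensible
    (fun a b (hab : a.1 ≠ b.1) z => by
      by_cases h : a.1 = z.1
      · exact Or.inr (show b.1 ≠ z.1 from h ▸ hab.symm)
      · exact Or.inl h)
    (fun _ _ _ _ => exists_injective_hom_map_arc) ⟨a, b, hab⟩
  obtain ⟨φ, hinj, hadj⟩ := hext.exists_embedding_forest hA e hdeg
    (fun _ _ => exists_adj_ne_of_two_le_ncard hE) ⟨a⟩ hD
    (fun i x hx => hfin.mem_toFinset.2 (Set.mem_iUnion.2 ⟨i, hx⟩)) le_rfl m le_rfl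
  have hverts : ∀ x ∈ (sSup 𝒻).verts, ∃ i, x ∈ (A i).verts := by
    intro x hx
    rw [Subgraph.verts_sSup] at hx
    obtain ⟨H, hH, hxH⟩ := Set.mem_iUnion₂.1 hx
    obtain ⟨i, rfl⟩ := (hmem H).1 hH
    exact ⟨i, hxH⟩
  refine ⟨⟨fun x => φ x, fun {x y} hxy => ?_⟩, fun x y hxy => Subtype.ext ?_⟩
  · obtain ⟨H, hH, hxyH⟩ := Subgraph.sSup_adj.1 hxy
    obtain ⟨i, rfl⟩ := (hmem H).1 hH
    exact hDG (hadj i i.2 _ _ hxyH)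
  · obtain ⟨i, hi⟩ := hverts x x.2
    obtain ⟨i', hi'⟩ := hverts y y.2
    exact hinj i i' i.2 i'.2 _ hi _ hi' hxy
end

section
/- For every graph F containing a cycle and all integers r ≥ 2 and n ≥ 1 there exists a graph G with G → (F)_r such that every subgraph H ⊆ G on at most n vertices satisfies H ↛nni (F)_2, i.e., there is a 2-colouring of the edges of H with no monochromatic subgraph isomorphic to F. -/
open SimpleGraph

/-- `G → (F)_r` : every `r`-colouring of the edges of `G` yields a monochromatic
induced copy of `F` in `G`. -/
def ArrowInd {V α : Type*} (G : SimpleGraph V) (F : SimpleGraph α) (r : ℕ) : Prop :=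
  ∀ c : Sym2 V → Fin r, ∃ f : F ↪g G, ∃ k : Fin r,
    ∀ x y, F.Adj x y → c s(f x, f y) = k

namespace HypergraphContainer

open Finset

/-- The number of `j`-element members of `𝒢` containing `L`. -/
def levelDegree {X : Type*} [DecidableEq X] (𝒢 : Finset (Finset X)) (j : ℕ) (L : Finset X) : ℕ :=
  #{E ∈ 𝒢 | #E = j ∧ L ⊆ E}

def weight (k Q l : ℕ) : ℕ := if l < k then (3 * Q) ^ (k - l) else 0

def potential {X : Type*} (k Q : ℕ) (𝒢 : Finset (Finset X)) : ℕ := ∑ E ∈ 𝒢, weight k Q #E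

/-- The antichains `𝒢` of forbidden sets that occur while a container for a `𝒢`-independent set
is being computed; `H` is the original `k`-uniform hypergraph. -/
structure IsForbiddenFamily {X : Type*} [DecidableEq X] (H : Finset (Finset X)) (k Q : ℕ)
    (𝒢 : Finset (Finset X)) : Prop where
  antichain : ∀ E ∈ 𝒢, ∀ E' ∈ 𝒢, E ⊆ E' → E = E'
  nonempty : ∀ E ∈ 𝒢, E.Nonempty
  card_le : ∀ E ∈ 𝒢, #E ≤ k
  covers : ∀ T ∈ H, ∃ E ∈ 𝒢, E ⊆ T
  degree_le : ∀ (L : Finset X) (j : ℕ), L.Nonempty → #L < j → j < k →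
    levelDegree 𝒢 j L ≤ 2 * Q ^ (j - #L)

lemma sum_two_mul_three_pow (k d l : ℕ) (h : k = l + 1 + d) :
    ∑ j ∈ Ioo l k, 2 * 3 ^ (k - j) + 3 = 3 ^ (k - l) := by
  induction d generalizing l with
  | zero => subst h; simp [show Ioo l (l + 1) = ∅ by ext; simp]
  | succ d ih =>
    have hI : Ioo l k = insert (l + 1) (Ioo (l + 1) k) := by ext; simp; omega
    rw [hI, sum_insert (by simp), add_assoc, ih (l + 1) (by omega),
      show k - l = (k - (l + 1)) + 1 by omega, pow_succ]
    ring

lemma absorbed_weight_le {X : Type*} [DecidableEq X] {H : Finset (Finset X)} {k Q : ℕ}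
    {𝒢 : Finset (Finset X)} (h𝒢 : IsForbiddenFamily H k Q 𝒢) {N : Finset X} (hN : N.Nonempty)
    (hl : #N < k) :
    ∑ E ∈ 𝒢 with N ⊂ E, weight k Q #E + 3 * Q ^ (k - #N) ≤ weight k Q #N := by
  have h1 : ∑ E ∈ 𝒢 with N ⊂ E, weight k Q #E
      = ∑ E ∈ 𝒢 with (N ⊂ E ∧ #E < k), weight k Q #E := by
    rw [← filter_filter, sum_filter (fun E => #E < k)]
    refine sum_congr rfl fun E _ => ?_
    unfold weight
    split_ifs <;> rfl
  have h2 : ∑ E ∈ 𝒢 with (N ⊂ E ∧ #E < k), weight k Q #E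
      ≤ ∑ j ∈ Ioo #N k, 2 * Q ^ (j - #N) * weight k Q j := by
    rw [← sum_fiberwise_of_maps_to (t := Ioo #N k) (g := fun E => #E)]
    · refine sum_le_sum fun j hj => ?_
      rw [mem_Ioo] at hj
      rw [sum_congr rfl (g := fun _ => weight k Q j)
        (fun E hE => by rw [(mem_filter.1 hE).2]), sum_const, smul_eq_mul]
      refine Nat.mul_le_mul_right _ (le_trans (card_le_card ?_) (h𝒢.degree_le N j hN hj.1 hj.2))
      intro E hE
      simp only [mem_filter] at hE ⊢
      exact ⟨hE.1.1, hE.2, hE.1.2.1.1⟩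
    · intro E hE
      simp only [mem_filter] at hE
      exact mem_Ioo.2 ⟨card_lt_card hE.2.1, hE.2.2⟩
  have h3 : ∑ j ∈ Ioo #N k, 2 * Q ^ (j - #N) * weight k Q j
      = Q ^ (k - #N) * ∑ j ∈ Ioo #N k, 2 * 3 ^ (k - j) := by
    rw [mul_sum]
    refine sum_congr rfl fun j hj => ?_
    rw [mem_Ioo] at hj
    rw [weight, if_pos hj.2, mul_pow, show k - #N = (j - #N) + (k - j) by omega, pow_add]
    ring
  rw [h1]
  calc _ ≤ Q ^ (k - #N) * ∑ j ∈ Ioo #N k, 2 * 3 ^ (k - j) + 3 * Q ^ (k - #N) := by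
        rw [← h3]; gcongr
    _ = Q ^ (k - #N) * (∑ j ∈ Ioo #N k, 2 * 3 ^ (k - j) + 3) := by ring
    _ = weight k Q #N := by
        rw [sum_two_mul_three_pow k (k - #N - 1) #N (by omega), weight, if_pos hl, mul_pow]
        ring
    _ ≤ _ := le_rfl

/-- Replace all supersets of members of `𝒩` by the members of `𝒩`. -/
def absorb {X : Type*} [DecidableEq X] (𝒢 𝒩 : Finset (Finset X)) : Finset (Finset X) :=
  𝒩 ∪ {E ∈ 𝒢 | ∀ N ∈ 𝒩, ¬ N ⊆ E}

lemma IsForbiddenFamily.absorb {X : Type*} [DecidableEq X] {H : Finset (Finset X)} {k Q : ℕ}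
    {𝒢 : Finset (Finset X)} (h𝒢 : IsForbiddenFamily H k Q 𝒢) {𝒩 : Finset (Finset X)} {l : ℕ}
    (hl0 : 0 < l) (hlk : l < k) (hcard : ∀ N ∈ 𝒩, #N = l) (hfree : ∀ N ∈ 𝒩, ∀ E ∈ 𝒢, ¬ E ⊆ N)
    (hdeg : ∀ L : Finset X, L.Nonempty → #L < l →
      levelDegree 𝒢 l L + levelDegree 𝒩 l L ≤ 2 * Q ^ (l - #L)) :
    IsForbiddenFamily H k Q (absorb 𝒢 𝒩) where
  antichain := by
    simp only [HypergraphContainer.absorb, mem_union, mem_filter]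
    rintro E (hE | hE) E' (hE' | hE') hs
    · exact eq_of_subset_of_card_le hs (by rw [hcard E hE, hcard E' hE'])
    · exact absurd hs (hE'.2 E hE)
    · exact absurd hs (hfree E' hE' E hE.1)
    · exact h𝒢.antichain E hE.1 E' hE'.1 hs
  nonempty := by
    simp only [HypergraphContainer.absorb, mem_union, mem_filter]
    rintro E (hE | hE)
    · exact card_pos.1 (by rw [hcard E hE]; exact hl0)
    · exact h𝒢.nonempty E hE.1
  card_le := by
    simp only [HypergraphContainer.absorb, mem_union, mem_filter]
    rintro E (hE | hE)
    · rw [hcard E hE]; exact hlk.le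
    · exact h𝒢.card_le E hE.1
  covers := by
    intro T hT
    obtain ⟨E, hE, hET⟩ := h𝒢.covers T hT
    by_cases h : ∀ N ∈ 𝒩, ¬ N ⊆ E
    · exact ⟨E, mem_union_right _ (mem_filter.2 ⟨hE, h⟩), hET⟩
    · push Not at h
      obtain ⟨N, hN, hNE⟩ := h
      exact ⟨N, mem_union_left _ hN, hNE.trans hET⟩
  degree_le := by
    intro L j hL hLj hjk
    have hsub : ({E ∈ HypergraphContainer.absorb 𝒢 𝒩 | #E = j ∧ L ⊆ E} : Finset _) ⊆
        {E ∈ 𝒢 | #E = j ∧ L ⊆ E} ∪ {E ∈ 𝒩 | #E = j ∧ L ⊆ E} := by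
      intro E hE
      simp only [HypergraphContainer.absorb, mem_union, mem_filter] at hE ⊢
      tauto
    have hle : levelDegree (HypergraphContainer.absorb 𝒢 𝒩) j L
        ≤ levelDegree 𝒢 j L + levelDegree 𝒩 j L :=
      (card_le_card hsub).trans (card_union_le _ _)
    by_cases hj : j = l
    · subst hj; exact hle.trans (hdeg L hL hLj)
    · have h0 : levelDegree 𝒩 j L = 0 := by
        rw [levelDegree, card_eq_zero, filter_eq_empty_iff]
        rintro E hE ⟨h, -⟩
        exact hj (h.symm.trans (hcard E hE))
      rw [h0, add_zero] at hle
      exact hle.trans (h𝒢.degree_le L j hL hLj hjk)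

lemma IsForbiddenFamily.potential_absorb {X : Type*} [DecidableEq X] {H : Finset (Finset X)}
    {k Q : ℕ} {𝒢 : Finset (Finset X)} (h𝒢 : IsForbiddenFamily H k Q 𝒢) {𝒩 : Finset (Finset X)}
    {l : ℕ} (hl0 : 0 < l) (hlk : l < k) (hcard : ∀ N ∈ 𝒩, #N = l)
    (hfree : ∀ N ∈ 𝒩, ∀ E ∈ 𝒢, ¬ E ⊆ N) :
    potential k Q 𝒢 + #𝒩 * (3 * Q ^ (k - l)) ≤ potential k Q (HypergraphContainer.absorb 𝒢 𝒩) := by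
  have hdisj : Disjoint 𝒩 {E ∈ 𝒢 | ∀ N ∈ 𝒩, ¬ N ⊆ E} := by
    rw [Finset.disjoint_left]
    intro E hE hE'
    exact hfree E hE E (mem_filter.1 hE').1 subset_rfl
  have hlost : ∑ E ∈ 𝒢 with ¬ ∀ N ∈ 𝒩, ¬ N ⊆ E, weight k Q #E
      ≤ ∑ N ∈ 𝒩, ∑ E ∈ 𝒢 with N ⊂ E, weight k Q #E := by
    simp_rw [sum_filter]
    rw [sum_comm]
    refine sum_le_sum fun E hE => ?_
    split_ifs with h
    · exact Nat.zero_le _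
    · push Not at h
      obtain ⟨N, hN, hNE⟩ := h
      refine le_trans (le_of_eq ?_) (single_le_sum (fun _ _ => Nat.zero_le _) hN)
      rw [if_pos ⟨hNE, hfree N hN E hE⟩]
  have hgain : ∑ N ∈ 𝒩, ∑ E ∈ 𝒢 with N ⊂ E, weight k Q #E + #𝒩 * (3 * Q ^ (k - l))
      ≤ ∑ N ∈ 𝒩, weight k Q #N := by
    rw [← smul_eq_mul #𝒩, ← sum_const, ← sum_add_distrib]
    refine sum_le_sum fun N hN => ?_
    have := absorbed_weight_le h𝒢 (N := N) (card_pos.1 (by rw [hcard N hN]; exact hl0))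
      (by rw [hcard N hN]; exact hlk)
    rwa [hcard N hN] at this ⊢
  have hsplit : potential k Q 𝒢 = ∑ E ∈ 𝒢 with ∀ N ∈ 𝒩, ¬ N ⊆ E, weight k Q #E
      + ∑ E ∈ 𝒢 with ¬ ∀ N ∈ 𝒩, ¬ N ⊆ E, weight k Q #E :=
    (sum_filter_add_sum_filter_not _ _ _).symm
  have hnew : potential k Q (HypergraphContainer.absorb 𝒢 𝒩) = ∑ N ∈ 𝒩, weight k Q #N
      + ∑ E ∈ 𝒢 with ∀ N ∈ 𝒩, ¬ N ⊆ E, weight k Q #E := by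
    rw [potential, HypergraphContainer.absorb, sum_union hdisj]
  omega

lemma IsForbiddenFamily.potential_le {X : Type*} [DecidableEq X] [Fintype X]
    {H : Finset (Finset X)} {k Q : ℕ} {𝒢 : Finset (Finset X)} (h𝒢 : IsForbiddenFamily H k Q 𝒢) :
    potential k Q 𝒢 ≤ Fintype.card X * (3 * Q) ^ (k - 1) := by
  have h1 : potential k Q 𝒢 ≤ ∑ x : X, ∑ E ∈ 𝒢 with x ∈ E, weight k Q #E := by
    simp_rw [sum_filter]
    rw [sum_comm]
    refine sum_le_sum fun E hE => ?_
    obtain ⟨x, hx⟩ := h𝒢.nonempty E hE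
    refine le_trans (le_of_eq ?_) (single_le_sum (fun _ _ => Nat.zero_le _) (mem_univ x))
    rw [if_pos hx]
  refine h1.trans (le_trans (sum_le_card_nsmul univ _ ((3 * Q) ^ (k - 1)) fun x _ => ?_)
    (by simp))
  by_cases hk : 1 < k
  · have hw : weight k Q 1 = (3 * Q) ^ (k - 1) := if_pos hk
    by_cases hx : {x} ∈ 𝒢
    · rw [← hw, filter_congr (q := fun E => E = {x}), filter_eq', if_pos hx]
      · simp
      · intro E hE
        constructor
        · intro h
          exact (h𝒢.antichain _ hx E hE (singleton_subset_iff.2 h)).symm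
        · rintro rfl; simp
    · have h := absorbed_weight_le h𝒢 (singleton_nonempty x) (by simpa using hk)
      rw [card_singleton, hw] at h
      refine le_trans (le_of_eq ?_) (le_trans (Nat.le_add_right _ _) h)
      refine sum_congr (filter_congr fun E hE => ?_) fun _ _ => rfl
      rw [ssubset_iff_subset_ne, singleton_subset_iff]
      refine ⟨fun h => ⟨h, ?_⟩, fun h => h.1⟩
      rintro rfl
      exact hx hE
  · refine (sum_eq_zero fun E hE => ?_).le.trans (Nat.zero_le _)
    have := card_pos.2 (h𝒢.nonempty E (mem_filter.1 hE).1)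
    exact if_neg (by omega)

/-- All degrees of a forbidden family are below the saturation threshold. -/
def IsStable {X : Type*} [DecidableEq X] (k Q : ℕ) (𝒢 : Finset (Finset X)) : Prop :=
  ∀ (L : Finset X) (j : ℕ), L.Nonempty → #L < j → j ≤ k → levelDegree 𝒢 j L ≤ Q ^ (j - #L)

lemma exists_saturated_of_not_isStable {X : Type*} [DecidableEq X] [Fintype X] {k Q : ℕ}
    {𝒢 : Finset (Finset X)} (h : ¬ IsStable k Q 𝒢) :
    ∃ (L : Finset X) (j : ℕ), L.Nonempty ∧ #L < j ∧ j ≤ k ∧ Q ^ (j - #L) < levelDegree 𝒢 j L ∧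
      (∀ (L' : Finset X) (l : ℕ), L'.Nonempty → #L' < l → l < j →
        levelDegree 𝒢 l L' ≤ Q ^ (l - #L')) ∧
      ∀ L' : Finset X, #L < #L' → #L' < j → levelDegree 𝒢 j L' ≤ Q ^ (j - #L') := by
  classical
  have hex : ∃ j, ∃ L : Finset X, L.Nonempty ∧ #L < j ∧ j ≤ k ∧
      Q ^ (j - #L) < levelDegree 𝒢 j L := by
    unfold IsStable at h
    push Not at h
    obtain ⟨L, j, h⟩ := h
    exact ⟨j, L, h⟩
  set j := Nat.find hex with hj
  obtain ⟨L₀, hL₀⟩ := Nat.find_spec hex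
  obtain ⟨L, hL, hmax⟩ := exists_max_image
    (univ.filter fun L : Finset X => L.Nonempty ∧ #L < j ∧ j ≤ k ∧
      Q ^ (j - #L) < levelDegree 𝒢 j L) (fun L => #L) ⟨L₀, mem_filter.2 ⟨mem_univ _, hL₀⟩⟩
  simp only [mem_filter, mem_univ, true_and] at hL hmax
  refine ⟨L, j, hL.1, hL.2.1, hL.2.2.1, hL.2.2.2, ?_, ?_⟩
  · intro L' l hL' hl hlj
    by_contra hcon
    exact Nat.find_min hex hlj ⟨L', hL', hl, hlj.le.trans hL.2.2.1, not_le.1 hcon⟩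
  · intro L' hlt hL'
    by_contra hcon
    have := hmax L' ⟨card_pos.1 (by omega), hL', hL.2.2.1, not_le.1 hcon⟩
    omega

/-- The state reached after learning that the saturated set `L` is not contained in the
independent set. -/
lemma IsForbiddenFamily.absorb_singleton {X : Type*} [DecidableEq X] {H : Finset (Finset X)}
    {k Q : ℕ} (hQ : 1 ≤ Q) {𝒢 : Finset (Finset X)} (h𝒢 : IsForbiddenFamily H k Q 𝒢)
    {L : Finset X} {j : ℕ} (hL : L.Nonempty) (hLj : #L < j) (hjk : j ≤ k)
    (hsat : Q ^ (j - #L) < levelDegree 𝒢 j L)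
    (hlow : ∀ (L' : Finset X) (l : ℕ), L'.Nonempty → #L' < l → l < j →
        levelDegree 𝒢 l L' ≤ Q ^ (l - #L')) :
    IsForbiddenFamily H k Q (HypergraphContainer.absorb 𝒢 {L}) ∧
      potential k Q 𝒢 < potential k Q (HypergraphContainer.absorb 𝒢 {L}) := by
  have hcard : ∀ N ∈ ({L} : Finset (Finset X)), #N = #L := by simp
  have hfree : ∀ N ∈ ({L} : Finset (Finset X)), ∀ E ∈ 𝒢, ¬ E ⊆ N := by
    simp only [mem_singleton, forall_eq]
    intro E hE hEL
    obtain ⟨E₀, hE₀⟩ := card_pos.1 (Nat.zero_lt_of_lt hsat)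
    simp only [mem_filter] at hE₀
    have := h𝒢.antichain E hE E₀ hE₀.1 (hEL.trans hE₀.2.2)
    have := card_le_card hEL
    subst E
    omega
  refine ⟨h𝒢.absorb (card_pos.2 hL) (hLj.trans_le hjk) hcard hfree fun L' hL' hlt => ?_, ?_⟩
  · have h1 := hlow L' #L hL' hlt hLj
    have h2 : levelDegree {L} #L L' ≤ 1 := (card_filter_le _ _).trans (by simp)
    have h3 : 1 ≤ Q ^ (#L - #L') := Nat.one_le_pow _ _ hQ
    omega
  · have h := h𝒢.potential_absorb (card_pos.2 hL) (hLj.trans_le hjk) hcard hfree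
    have : 0 < Q ^ (k - #L) := Nat.pow_pos hQ
    rw [card_singleton] at h
    omega

/-- The state reached after learning that the saturated set `L` is contained in the
independent set. -/
lemma IsForbiddenFamily.absorb_link {X : Type*} [DecidableEq X] {H : Finset (Finset X)}
    {k Q : ℕ} {𝒢 : Finset (Finset X)} (h𝒢 : IsForbiddenFamily H k Q 𝒢)
    {L : Finset X} {j : ℕ} (hL : L.Nonempty) (hLj : #L < j) (hjk : j ≤ k)
    (hsat : Q ^ (j - #L) < levelDegree 𝒢 j L)
    (hlow : ∀ (L' : Finset X) (l : ℕ), L'.Nonempty → #L' < l → l < j →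
        levelDegree 𝒢 l L' ≤ Q ^ (l - #L'))
    (hhigh : ∀ L' : Finset X, #L < #L' → #L' < j → levelDegree 𝒢 j L' ≤ Q ^ (j - #L')) :
    IsForbiddenFamily H k Q
        (HypergraphContainer.absorb 𝒢 ({E ∈ 𝒢 | #E = j ∧ L ⊆ E}.image (· \ L))) ∧
      potential k Q 𝒢 + Q ^ k ≤ potential k Q
        (HypergraphContainer.absorb 𝒢 ({E ∈ 𝒢 | #E = j ∧ L ⊆ E}.image (· \ L))) := by
  have hLpos := card_pos.2 hL
  have hcard : ∀ N ∈ ({E ∈ 𝒢 | #E = j ∧ L ⊆ E}.image (· \ L)), #N = j - #L := by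
    simp only [mem_image, mem_filter]
    rintro _ ⟨E, ⟨-, hE, hLE⟩, rfl⟩
    rw [card_sdiff_of_subset hLE, hE]
  have hfree : ∀ N ∈ ({E ∈ 𝒢 | #E = j ∧ L ⊆ E}.image (· \ L)), ∀ E ∈ 𝒢, ¬ E ⊆ N := by
    simp only [mem_image, mem_filter]
    rintro _ ⟨E, ⟨hE𝒢, hE, hLE⟩, rfl⟩ E' hE' hs
    have := h𝒢.antichain E' hE' E hE𝒢 (hs.trans sdiff_subset)
    subst E'
    obtain ⟨x, hx⟩ := hL
    exact (mem_sdiff.1 (hs (hLE hx))).2 hx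
  have hcardN : #({E ∈ 𝒢 | #E = j ∧ L ⊆ E}.image (· \ L)) = levelDegree 𝒢 j L := by
    refine card_image_of_injOn ?_
    intro E hE E' hE' h
    simp only [coe_filter, Set.mem_ofPred_eq] at hE hE' h
    rw [← sdiff_union_of_subset hE.2.2, h, sdiff_union_of_subset hE'.2.2]
  refine ⟨h𝒢.absorb (by omega) (by omega) hcard hfree fun L' hL' hlt => ?_, ?_⟩
  · have h1 := hlow L' (j - #L) hL' hlt (by omega)
    have h2 : levelDegree ({E ∈ 𝒢 | #E = j ∧ L ⊆ E}.image (· \ L)) (j - #L) L'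
        ≤ Q ^ (j - #L - #L') := by
      by_cases hd : Disjoint L L'
      · have hu : #(L ∪ L') = #L + #L' := card_union_of_disjoint hd
        have := card_pos.2 hL'
        have h3 := hhigh (L ∪ L') (by omega) (by omega)
        rw [hu, ← Nat.sub_sub] at h3
        refine le_trans ?_ h3
        refine le_trans (card_le_card (t := {E ∈ 𝒢 | #E = j ∧ L ∪ L' ⊆ E}.image (· \ L)) ?_)
          card_image_le
        intro N hN
        simp only [mem_filter, mem_image] at hN ⊢
        obtain ⟨⟨E, hE, rfl⟩, -, hL'E⟩ := hN
        exact ⟨E, ⟨hE.1, hE.2.1, union_subset hE.2.2 (hL'E.trans sdiff_subset)⟩, rfl⟩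
      · rw [levelDegree, filter_eq_empty_iff.2, card_empty]
        · exact Nat.zero_le _
        · rintro N hN ⟨-, hs⟩
          simp only [mem_image] at hN
          obtain ⟨E, -, rfl⟩ := hN
          exact hd (disjoint_sdiff.mono_right hs)
    omega
  · have h := h𝒢.potential_absorb (by omega) (by omega) hcard hfree
    rw [hcardN] at h
    refine le_trans (Nat.add_le_add_left ?_ _) h
    calc Q ^ k = Q ^ (j - #L) * Q ^ (k - (j - #L)) := by rw [← pow_add]; congr 1; omega
      _ ≤ levelDegree 𝒢 j L * (3 * Q ^ (k - (j - #L))) := by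
        refine Nat.mul_le_mul hsat.le ?_
        omega

lemma exists_containerMap {X : Type*} [DecidableEq X] [Fintype X] (H : Finset (Finset X))
    {k Q : ℕ} (hQ : 1 ≤ Q) (n : ℕ) (𝒢 : Finset (Finset X)) (h𝒢 : IsForbiddenFamily H k Q 𝒢)
    (hn : Fintype.card X * (3 * Q) ^ (k - 1) - potential k Q 𝒢 ≤ n) :
    ∃ f : Finset X → Finset X,
      (∀ S, ∃ 𝒢', IsForbiddenFamily H k Q 𝒢' ∧ IsStable k Q 𝒢' ∧ ∀ x ∈ f S, {x} ∉ 𝒢') ∧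
      ∀ I : Finset X, (∀ E ∈ 𝒢, ¬ E ⊆ I) → ∃ S ⊆ I,
        #S * Q ^ k ≤ k * (Fintype.card X * (3 * Q) ^ (k - 1) - potential k Q 𝒢) ∧
        ∀ S', S ⊆ S' → S' ⊆ I → I ⊆ f S' := by
  induction n using Nat.strong_induction_on generalizing 𝒢 with
  | _ n ih =>
  by_cases hst : IsStable k Q 𝒢
  · refine ⟨fun _ => {x | {x} ∉ 𝒢}, fun _ => ⟨𝒢, h𝒢, hst, by simp⟩, fun I hI => ⟨∅, by simp, by simp,
      fun S' _ _ x hx => ?_⟩⟩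
    simp only [mem_filter, mem_univ, true_and]
    exact fun h => hI _ h (singleton_subset_iff.2 hx)
  obtain ⟨L, j, hL, hLj, hjk, hsat, hlow, hhigh⟩ := exists_saturated_of_not_isStable hst
  obtain ⟨hno, hnoΦ⟩ := h𝒢.absorb_singleton hQ hL hLj hjk hsat hlow
  obtain ⟨hyes, hyesΦ⟩ := h𝒢.absorb_link hL hLj hjk hsat hlow hhigh
  have hnoB := hno.potential_le
  have hyesB := hyes.potential_le
  have hQk : 0 < Q ^ k := Nat.pow_pos hQ
  obtain ⟨f₀, hf₀, hI₀⟩ := ih _ (by omega) _ hno le_rfl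
  obtain ⟨f₁, hf₁, hI₁⟩ := ih _ (by omega) _ hyes le_rfl
  refine ⟨fun S => if L ⊆ S then f₁ S else f₀ S, fun S => ?_, fun I hI => ?_⟩
  · by_cases h : L ⊆ S
    · simpa [h] using hf₁ S
    · simpa [h] using hf₀ S
  by_cases hLI : L ⊆ I
  · obtain ⟨S, hSI, hS, hcont⟩ := hI₁ I (by
      simp only [HypergraphContainer.absorb, mem_union, mem_filter, mem_image]
      rintro E (⟨E', ⟨hE', -, -⟩, rfl⟩ | hE) hEI
      · refine hI E' hE' fun x hx => ?_
        by_cases hxL : x ∈ L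
        · exact hLI hxL
        · exact hEI (mem_sdiff.2 ⟨hx, hxL⟩)
      · exact hI E hE.1 hEI)
    refine ⟨S ∪ L, union_subset hSI hLI, ?_, fun S' hS' hS'I => ?_⟩
    · calc #(S ∪ L) * Q ^ k ≤ (#S + #L) * Q ^ k := Nat.mul_le_mul_right _ (card_union_le _ _)
        _ ≤ #S * Q ^ k + k * Q ^ k := by
          rw [add_mul]
          exact Nat.add_le_add_left (Nat.mul_le_mul_right _ (by omega)) _
        _ ≤ _ := by
          refine (Nat.add_le_add_right hS _).trans ?_
          rw [← mul_add]
          exact Nat.mul_le_mul_left _ (by omega)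
    · beta_reduce
      rw [if_pos (subset_union_right.trans hS')]
      exact hcont S' (subset_union_left.trans hS') hS'I
  · obtain ⟨S, hSI, hS, hcont⟩ := hI₀ I (by
      simp only [HypergraphContainer.absorb, mem_union, mem_filter, mem_singleton]
      rintro E (rfl | hE) hEI
      · exact hLI hEI
      · exact hI E hE.1 hEI)
    refine ⟨S, hSI, hS.trans (Nat.mul_le_mul_left _ (by omega)), fun S' hS' hS'I => ?_⟩
    beta_reduce
    rw [if_neg fun h => hLI (h.trans hS'I)]
    exact hcont S' hS' hS'I

/-- A hypergraph container theorem for a `k`-uniform (multi)hypergraph `e : ι → Finset X`. -/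
theorem exists_container {X ι : Type*} [DecidableEq X] [Fintype X] [Fintype ι]
    (e : ι → Finset X) {k Q κ B : ℕ} (hk : 1 ≤ k) (hQ : 1 ≤ Q) (he : ∀ t, #(e t) = k)
    (hdeg : ∀ L : Finset X, 2 ≤ #L → κ * Q ^ (#L - 1) * #{t | L ⊆ e t} ≤ B) :
    ∃ f : Finset X → Finset X,
      (∀ S, κ * #{t | e t ⊆ f S} ≤ k * Fintype.card X * B) ∧
      ∀ I : Finset X, (∀ t, ¬ e t ⊆ I) →
        ∃ S ⊆ I, #S * Q ≤ k * 3 ^ k * Fintype.card X ∧ I ⊆ f S := by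
  classical
  have h0 : IsForbiddenFamily (univ.image e) k Q (univ.image e) := by
    refine ⟨?_, ?_, ?_, fun T hT => ⟨T, hT, subset_rfl⟩, ?_⟩
    · simp only [mem_image, mem_univ, true_and]
      rintro _ ⟨t, rfl⟩ _ ⟨t', rfl⟩ hs
      exact eq_of_subset_of_card_le hs (by rw [he, he])
    · simp only [mem_image, mem_univ, true_and]
      rintro _ ⟨t, rfl⟩
      exact card_pos.1 (by rw [he]; omega)
    · simp only [mem_image, mem_univ, true_and]
      rintro _ ⟨t, rfl⟩
      exact (he t).le
    · intro L j _ _ hjk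
      rw [levelDegree, filter_eq_empty_iff.2, card_empty]
      · exact Nat.zero_le _
      · simp only [mem_image, mem_univ, true_and]
        rintro _ ⟨t, rfl⟩ ⟨h, -⟩
        rw [he] at h
        omega
  obtain ⟨f, hf, hI⟩ := exists_containerMap (univ.image e) hQ _ _ h0 le_rfl
  refine ⟨f, fun S => ?_, fun I hind => ?_⟩
  · obtain ⟨𝒢, h𝒢, hst, hS⟩ := hf S
    have hlevel : ∀ l ∈ Icc 2 k, κ * ∑ E ∈ 𝒢 with #E = l, #{t | E ⊆ e t} ≤ Fintype.card X * B := by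
      intro l hl
      rw [mem_Icc] at hl
      have hcount : #{E ∈ 𝒢 | #E = l} ≤ Fintype.card X * Q ^ (l - 1) := by
        calc #{E ∈ 𝒢 | #E = l} ≤ #(univ.biUnion fun x : X => {E ∈ 𝒢 | #E = l ∧ {x} ⊆ E}) := by
              refine card_le_card fun E hE => ?_
              simp only [mem_filter, mem_biUnion, mem_univ, true_and, singleton_subset_iff] at hE ⊢
              obtain ⟨x, hx⟩ := h𝒢.nonempty E hE.1
              exact ⟨x, hE.1, hE.2, hx⟩
          _ ≤ ∑ x : X, levelDegree 𝒢 l {x} := card_biUnion_le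
          _ ≤ ∑ _x : X, Q ^ (l - 1) := sum_le_sum fun x _ => by
              simpa using hst {x} l (singleton_nonempty x) (by rw [card_singleton]; omega) hl.2
          _ = _ := by simp
      calc κ * ∑ E ∈ 𝒢 with #E = l, #{t | E ⊆ e t}
          = ∑ E ∈ 𝒢 with #E = l, κ * #{t | E ⊆ e t} := mul_sum _ _ _
        _ ≤ #{E ∈ 𝒢 | #E = l} * (B / Q ^ (l - 1)) := by
            rw [← smul_eq_mul]
            refine sum_le_card_nsmul _ _ _ fun E hE => ?_
            rw [Nat.le_div_iff_mul_le (Nat.pow_pos hQ)]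
            have hEl := (mem_filter.1 hE).2
            have := hdeg E (by omega)
            rw [hEl] at this
            linarith
        _ ≤ Fintype.card X * Q ^ (l - 1) * (B / Q ^ (l - 1)) := Nat.mul_le_mul_right _ hcount
        _ ≤ _ := by
            rw [mul_assoc]
            exact Nat.mul_le_mul_left _ (Nat.mul_div_le _ _)
    have hcover : #{t | e t ⊆ f S} ≤ ∑ l ∈ Icc 2 k, ∑ E ∈ 𝒢 with #E = l, #{t | E ⊆ e t} := by
      refine le_trans (card_le_card (t := (Icc 2 k).biUnion fun l =>
        ({E ∈ 𝒢 | #E = l} : Finset _).biUnion fun E => {t | E ⊆ e t}) ?_) (card_biUnion_le.trans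
        (sum_le_sum fun l _ => card_biUnion_le))
      intro t ht
      simp only [mem_filter, mem_univ, true_and, mem_biUnion, mem_Icc] at ht ⊢
      obtain ⟨E, hE, hEt⟩ := h𝒢.covers (e t) (mem_image_of_mem _ (mem_univ t))
      refine ⟨#E, ⟨?_, h𝒢.card_le E hE⟩, E, ⟨hE, rfl⟩, hEt⟩
      have hpos := card_pos.2 (h𝒢.nonempty E hE)
      by_contra hlt
      obtain ⟨x, rfl⟩ := card_eq_one.1 (show #E = 1 by omega)
      exact hS x (ht (hEt (mem_singleton_self x))) hE
    calc κ * #{t | e t ⊆ f S} ≤ κ * ∑ l ∈ Icc 2 k, ∑ E ∈ 𝒢 with #E = l, #{t | E ⊆ e t} :=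
          Nat.mul_le_mul_left _ hcover
      _ = ∑ l ∈ Icc 2 k, κ * ∑ E ∈ 𝒢 with #E = l, #{t | E ⊆ e t} := mul_sum _ _ _
      _ ≤ #(Icc 2 k) * (Fintype.card X * B) := by
          rw [← smul_eq_mul]; exact sum_le_card_nsmul _ _ _ hlevel
      _ ≤ k * (Fintype.card X * B) := Nat.mul_le_mul_right _ (by rw [Nat.card_Icc]; omega)
      _ = _ := by ring
  · obtain ⟨S, hSI, hS, hcont⟩ := hI I (by simpa using hind)
    refine ⟨S, hSI, ?_, hcont S subset_rfl hSI⟩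
    have hQk : 0 < Q ^ (k - 1) := Nat.pow_pos hQ
    refine Nat.le_of_mul_le_mul_right (le_trans (le_of_eq ?_) (hS.trans ?_)) hQk
    · rw [mul_assoc, mul_comm Q, ← pow_succ]
      congr 2
      omega
    · calc k * (Fintype.card X * (3 * Q) ^ (k - 1) - potential k Q (univ.image e))
          ≤ k * (Fintype.card X * (3 * Q) ^ (k - 1)) := Nat.mul_le_mul_left _ (Nat.sub_le _ _)
        _ = k * Fintype.card X * 3 ^ (k - 1) * Q ^ (k - 1) := by rw [mul_pow]; ring
        _ ≤ k * Fintype.card X * 3 ^ k * Q ^ (k - 1) := by gcongr <;> omega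
        _ = _ := by ring

end HypergraphContainer

/-- The set of vertices covered by a set of edges. -/
def edgeVerts {V : Type*} [DecidableEq V] (B : Finset (Sym2 V)) : Finset V :=
  B.biUnion Sym2.toFinset

lemma mem_edgeVerts {V : Type*} [DecidableEq V] {B : Finset (Sym2 V)} {x : V} :
    x ∈ edgeVerts B ↔ ∃ e ∈ B, x ∈ e := by
  simp [edgeVerts]

lemma edgeVerts_image {V W : Type*} [DecidableEq V] [DecidableEq W] (f : V → W)
    (B : Finset (Sym2 V)) : edgeVerts (B.image (Sym2.map f)) = (edgeVerts B).image f := by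
  ext y
  simp only [mem_edgeVerts, Finset.mem_image]
  constructor
  · rintro ⟨_, ⟨e, he, rfl⟩, hy⟩
    obtain ⟨x, hx, rfl⟩ := Sym2.mem_map.1 hy
    exact ⟨x, ⟨e, he, hx⟩, rfl⟩
  · rintro ⟨x, ⟨e, he, hx⟩, rfl⟩
    exact ⟨_, ⟨e, he, rfl⟩, Sym2.mem_map.2 ⟨x, hx, rfl⟩⟩

lemma Sym2.IsDiag.of_map_injective {V W : Type*} {f : V → W} (hf : Function.Injective f)
    {e : Sym2 V} (h : (e.map f).IsDiag) : e.IsDiag := by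
  induction e with
  | _ x y => simpa [hf.eq_iff] using h

namespace BlowUp

open Finset

variable {α W K Γ : Type*} {m r : ℕ}

/-- The canonical lift of `g : α → W` to the `m`-fold blow-up along a transversal `φ`. -/
def place (g : α → W) (φ : W → Fin m) (a : α) : W × Fin m := (g a, φ (g a))

lemma place_injective {g : α → W} (hg : Function.Injective g) (φ : W → Fin m) :
    Function.Injective (place g φ) := fun _ _ h => hg (congrArg Prod.fst h)

lemma card_sym2_prod_le [Fintype W] [DecidableEq W] [Fintype K] :
    Fintype.card (Sym2 (W × Fin m) × K) ≤ Fintype.card W ^ 2 * Fintype.card K * m ^ 2 := by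
  have h1 : Fintype.card (Sym2 (W × Fin m)) ≤ (Fintype.card W * m) ^ 2 := by
    have := Fintype.card_le_of_surjective (fun p : (W × Fin m) × (W × Fin m) => s(p.1, p.2))
      (fun e => by induction e with | _ x y => exact ⟨(x, y), rfl⟩)
    simpa [pow_two] using this
  rw [Fintype.card_prod]
  calc _ ≤ (Fintype.card W * m) ^ 2 * Fintype.card K := Nat.mul_le_mul_right _ h1
    _ = _ := by ring

section count

variable [Fintype W] [DecidableEq W]

lemma card_transversal_mul_le (Y : Finset (W × Fin m))
    (hY : Set.InjOn Prod.fst (Y : Set (W × Fin m))) :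
    #{φ : W → Fin m | ∀ p ∈ Y, φ p.1 = p.2} * m ^ #Y ≤ m ^ Fintype.card W := by
  have h1 : ({φ : W → Fin m | ∀ p ∈ Y, φ p.1 = p.2} : Finset _) ⊆
      Fintype.piFinset fun w => {i | ∀ p ∈ Y, p.1 = w → i = p.2} := by
    intro φ hφ
    simp only [mem_filter, mem_univ, true_and, Fintype.mem_piFinset] at hφ ⊢
    rintro w p hp rfl
    exact hφ p hp
  have h2 : ∀ w, #{i : Fin m | ∀ p ∈ Y, p.1 = w → i = p.2} ≤
      if w ∈ Y.image Prod.fst then 1 else m := by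
    intro w
    split_ifs with hw
    · obtain ⟨p, hp, rfl⟩ := mem_image.1 hw
      refine card_le_one.2 fun i hi j hj => ?_
      simp only [mem_filter, mem_univ, true_and] at hi hj
      rw [hi p hp rfl, hj p hp rfl]
    · exact (card_le_univ _).trans (by simp)
  have h3 : #{φ : W → Fin m | ∀ p ∈ Y, φ p.1 = p.2} ≤
      m ^ #{w | w ∉ Y.image Prod.fst} := by
    refine (card_le_card h1).trans ?_
    rw [Fintype.card_piFinset]
    refine (prod_le_prod (fun _ _ => Nat.zero_le _) fun w _ => h2 w).trans ?_
    rw [prod_ite]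
    simp
  have h4 : #{w | w ∉ Y.image Prod.fst} + #Y = Fintype.card W := by
    rw [← card_image_of_injOn hY, ← compl_filter, card_compl]
    have : ({w | w ∈ Y.image Prod.fst} : Finset W) = Y.image Prod.fst := by ext; simp
    rw [this]
    have := card_le_univ (Y.image Prod.fst)
    omega
  calc _ ≤ m ^ #{w | w ∉ Y.image Prod.fst} * m ^ #Y := Nat.mul_le_mul_right _ h3
    _ = _ := by rw [← pow_add, h4]

lemma card_cover_mul_le (g : α → W) (Y : Finset (W × Fin m)) [DecidablePred fun φ : W → Fin m =>
    ∀ p ∈ Y, ∃ a, place g φ a = p] :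
    #{φ : W → Fin m | ∀ p ∈ Y, ∃ a, place g φ a = p} * m ^ #Y ≤ m ^ Fintype.card W := by
  have hval : ∀ φ : W → Fin m, (∀ p ∈ Y, ∃ a, place g φ a = p) → ∀ p ∈ Y, φ p.1 = p.2 := by
    intro φ hφ p hp
    obtain ⟨a, rfl⟩ := hφ p hp
    rfl
  by_cases hex : ∃ φ : W → Fin m, ∀ p ∈ Y, ∃ a, place g φ a = p
  · obtain ⟨φ, hφ⟩ := hex
    refine le_trans (Nat.mul_le_mul_right _ (card_le_card ?_)) (card_transversal_mul_le Y ?_)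
    · exact monotone_filter_right _ fun φ _ => hval φ
    · intro p hp q hq h
      refine Prod.ext h ?_
      rw [← hval φ hφ p hp, ← hval φ hφ q hq, h]
  · rw [filter_eq_empty_iff.2 fun φ _ h => hex ⟨φ, h⟩]
    simp

end count

/-- The labelled edge set of the canonical copy given by `g` and `φ`. -/
def labelledCopy [DecidableEq W] [DecidableEq K] (E : Finset (Sym2 α)) (lab : Sym2 α → Fin r → K)
    (g : α → W) (φ : W → Fin m) (c : Fin r) : Finset (Sym2 (W × Fin m) × K) :=
  E.image fun e => (e.map (place g φ), lab e c)

lemma card_labelledCopy [DecidableEq W] [DecidableEq K] (E : Finset (Sym2 α))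
    (lab : Sym2 α → Fin r → K) {g : α → W} (hg : Function.Injective g) (φ : W → Fin m)
    (c : Fin r) : #(labelledCopy E lab g φ c) = #E :=
  card_image_of_injective _ fun _ _ h =>
    Sym2.map.injective (place_injective hg φ) (congrArg Prod.fst h)

variable [Fintype W] [DecidableEq W] [Fintype Γ]

lemma card_meeting_mul_le {E : Finset (Sym2 α)} (hE : ∀ e ∈ E, ¬ e.IsDiag) (g : Γ → α → W)
    (hg : ∀ γ, Function.Injective (g γ)) (D : Finset (Sym2 (W × Fin m))) :
    #{t : Γ × (W → Fin m) | ∃ e ∈ E, e.map (place (g t.1) t.2) ∈ D} * m ^ 2 ≤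
      #D * (Fintype.card Γ * m ^ Fintype.card W) := by
  classical
  have hone : ∀ d ∈ D, #{t : Γ × (W → Fin m) | ∃ e ∈ E, e.map (place (g t.1) t.2) = d} * m ^ 2 ≤
      Fintype.card Γ * m ^ Fintype.card W := by
    intro d _
    by_cases hd : d.IsDiag
    · rw [filter_eq_empty_iff.2, card_empty, zero_mul]
      · exact Nat.zero_le _
      · rintro t - ⟨e, he, rfl⟩
        exact hE e he (hd.of_map_injective (place_injective (hg _) _))
    have hsum : #{t : Γ × (W → Fin m) | ∃ e ∈ E, e.map (place (g t.1) t.2) = d} =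
        ∑ γ : Γ, #{φ : W → Fin m | ∃ e ∈ E, e.map (place (g γ) φ) = d} := by
      simp only [card_filter]
      rw [Fintype.sum_prod_type]
    rw [hsum, sum_mul]
    refine (sum_le_card_nsmul _ _ (m ^ Fintype.card W) fun γ _ => ?_).trans (by simp)
    have hcov := card_cover_mul_le (g γ) d.toFinset
    rw [Sym2.card_toFinset_of_not_isDiag d hd] at hcov
    refine le_trans (Nat.mul_le_mul_right _ (card_le_card
      (monotone_filter_right _ fun φ _ hφ p hp => ?_))) hcov
    obtain ⟨e, -, rfl⟩ := hφ
    obtain ⟨a, -, ha⟩ := Sym2.mem_map.1 (Sym2.mem_toFinset.1 hp)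
    exact ⟨a, ha⟩
  have hcover : #{t : Γ × (W → Fin m) | ∃ e ∈ E, e.map (place (g t.1) t.2) ∈ D} ≤
      ∑ d ∈ D, #{t : Γ × (W → Fin m) | ∃ e ∈ E, e.map (place (g t.1) t.2) = d} := by
    refine le_trans (card_le_card fun t ht => ?_) card_biUnion_le
    simp only [mem_filter, mem_univ, true_and, mem_biUnion] at ht ⊢
    obtain ⟨e, he, hD⟩ := ht
    exact ⟨_, hD, e, he, rfl⟩
  refine (Nat.mul_le_mul_right _ hcover).trans ?_
  rw [sum_mul, ← smul_eq_mul #D]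
  exact sum_le_card_nsmul _ _ _ hone

variable [DecidableEq K]

/-- The edges which cannot be given any colour whose labels all lie in `C`. -/
def badEdges (E : Finset (Sym2 α)) (lab : Sym2 α → Fin r → K) (C : Finset (Sym2 (W × Fin m) × K)) :
    Finset (Sym2 (W × Fin m)) :=
  {e | ∀ c : Fin r, ∃ e' ∈ E, (e, lab e' c) ∉ C}

lemma card_badEdges_ge {E : Finset (Sym2 α)} (hE : ∀ e ∈ E, ¬ e.IsDiag) (g : Γ → α → W)
    (hg : ∀ γ, Function.Injective (g γ)) (hr : 0 < r) (hm : 1 ≤ m)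
    (hR : ∀ c : Sym2 W → Fin r, ∃ γ, ∃ k, ∀ e ∈ E, c (e.map (g γ)) = k)
    (lab : Sym2 α → Fin r → K) (C : Finset (Sym2 (W × Fin m) × K))
    (hC : 2 * #{t : (Γ × Fin r) × (W → Fin m) | labelledCopy E lab (g t.1.1) t.2 t.1.2 ⊆ C} ≤
      m ^ Fintype.card W) :
    m ^ 2 ≤ 2 * Fintype.card Γ * #(badEdges E lab C) := by
  classical
  have : NeZero r := ⟨hr.ne'⟩
  set D := badEdges E lab C with hD
  have hcol : ∀ e : Sym2 (W × Fin m), ∃ c : Fin r, e ∉ D → ∀ e' ∈ E, (e, lab e' c) ∈ C := by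
    intro e
    by_cases h : e ∈ D
    · exact ⟨0, fun h' => absurd h h'⟩
    · rw [hD, badEdges, mem_filter] at h
      push Not at h
      obtain ⟨c, hc⟩ := h (mem_univ _)
      exact ⟨c, fun _ => hc⟩
  choose col hcol using hcol
  have hmono : ∀ φ : W → Fin m, ∃ p : Γ × Fin r,
      ∀ e ∈ E, col (e.map (place (g p.1) φ)) = p.2 := by
    intro φ
    obtain ⟨γ, k, h⟩ := hR fun e => col (e.map fun w => (w, φ w))
    refine ⟨(γ, k), fun e he => ?_⟩
    rw [← h e he, Sym2.map_map]
    rfl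
  choose p hp using hmono
  have hsplit : Fintype.card (W → Fin m) ≤
      #{t : Γ × (W → Fin m) | ∃ e ∈ E, e.map (place (g t.1) t.2) ∈ D} +
      #{t : (Γ × Fin r) × (W → Fin m) | labelledCopy E lab (g t.1.1) t.2 t.1.2 ⊆ C} := by
    rw [← card_univ, ← card_filter_add_card_filter_not
      (fun φ : W → Fin m => ∃ e ∈ E, e.map (place (g (p φ).1) φ) ∈ D)]
    refine Nat.add_le_add (card_le_card_of_injOn (fun φ => ((p φ).1, φ)) ?_ ?_)
      (card_le_card_of_injOn (fun φ => (p φ, φ)) ?_ ?_)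
    · intro φ hφ
      simpa using hφ
    · intro φ _ φ' _ h
      exact congrArg Prod.snd h
    · intro φ hφ
      simp only [coe_filter, mem_univ, true_and, Set.mem_ofPred_eq] at hφ ⊢
      intro x hx
      obtain ⟨e, he, rfl⟩ := mem_image.1 hx
      rw [← hp φ e he]
      exact hcol _ (fun h => hφ ⟨e, he, h⟩) e he
    · intro φ _ φ' _ h
      exact congrArg Prod.snd h
  rw [Fintype.card_fun, Fintype.card_fin] at hsplit
  have hmeet := card_meeting_mul_le hE g hg D
  have hpos : 0 < m ^ Fintype.card W := Nat.pow_pos hm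
  refine le_of_mul_le_mul_left (a := m ^ Fintype.card W) ?_ hpos
  calc m ^ Fintype.card W * m ^ 2
      ≤ 2 * #{t : Γ × (W → Fin m) | ∃ e ∈ E, e.map (place (g t.1) t.2) ∈ D} * m ^ 2 :=
        Nat.mul_le_mul_right _ (by omega)
    _ ≤ 2 * (#D * (Fintype.card Γ * m ^ Fintype.card W)) := by
        rw [mul_assoc]; exact Nat.mul_le_mul_left _ hmeet
    _ = _ := by ring

variable [DecidableEq α]

lemma labelledCopy_degree_le {E : Finset (Sym2 α)} (lab : Sym2 α → Fin r → K)
    (g : Γ → α → W) (hg : ∀ γ, Function.Injective (g γ)) {κ Q : ℕ} (hm : 1 ≤ m)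
    (hW : 2 ≤ Fintype.card W)
    (hJ : ∀ J ⊆ E, 2 ≤ #J → κ * Q ^ (#J - 1) * m ^ 2 ≤ m ^ #(edgeVerts J))
    (L : Finset (Sym2 (W × Fin m) × K)) (hL : 2 ≤ #L) :
    κ * Q ^ (#L - 1) * #{t : (Γ × Fin r) × (W → Fin m) |
        L ⊆ labelledCopy E lab (g t.1.1) t.2 t.1.2} ≤
      Fintype.card Γ * r * m ^ (Fintype.card W - 2) := by
  classical
  have hfib : ∀ p : Γ × Fin r, κ * Q ^ (#L - 1) *
      #{φ : W → Fin m | L ⊆ labelledCopy E lab (g p.1) φ p.2} ≤ m ^ (Fintype.card W - 2) := by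
    rintro ⟨γ, c⟩
    by_cases hex : ∃ φ : W → Fin m, L ⊆ labelledCopy E lab (g γ) φ c
    swap
    · rw [filter_eq_empty_iff.2 fun φ _ h => hex ⟨φ, h⟩]
      simp
    obtain ⟨φ₀, hφ₀⟩ := hex
    have hinj := place_injective (hg γ) φ₀
    set J : Finset (Sym2 α) := {e ∈ E | (e.map (place (g γ) φ₀), lab e c) ∈ L} with hJdef
    have hLJ : labelledCopy J lab (g γ) φ₀ c = L := by
      ext x
      simp only [labelledCopy, mem_image, hJdef, mem_filter]
      constructor
      · rintro ⟨e, ⟨-, he⟩, rfl⟩; exact he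
      · intro hx
        obtain ⟨e, he, rfl⟩ := mem_image.1 (hφ₀ hx)
        exact ⟨e, ⟨he, hx⟩, rfl⟩
    have hcard : #J = #L := by rw [← hLJ, card_labelledCopy J lab (hg γ)]
    have hfst : L.image Prod.fst = J.image (Sym2.map (place (g γ) φ₀)) := by
      rw [← hLJ, labelledCopy, image_image]; rfl
    have hv : #(edgeVerts (L.image Prod.fst)) = #(edgeVerts J) := by
      rw [hfst, edgeVerts_image, card_image_of_injective _ hinj]
    have hcov := card_cover_mul_le (g γ) (edgeVerts (L.image Prod.fst))
    have hle : #{φ : W → Fin m | L ⊆ labelledCopy E lab (g γ) φ c} ≤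
        #{φ : W → Fin m | ∀ p ∈ edgeVerts (L.image Prod.fst), ∃ a, place (g γ) φ a = p} := by
      refine card_le_card (monotone_filter_right _ fun φ _ hφ p hp => ?_)
      obtain ⟨e, he, hpe⟩ := mem_edgeVerts.1 hp
      obtain ⟨x, hx, rfl⟩ := mem_image.1 he
      obtain ⟨e', -, rfl⟩ := mem_image.1 (hφ hx)
      obtain ⟨a, -, ha⟩ := Sym2.mem_map.1 hpe
      exact ⟨a, ha⟩
    have hJ' := hJ J (filter_subset _ _) (by omega)
    rw [hcard] at hJ'
    rw [hv] at hcov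
    refine Nat.le_of_mul_le_mul_right (c := m ^ 2) ?_ (Nat.pow_pos hm)
    rw [← pow_add, Nat.sub_add_cancel hW]
    calc _ = κ * Q ^ (#L - 1) * m ^ 2 *
          #{φ : W → Fin m | L ⊆ labelledCopy E lab (g γ) φ c} := by ring
      _ ≤ m ^ #(edgeVerts J) * _ := Nat.mul_le_mul hJ' hle
      _ ≤ _ := by rw [mul_comm]; exact hcov
  have hsum : #{t : (Γ × Fin r) × (W → Fin m) | L ⊆ labelledCopy E lab (g t.1.1) t.2 t.1.2} =
      ∑ p : Γ × Fin r, #{φ : W → Fin m | L ⊆ labelledCopy E lab (g p.1) φ p.2} := by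
    simp only [card_filter]
    rw [Fintype.sum_prod_type]
  rw [hsum, mul_sum]
  refine (sum_le_card_nsmul _ _ _ fun p _ => hfib p).trans ?_
  simp

/-- Containers for the colourings of subgraphs of a blow-up without monochromatic canonical
copies. -/
theorem exists_container [Fintype K] {E : Finset (Sym2 α)} (hE : ∀ e ∈ E, ¬ e.IsDiag) (hEne : E.Nonempty)
    (g : Γ → α → W) (hg : ∀ γ, Function.Injective (g γ)) (hr : 0 < r) (hm : 1 ≤ m)
    (hR : ∀ c : Sym2 W → Fin r, ∃ γ, ∃ k, ∀ e ∈ E, c (e.map (g γ)) = k)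
    (lab : Sym2 α → Fin r → K) {κ Q : ℕ} (hQ : 1 ≤ Q)
    (hκ : 2 * (#E * Fintype.card W ^ 2 * Fintype.card K * Fintype.card Γ * r) + 1 ≤ κ)
    (hJ : ∀ J ⊆ E, 2 ≤ #J → κ * Q ^ (#J - 1) * m ^ 2 ≤ m ^ #(edgeVerts J)) :
    ∃ C : Finset (Sym2 (W × Fin m) × K) → Finset (Sym2 (W × Fin m) × K),
      (∀ S, m ^ 2 ≤ 2 * Fintype.card Γ * #(badEdges E lab (C S))) ∧
      ∀ I : Finset (Sym2 (W × Fin m) × K),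
        (∀ γ φ c, ∃ e ∈ E, (e.map (place (g γ) φ), lab e c) ∉ I) →
        ∃ S ⊆ I, #S * Q ≤
          #E * 3 ^ #E * (Fintype.card W ^ 2 * Fintype.card K * m ^ 2) ∧ I ⊆ C S := by
  have : NeZero r := ⟨hr.ne'⟩
  have hW : 2 ≤ Fintype.card W := by
    obtain ⟨γ, -⟩ := hR fun _ => 0
    obtain ⟨e, he⟩ := hEne
    have h := card_le_univ (e.map (g γ)).toFinset
    rwa [Sym2.card_toFinset_of_not_isDiag _ fun hd => hE e he (hd.of_map_injective (hg γ))] at h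
  have hX := card_sym2_prod_le (W := W) (K := K) (m := m)
  obtain ⟨C, hC, hI⟩ := HypergraphContainer.exists_container
    (fun t : (Γ × Fin r) × (W → Fin m) => labelledCopy E lab (g t.1.1) t.2 t.1.2)
    (k := #E) (Q := Q) (κ := κ) (B := Fintype.card Γ * r * m ^ (Fintype.card W - 2))
    (card_pos.2 hEne) hQ (fun t => card_labelledCopy E lab (hg _) _ _)
    (fun L hL => labelledCopy_degree_le lab g hg hm hW hJ L hL)
  refine ⟨C, fun S => card_badEdges_ge hE g hg hr hm hR lab (C S) ?_, fun I hind => ?_⟩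
  · have h1 := hC S
    set s := #{t : (Γ × Fin r) × (W → Fin m) | labelledCopy E lab (g t.1.1) t.2 t.1.2 ⊆ C S}
    set c := #E * Fintype.card W ^ 2 * Fintype.card K * Fintype.card Γ * r
    have h2 : (2 * c + 1) * s ≤ c * m ^ Fintype.card W := by
      refine (Nat.mul_le_mul_right _ hκ).trans (h1.trans ?_)
      refine (Nat.mul_le_mul_right _ (Nat.mul_le_mul_left _ hX)).trans (le_of_eq ?_)
      rw [show m ^ Fintype.card W = m ^ (Fintype.card W - 2) * m ^ 2 by
        rw [← pow_add, Nat.sub_add_cancel hW]]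
      ring
    by_contra! hlt
    have h3 := Nat.mul_le_mul_left c hlt.le
    have h4 : (2 * c + 1) * s = c * (2 * s) + s := by ring
    omega
  · obtain ⟨S, hS, hcard, hsub⟩ := hI I fun t ht => by
      obtain ⟨e, he, hne⟩ := hind t.1.1 t.2 t.1.2
      exact hne (ht (mem_image_of_mem _ he))
    exact ⟨S, hS, hcard.trans (Nat.mul_le_mul_left _ hX), hsub⟩

end BlowUp

open Finset in
lemma sum_pow_card_le {X : Type*} [Fintype X] [DecidableEq X] (s : ℕ) {y z : ℝ} (hy : 0 ≤ y)
    (hz : 0 < z) (hz1 : z ≤ 1) :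
    ∑ S : Finset X with #S ≤ s, y ^ #S ≤ z⁻¹ ^ s * (1 + z * y) ^ Fintype.card X := by
  have hsum : ∑ S : Finset X, (z * y) ^ #S = (1 + z * y) ^ Fintype.card X := by
    have := sum_pow_mul_eq_add_pow (z * y) 1 (univ : Finset X)
    rw [powerset_univ, card_univ, add_comm] at this
    simpa using this
  rw [← hsum, mul_sum]
  refine (sum_le_sum (fun S hS => ?_)).trans (sum_le_sum_of_subset_of_nonneg (subset_univ _)
    fun S _ _ => by positivity)
  have hS := (mem_filter.1 hS).2
  rw [mul_pow, ← mul_assoc]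
  refine le_mul_of_one_le_left (by positivity) ?_
  rw [inv_pow, inv_mul_eq_div, one_le_div (by positivity)]
  exact pow_le_pow_of_le_one hz.le hz1 hS

open Finset in
lemma sum_pow_card_le_exp {X : Type*} [Fintype X] [DecidableEq X] (s : ℕ) {y z : ℝ} (hy : 0 ≤ y)
    (hz : 0 < z) (hz1 : z ≤ 1) :
    ∑ S : Finset X with #S ≤ s, y ^ #S ≤
      Real.exp (s * Real.log z⁻¹ + z * y * Fintype.card X) := by
  refine (sum_pow_card_le s hy hz hz1).trans ?_
  rw [Real.exp_add, ← Real.log_pow, Real.exp_log (by positivity), mul_comm (z * y), Real.exp_nat_mul,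
    add_comm]
  gcongr
  exact Real.add_one_le_exp _

namespace MulticolourRamsey

open Finset

lemma exists_list {V : Type*} [DecidableEq V] {r : ℕ} (hr : 0 < r) (c : Sym2 V → Fin r) (L : ℕ)
    (A : Finset V) (hA : (r + 1) ^ L ≤ #A) :
    ∃ l : List (V × Fin r), l.length = L ∧ (∀ p ∈ l, p.1 ∈ A) ∧
      l.Pairwise fun p q => p.1 ≠ q.1 ∧ c s(p.1, q.1) = p.2 := by
  induction L generalizing A with
  | zero => exact ⟨[], by simp⟩
  | succ L ih =>
    have hpos : 1 ≤ (r + 1) ^ L := Nat.one_le_pow _ _ (by omega)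
    rw [pow_succ, mul_add, mul_one] at hA
    obtain ⟨a, ha⟩ : A.Nonempty := card_pos.1 (by omega)
    have : NeZero r := ⟨hr.ne'⟩
    obtain ⟨d, -, hd⟩ := exists_le_card_fiber_of_mul_le_card_of_maps_to
      (s := A.erase a) (t := univ) (f := fun x => c s(a, x)) (n := (r + 1) ^ L)
      (fun _ _ => mem_univ _) univ_nonempty (by
        rw [card_univ, Fintype.card_fin, card_erase_of_mem ha, mul_comm]; omega)
    obtain ⟨l, hl, hmem, hpair⟩ := ih _ hd
    refine ⟨(a, d) :: l, by simp [hl], ?_, List.pairwise_cons.2 ⟨fun p hp => ?_, hpair⟩⟩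
    · simp only [List.mem_cons, forall_eq_or_imp]
      exact ⟨ha, fun p hp => mem_of_mem_erase (mem_filter.1 (hmem p hp)).1⟩
    · have h := mem_filter.1 (hmem p hp)
      exact ⟨(ne_of_mem_erase h.1).symm, h.2⟩

theorem exists_arrowInd_top (α : Type*) [Fintype α] {r : ℕ} (hr : 0 < r) :
    ∃ N : ℕ, ArrowInd (⊤ : SimpleGraph (Fin N)) (⊤ : SimpleGraph α) r := by
  refine ⟨(r + 1) ^ (r * Fintype.card α), fun c => ?_⟩
  obtain ⟨l, hl, -, hpair⟩ := exists_list hr c (r * Fintype.card α) univ (by simp)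
  have : NeZero r := ⟨hr.ne'⟩
  obtain ⟨d, -, hd⟩ := exists_le_card_fiber_of_mul_le_card_of_maps_to
    (s := (univ : Finset (Fin l.length))) (t := univ) (f := fun i => (l.get i).2)
    (n := Fintype.card α) (fun _ _ => mem_univ _) univ_nonempty (by simp [hl])
  obtain ⟨e⟩ : Nonempty (α ↪ {i : Fin l.length // i ∈ ({i | (l.get i).2 = d} : Finset _)}) :=
    Function.Embedding.nonempty_of_card_le (by rwa [Fintype.card_coe])
  have hcol : ∀ x, (l.get (e x)).2 = d := fun x => (mem_filter.1 (e x).2).2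
  have hget := List.pairwise_iff_get.1 hpair
  have key : ∀ x y, x ≠ y → (l.get (e x)).1 ≠ (l.get (e y)).1 ∧
      c s((l.get (e x)).1, (l.get (e y)).1) = d := by
    intro x y hxy
    have hne : (e x).1 ≠ (e y).1 := fun h => hxy (e.injective (Subtype.ext h))
    rcases lt_or_gt_of_ne hne with h | h
    · have := hget _ _ h
      exact ⟨this.1, this.2.trans (hcol x)⟩
    · have := hget _ _ h
      refine ⟨this.1.symm, ?_⟩
      rw [Sym2.eq_swap]
      exact this.2.trans (hcol y)
  have hinj : Function.Injective fun x => (l.get (e x)).1 := by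
    intro x y h
    by_contra hxy
    exact (key x y hxy).1 h
  refine ⟨⟨⟨_, hinj⟩, ?_⟩, d, fun x y hxy => (key x y hxy).2⟩
  intro x y
  simp only [top_adj, Function.Embedding.coeFn_mk]
  exact hinj.ne_iff

end MulticolourRamsey

open Finset in
lemma three_le_card_edgeVerts {V : Type*} [DecidableEq V] {J : Finset (Sym2 V)}
    (hJ : ∀ e ∈ J, ¬ e.IsDiag) (h2 : 2 ≤ #J) : 3 ≤ #(edgeVerts J) := by
  obtain ⟨e, he, e', he', hne⟩ := one_lt_card.1 (show 1 < #J by omega)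
  by_contra hlt
  have key : ∀ e ∈ J, e.toFinset = edgeVerts J := by
    intro e he
    refine eq_of_subset_of_card_le (subset_biUnion_of_mem _ he) ?_
    rw [Sym2.card_toFinset_of_not_isDiag e (hJ e he)]
    omega
  refine hne (Sym2.ext fun x => ?_)
  rw [← Sym2.mem_toFinset, ← Sym2.mem_toFinset, key e he, key e' he']

namespace InducedRamsey

open Finset BlowUp

/-- Label edges of the pattern by their colour and non-edges by `none`. -/
def inducedLabel {α : Type*} {r : ℕ} (F : Finset (Sym2 α)) [DecidableEq α] (e : Sym2 α)
    (c : Fin r) : Option (Fin r) := if e ∈ F then some c else none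

/-- The labelled edges of a coloured graph. -/
def colouredGraph {V : Type*} [Fintype V] [DecidableEq V] {r : ℕ} (G : Finset (Sym2 V))
    (c : Sym2 V → Fin r) : Finset (Sym2 V × Option (Fin r)) :=
  univ.image fun e => (e, if e ∈ G then some (c e) else none)

lemma mem_colouredGraph {V : Type*} [Fintype V] [DecidableEq V] {r : ℕ} {G : Finset (Sym2 V)}
    {c : Sym2 V → Fin r} {e : Sym2 V} {x : Option (Fin r)} :
    (e, x) ∈ colouredGraph G c ↔ (if e ∈ G then some (c e) else none) = x := by
  simp [colouredGraph]

lemma inter_badEdges_eq {α W : Type*} [DecidableEq α] [Fintype W] [DecidableEq W] {r m : ℕ}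
    {E F : Finset (Sym2 α)} {G G' : Finset (Sym2 (W × Fin m))} {c c' : Sym2 (W × Fin m) → Fin r}
    {C : Finset (Sym2 (W × Fin m) × Option (Fin r))} (h : colouredGraph G c ⊆ C)
    (h' : colouredGraph G' c' ⊆ C) :
    G ∩ badEdges E (inducedLabel F) C ⊆ G' := by
  intro e he
  rw [mem_inter, badEdges, mem_filter] at he
  by_contra heG'
  have h1 : (e, some (c e)) ∈ C := h (mem_colouredGraph.2 (if_pos he.1))
  have h2 : (e, none) ∈ C := h' (mem_colouredGraph.2 (if_neg heG'))
  obtain ⟨e', -, hne⟩ := he.2.2 (c e)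
  unfold inducedLabel at hne
  split_ifs at hne
  · exact hne h1
  · exact hne h2

lemma card_le_sum_of_badEdges {V S : Type*} [Fintype V] [DecidableEq V] [DecidableEq S]
    (f : Finset V → S) (D : S → Finset V) (T : Finset S) (hT : ∀ G, f G ∈ T)
    (hD : ∀ G G', f G = f G' → G ∩ D (f G) ⊆ G') {x : ℝ}
    (hx : ∀ s, x ≤ 2 ^ #(D s)) : x ≤ #T := by
  have hfib : ∀ s ∈ T, (#{G : Finset V | f G = s} : ℝ) * x ≤ 2 ^ Fintype.card V := by
    intro s _
    have h1 : #{G : Finset V | f G = s} ≤ #((D s)ᶜ.powerset) := by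
      refine card_le_card_of_injOn (fun G => G \ D s) (fun G _ => ?_) fun G hG G' hG' h => ?_
      · simp only [coe_powerset, Set.mem_preimage, Set.mem_powerset_iff, coe_subset]
        intro e he
        exact mem_compl.2 (mem_sdiff.1 he).2
      · simp only [coe_filter, mem_univ, true_and, Set.mem_ofPred_eq] at hG hG' h
        have hG1 := hD G G' (hG.trans hG'.symm)
        have hG2 := hD G' G (hG'.trans hG.symm)
        rw [hG] at hG1
        rw [hG'] at hG2
        ext e
        by_cases he : e ∈ D s
        · exact ⟨fun h => hG1 (mem_inter.2 ⟨h, he⟩), fun h => hG2 (mem_inter.2 ⟨h, he⟩)⟩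
        · have := congrArg (e ∈ ·) h
          simpa [he] using this
    rw [card_powerset] at h1
    calc (#{G : Finset V | f G = s} : ℝ) * x ≤ 2 ^ #(D s)ᶜ * 2 ^ #(D s) := by
          refine (mul_le_mul_of_nonneg_left (hx s) (Nat.cast_nonneg _)).trans ?_
          gcongr
          exact_mod_cast h1
      _ = 2 ^ Fintype.card V := by rw [← pow_add, card_compl_add_card]
  have htot : (2 : ℝ) ^ Fintype.card V = ∑ s ∈ T, (#{G : Finset V | f G = s} : ℝ) := by
    have := card_eq_sum_card_fiberwise (s := (univ : Finset (Finset V))) (t := T) (f := f)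
      fun G _ => hT G
    rw [card_univ, Fintype.card_finset] at this
    exact_mod_cast this
  have hpos : (0 : ℝ) < 2 ^ Fintype.card V := by positivity
  refine le_of_mul_le_mul_left (a := (2 : ℝ) ^ Fintype.card V) ?_ hpos
  calc 2 ^ Fintype.card V * x = ∑ s ∈ T, (#{G : Finset V | f G = s} : ℝ) * x := by
        rw [← sum_mul, ← htot]
    _ ≤ #T * 2 ^ Fintype.card V := by
        rw [← nsmul_eq_mul]; exact sum_le_card_nsmul _ _ _ hfib
    _ = _ := mul_comm _ _

/-- A Ramsey theorem for induced subgraphs. -/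
theorem exists_arrowInd {α : Type*} [Fintype α] [Nontrivial α] (F : SimpleGraph α) {r : ℕ}
    (hr : 0 < r) : ∃ (N m : ℕ) (R : SimpleGraph (Fin N × Fin m)), ArrowInd R F r := by
  classical
  have : NeZero r := ⟨hr.ne'⟩
  obtain ⟨N, hN⟩ := MulticolourRamsey.exists_arrowInd_top α hr
  obtain ⟨x₀, y₀, hxy₀⟩ := exists_pair_ne α
  set E : Finset (Sym2 α) := {e | ¬ e.IsDiag} with hEdef
  have hE : ∀ e ∈ E, ¬ e.IsDiag := fun e he => (mem_filter.1 he).2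
  have hEne : E.Nonempty := ⟨s(x₀, y₀), by simpa [hEdef] using hxy₀⟩
  let g : (α ↪ Fin N) → α → Fin N := fun γ => γ
  have hg : ∀ γ, Function.Injective (g γ) := fun γ => γ.injective
  have hR : ∀ c : Sym2 (Fin N) → Fin r, ∃ γ, ∃ k, ∀ e ∈ E, c (e.map (g γ)) = k := by
    intro c
    obtain ⟨f, k, hk⟩ := hN c
    refine ⟨f.toEmbedding, k, fun e he => ?_⟩
    induction e with
    | _ x y => exact hk x y (by simpa [hEdef] using he)
  obtain ⟨γ₀, -⟩ := hR fun _ => 0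
  have hΓ : 1 ≤ Fintype.card (α ↪ Fin N) := Fintype.card_pos_iff.2 ⟨γ₀⟩
  have hN1 : 1 ≤ N := by
    have := (γ₀ x₀).2
    omega
  set K₁ : ℕ := 2 * Fintype.card (α ↪ Fin N) with hK₁
  set A : ℕ := N ^ 2 * (r + 1) with hA
  have hA1 : 1 ≤ A := Nat.one_le_iff_ne_zero.2 (by positivity)
  have hK1 : 1 ≤ K₁ := by omega
  have hA1' : (1 : ℝ) ≤ A := by exact_mod_cast hA1
  have hK1' : (1 : ℝ) ≤ K₁ := by exact_mod_cast hK1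
  set z : ℝ := (4 * A * K₁)⁻¹ with hz
  have hz0 : 0 < z := by positivity
  have hz1 : z ≤ 1 := inv_le_one_of_one_le₀ (by nlinarith)
  obtain ⟨Q, hQ⟩ := exists_nat_ge (max 1 (4 * K₁ * (#E * 3 ^ #E * A) * Real.log z⁻¹))
  have hQ1 : 1 ≤ Q := by exact_mod_cast (le_max_left _ _).trans hQ
  have hQ2 := (le_max_right _ _).trans hQ
  set κ : ℕ := 2 * (#E * Fintype.card (Fin N) ^ 2 * Fintype.card (Option (Fin r)) *
    Fintype.card (α ↪ Fin N) * r) + 1 with hκ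
  set m : ℕ := κ * Q ^ #E with hm
  have hm1 : 1 ≤ m := Nat.one_le_iff_ne_zero.2 (by positivity)
  refine ⟨N, m, ?_⟩
  by_contra hcon
  push Not at hcon
  obtain ⟨C, hC, hI⟩ := BlowUp.exists_container hE hEne g hg hr hm1 hR
    (inducedLabel (r := r) F.edgeFinset) hQ1 le_rfl (by
      intro J hJ hJ2
      have h3 := three_le_card_edgeVerts (fun e he => hE e (hJ he)) hJ2
      calc κ * Q ^ (#J - 1) * m ^ 2 ≤ κ * Q ^ #E * m ^ 2 := by
            gcongr
            have := card_le_card hJ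
            omega
        _ = m ^ 3 := by rw [← hm]; ring
        _ ≤ m ^ #(edgeVerts J) := Nat.pow_le_pow_right hm1 h3)
  have hcol : ∀ G : Finset (Sym2 (Fin N × Fin m)), ∃ c : Sym2 (Fin N × Fin m) → Fin r,
      ∀ γ φ k, ∃ e ∈ E, (e.map (place (g γ) φ), inducedLabel F.edgeFinset e k) ∉
        colouredGraph G c := by
    intro G
    have h := hcon (fromEdgeSet G)
    unfold ArrowInd at h
    push Not at h
    obtain ⟨c, hc⟩ := h
    refine ⟨c, fun γ φ k => ?_⟩
    by_contra! hall
    have hedge : ∀ x y, x ≠ y → (F.Adj x y ↔ s(place (g γ) φ x, place (g γ) φ y) ∈ G) ∧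
        (F.Adj x y → c s(place (g γ) φ x, place (g γ) φ y) = k) := by
      intro x y hxy
      have := mem_colouredGraph.1 (hall s(x, y) (by simpa [hEdef] using hxy))
      rw [Sym2.map_mk] at this
      by_cases hadj : F.Adj x y
      · have hlab : inducedLabel F.edgeFinset s(x, y) k = some k := if_pos (by simpa using hadj)
        rw [hlab] at this
        split_ifs at this with hG
        exact ⟨iff_of_true hadj hG, fun _ => Option.some_injective _ this⟩
      · have hlab : inducedLabel F.edgeFinset s(x, y) k = none := if_neg (by simpa using hadj)
        rw [hlab] at this
        split_ifs at this with hG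
        exact ⟨iff_of_false hadj hG, fun h => absurd h hadj⟩
    obtain ⟨x, y, hxy, hne⟩ := hc ⟨⟨place (g γ) φ, place_injective (hg γ) φ⟩, by
      intro x y
      simp only [fromEdgeSet_adj, Function.Embedding.coeFn_mk, mem_coe]
      constructor
      · rintro ⟨h, hne⟩
        exact (hedge x y fun h' => hne (by rw [h'])).1.2 h
      · intro h
        exact ⟨(hedge x y h.ne).1.1 h, (place_injective (hg γ) φ).ne h.ne⟩⟩ k
    exact hne ((hedge x y hxy.ne).2 hxy)
  choose c hc using hcol
  choose S hSI hScard hSC using fun G => hI (colouredGraph G (c G)) (hc G)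
  rw [Fintype.card_option, Fintype.card_fin, Fintype.card_fin, ← hA] at hScard
  set s : ℕ := #E * 3 ^ #E * (A * m ^ 2) / Q with hs
  have hS : ∀ G, #(S G) ≤ s := fun G => (Nat.le_div_iff_mul_le (by omega)).2 (hScard G)
  have hmpos : (0 : ℝ) < m ^ 2 / K₁ := by
    have : (0 : ℝ) < m := by exact_mod_cast hm1
    positivity
  have hlow : Real.exp (Real.log 2 * (m ^ 2 / K₁)) ≤
      #({T : Finset (Sym2 (Fin N × Fin m) × Option (Fin r)) | #T ≤ s} : Finset _) := by
    refine card_le_sum_of_badEdges S (fun T => badEdges E (inducedLabel F.edgeFinset) (C T)) _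
      (fun G => mem_filter.2 ⟨mem_univ _, hS G⟩) (fun G G' h => ?_) fun T => ?_
    · exact inter_badEdges_eq (hSC G) (h ▸ hSC G')
    · rw [← Real.rpow_def_of_pos two_pos, ← Real.rpow_natCast (2 : ℝ)]
      refine Real.rpow_le_rpow_of_exponent_le one_le_two ?_
      rw [div_le_iff₀ (by positivity), mul_comm]
      have := hC T
      rw [← hK₁] at this
      exact_mod_cast this
  have hup := sum_pow_card_le_exp (X := Sym2 (Fin N × Fin m) × Option (Fin r)) s zero_le_one hz0 hz1
  simp only [one_pow, sum_const, nsmul_eq_mul, mul_one] at hup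
  have hexp := Real.exp_le_exp.1 (hlow.trans hup)
  have hX : Fintype.card (Sym2 (Fin N × Fin m) × Option (Fin r)) ≤ A * m ^ 2 := by
    simpa [hA] using card_sym2_prod_le (W := Fin N) (K := Option (Fin r)) (m := m)
  have hX' : z * Fintype.card (Sym2 (Fin N × Fin m) × Option (Fin r)) ≤ m ^ 2 / K₁ / 4 := by
    calc z * Fintype.card (Sym2 (Fin N × Fin m) × Option (Fin r)) ≤ z * (A * m ^ 2) := by
          gcongr; exact_mod_cast hX
      _ = m ^ 2 / K₁ / 4 := by rw [hz]; field_simp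
  have hlog : 0 ≤ Real.log z⁻¹ := Real.log_nonneg (one_le_inv_iff₀.2 ⟨hz0, hz1⟩)
  have hs' : s * Real.log z⁻¹ ≤ m ^ 2 / K₁ / 4 := by
    have h1 : (s : ℝ) ≤ #E * 3 ^ #E * (A * m ^ 2) / Q := by
      refine Nat.cast_div_le.trans (le_of_eq ?_)
      push_cast
      rfl
    have hQ0 : (0 : ℝ) < Q := by exact_mod_cast hQ1
    refine (mul_le_mul_of_nonneg_right h1 hlog).trans ?_
    rw [div_mul_eq_mul_div, div_div, div_le_div_iff₀ hQ0 (by positivity)]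
    calc _ = m ^ 2 * (4 * K₁ * (#E * 3 ^ #E * A) * Real.log z⁻¹) := by ring
      _ ≤ m ^ 2 * Q := by gcongr
  have h2 := Real.log_two_gt_d9
  nlinarith

end InducedRamsey

namespace TightColouring

open Finset

variable {E : Type*}

/-- `B` attains equality in `a * (#B - 1) ≤ b * (v B - 2)`. -/
def IsTight (v : Finset E → ℕ) (a b : ℕ) (B : Finset E) : Prop := a * #B + 2 * b = b * v B + a

/-- A family of tight `q`-sets all of whose proper parts of size at least two are strictly
sparser. -/
structure IsBalancedFamily (v : Finset E → ℕ) (a b q : ℕ) (𝒜 : Set (Finset E)) : Prop where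
  card : ∀ A ∈ 𝒜, #A = q
  tight : ∀ A ∈ 𝒜, IsTight v a b A
  strict : ∀ A ∈ 𝒜, ∀ J ⊆ A, J ≠ A → 2 ≤ #J → a * #J + 2 * b < b * v J + a
  two_le : ∀ A ∈ 𝒜, ∀ e ∈ A, 2 ≤ v {e}

def IsGood (𝒜 : Set (Finset E)) (T : Finset E) (c : E → Fin 2) : Prop :=
  ∀ A ∈ 𝒜, A ⊆ T → ¬ ∃ k, ∀ e ∈ A, c e = k

variable {v : Finset E → ℕ} {a b q : ℕ} {𝒜 : Set (Finset E)}

lemma IsBalancedFamily.eq_of_subset (h𝒜 : IsBalancedFamily v a b q 𝒜) {A B : Finset E}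
    (hA : A ∈ 𝒜) (hB : B ∈ 𝒜) (h : A ⊆ B) : A = B :=
  Finset.eq_of_subset_of_card_le h (by rw [h𝒜.card A hA, h𝒜.card B hB])

variable [DecidableEq E]

lemma IsBalancedFamily.union (h𝒜 : IsBalancedFamily v a b q 𝒜)
    (hv : ∀ A B, v (A ∪ B) + v (A ∩ B) ≤ v A + v B) {T : Finset E}
    (hT : ∀ B ⊆ T, B.Nonempty → a * #B + 2 * b ≤ b * v B + a) {A U : Finset E} (hA : A ∈ 𝒜)
    (hAT : A ⊆ T) (hUT : U ⊆ T) (hU : IsTight v a b U) (hne : (A ∩ U).Nonempty)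
    (hAU : ¬ A ⊆ U) : #(A ∩ U) = 1 ∧ IsTight v a b (A ∪ U) := by
  have h1 := Nat.mul_le_mul_left b (hv A U)
  have h2 : a * #(A ∪ U) + a * #(A ∩ U) = a * #A + a * #U := by
    rw [← mul_add, ← mul_add, card_union_add_card_inter]
  have h3 := hT (A ∪ U) (union_subset hAT hUT) (hne.mono (inter_subset_left.trans subset_union_left))
  have h4 := h𝒜.tight A hA
  unfold IsTight at hU h4 ⊢
  rw [mul_add, mul_add] at h1
  have hone : #(A ∩ U) = 1 := by
    by_contra h
    have := card_pos.2 hne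
    have := h𝒜.strict A hA (A ∩ U) inter_subset_left (fun h => hAU (inter_eq_left.1 h)) (by omega)
    omega
  refine ⟨hone, ?_⟩
  obtain ⟨e, he⟩ := card_eq_one.1 hone
  have he2 := Nat.mul_le_mul_left b (h𝒜.two_le A hA e (inter_subset_left
    (by rw [he]; exact mem_singleton_self e)))
  rw [he] at h1
  rw [hone] at h2
  omega

theorem IsBalancedFamily.exists_isGood (h𝒜 : IsBalancedFamily v a b q 𝒜) (hq : 3 ≤ q)
    (hv : ∀ A B, v (A ∪ B) + v (A ∩ B) ≤ v A + v B) (T : Finset E)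
    (hT : ∀ B ⊆ T, B.Nonempty → a * #B + 2 * b ≤ b * v B + a) : ∃ c, IsGood 𝒜 T c := by
  classical
  induction hn : #T using Nat.strong_induction_on generalizing T with
  | _ n ih =>
  subst hn
  by_cases hex : ∃ A ∈ 𝒜, A ⊆ T
  swap
  · exact ⟨0, fun A hA hAT => absurd ⟨A, hA, hAT⟩ hex⟩
  obtain ⟨A₀, hA₀, hA₀T⟩ := hex
  have hA₀good : ∃ c, IsGood 𝒜 A₀ c := by
    obtain ⟨x, hx, y, hy, hxy⟩ := one_lt_card.1 (show 1 < #A₀ by rw [h𝒜.card A₀ hA₀]; omega)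
    refine ⟨fun e => if e = x then 0 else 1, fun A hA hs => ?_⟩
    obtain rfl := h𝒜.eq_of_subset hA hA₀ hs
    rintro ⟨k, hk⟩
    have := (hk x hx).trans (hk y hy).symm
    beta_reduce at this
    rw [if_pos rfl, if_neg hxy.symm] at this
    exact absurd this (by decide)
  obtain ⟨U, hU, hmax⟩ := exists_max_image
    {U ∈ T.powerset | IsTight v a b U ∧ ∃ c, IsGood 𝒜 U c} Finset.card
    ⟨A₀, mem_filter.2 ⟨mem_powerset.2 hA₀T, h𝒜.tight A₀ hA₀, hA₀good⟩⟩
  simp only [mem_filter, mem_powerset] at hU hmax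
  obtain ⟨hUT, hUtight, c₁, hc₁⟩ := hU
  have hUcard := hmax A₀ ⟨hA₀T, h𝒜.tight A₀ hA₀, hA₀good⟩
  rw [h𝒜.card A₀ hA₀] at hUcard
  have hinter : ∀ A ∈ 𝒜, A ⊆ T → (A ∩ U).Nonempty → A ⊆ U := by
    intro A hA hAT hne
    by_contra hAU
    obtain ⟨hone, htight⟩ := h𝒜.union hv hT hA hAT hUT hUtight hne hAU
    have hcA := h𝒜.card A hA
    have hsd := card_sdiff_add_card_inter A U
    obtain ⟨x, hx, y, hy, hxy⟩ := one_lt_card.1 (show 1 < #(A \ U) by omega)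
    have hgood : IsGood 𝒜 (A ∪ U) fun e => if e ∈ U then c₁ e else if e = x then 0 else 1 := by
      rintro B hB hBs ⟨k, hk⟩
      by_cases hBU : B ⊆ U
      · refine hc₁ B hB hBU ⟨k, fun e he => ?_⟩
        have := hk e he
        beta_reduce at this
        rwa [if_pos (hBU he)] at this
      have hBone : #(B ∩ U) ≤ 1 := by
        by_cases hBne : (B ∩ U).Nonempty
        · exact (h𝒜.union hv hT hB (hBs.trans (union_subset hAT hUT)) hUT hUtight hBne hBU).1.le
        · rw [not_nonempty_iff_eq_empty.1 hBne]; simp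
      have hsdB := card_sdiff_add_card_inter B U
      have hcB := h𝒜.card B hB
      have heq : B \ U = A \ U := by
        refine Finset.eq_of_subset_of_card_le (fun e he => ?_) (by omega)
        rw [mem_sdiff] at he ⊢
        exact ⟨(mem_union.1 (hBs he.1)).resolve_right he.2, he.2⟩
      rw [← heq] at hx hy
      have hx' := mem_sdiff.1 hx
      have hy' := mem_sdiff.1 hy
      have := (hk x hx'.1).trans (hk y hy'.1).symm
      beta_reduce at this
      rw [if_neg hx'.2, if_pos rfl, if_neg hy'.2, if_neg hxy.symm] at this
      exact absurd this (by decide)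
    have h1 := hmax (A ∪ U) ⟨union_subset hAT hUT, htight, _, hgood⟩
    have h2 := card_union_add_card_inter A U
    omega
  have hlt : #(T \ U) < #T := by
    have := card_sdiff_add_card_inter T U
    rw [inter_eq_right.2 hUT] at this
    omega
  obtain ⟨c₂, hc₂⟩ := ih _ hlt (T \ U) (fun B hB => hT B (hB.trans sdiff_subset)) rfl
  refine ⟨fun e => if e ∈ U then c₁ e else c₂ e, ?_⟩
  rintro A hA hAT ⟨k, hk⟩
  by_cases hne : (A ∩ U).Nonempty
  · have hAU := hinter A hA hAT hne
    refine hc₁ A hA hAU ⟨k, fun e he => ?_⟩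
    have := hk e he
    beta_reduce at this
    rwa [if_pos (hAU he)] at this
  · have hd : ∀ e ∈ A, e ∉ U := fun e he heU => hne ⟨e, mem_inter.2 ⟨he, heU⟩⟩
    refine hc₂ A hA (fun e he => mem_sdiff.2 ⟨hAT he, hd e he⟩) ⟨k, fun e he => ?_⟩
    have := hk e he
    beta_reduce at this
    rwa [if_neg (hd e he)] at this

end TightColouring

section density

open Finset

/-- `J` is a densest set of edges inside `E`, `a / b` is the reciprocal of its density
`(#J - 1) / (v(J) - 2)`, and all smaller parts of `J` are strictly sparser. -/
structure IsDensestPart {α : Type*} [DecidableEq α] (E J : Finset (Sym2 α)) (a b : ℕ) : Prop where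
  subset : J ⊆ E
  three_le : 3 ≤ #J
  pos : 1 ≤ a
  lt : a < b
  tight : a * #J + 2 * b = b * #(edgeVerts J) + a
  le : ∀ J' ⊆ E, 2 ≤ #J' → a * #J' + 2 * b ≤ b * #(edgeVerts J') + a
  strict : ∀ J' ⊆ J, J' ≠ J → 2 ≤ #J' → a * #J' + 2 * b < b * #(edgeVerts J') + a

lemma exists_card_edgeVerts_le {α : Type*} [DecidableEq α] {F : SimpleGraph α}
    (hF : ¬ F.IsAcyclic) : ∃ J : Finset (Sym2 α), (J : Set (Sym2 α)) ⊆ F.edgeSet ∧ 3 ≤ #J ∧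
      #(edgeVerts J) ≤ #J := by
  unfold IsAcyclic at hF
  push Not at hF
  obtain ⟨x, c, hc⟩ := hF
  have hcard : #c.edges.toFinset = c.length := by
    rw [List.toFinset_card_of_nodup hc.edges_nodup, Walk.length_edges]
  refine ⟨c.edges.toFinset, fun e he => c.edges_subset_edgeSet (by simpa using he),
    hcard ▸ hc.three_le_length, ?_⟩
  rw [hcard]
  have hsub : edgeVerts c.edges.toFinset ⊆ c.support.tail.toFinset := by
    intro y hy
    obtain ⟨e, he, hye⟩ := mem_edgeVerts.1 hy
    have hys : y ∈ c.support := Walk.mem_support_of_mem_edges (by simpa using he) hye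
    rw [List.mem_toFinset]
    rw [← Walk.cons_tail_support, List.mem_cons] at hys
    rcases hys with rfl | hys
    · exact c.end_mem_tail_support hc.not_nil
    · exact hys
  refine (card_le_card hsub).trans ((List.toFinset_card_le _).trans ?_)
  simp

theorem exists_isDensestPart {α : Type*} [DecidableEq α] (F : SimpleGraph α) (E : Finset (Sym2 α))
    (hE : (E : Set (Sym2 α)) = F.edgeSet) (hF : ¬ F.IsAcyclic) :
    ∃ J a b, IsDensestPart E J a b := by
  have hdiag : ∀ e ∈ E, ¬ e.IsDiag := fun e he =>
    F.not_isDiag_of_mem_edgeSet (by rw [← hE]; exact he)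
  have hthree : ∀ J ⊆ E, 2 ≤ #J → 3 ≤ #(edgeVerts J) := fun J hJ =>
    three_le_card_edgeVerts fun e he => hdiag e (hJ he)
  obtain ⟨J₀, hJ₀E, hJ₀, hJ₀v⟩ := exists_card_edgeVerts_le hF
  rw [← hE, coe_subset] at hJ₀E
  obtain ⟨J, hJ, hmax⟩ := exists_max_image {J ∈ E.powerset | 2 ≤ #J}
    (fun J => toLex (((#J - 1 : ℚ) / (#(edgeVerts J) - 2) : ℚ), (-#J : ℤ)))
    ⟨J₀, mem_filter.2 ⟨mem_powerset.2 hJ₀E, by omega⟩⟩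
  simp only [mem_filter, mem_powerset, Prod.Lex.toLex_le_toLex] at hJ hmax
  obtain ⟨hJE, hJ2⟩ := hJ
  have hv := hthree J hJE hJ2
  have hpos : ∀ J' ⊆ E, 2 ≤ #J' → (0 : ℚ) < #(edgeVerts J') - 2 := by
    intro J' hJ' h2
    have : (3 : ℚ) ≤ #(edgeVerts J') := by exact_mod_cast hthree J' hJ' h2
    linarith
  have key : ∀ J' ⊆ E, 2 ≤ #J' →
      ((#J' - 1 : ℚ) * (#(edgeVerts J) - 2) < (#J - 1) * (#(edgeVerts J') - 2)) ∨
      ((#J' - 1 : ℚ) * (#(edgeVerts J) - 2) = (#J - 1) * (#(edgeVerts J') - 2)) ∧ #J ≤ #J' := by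
    intro J' hJ' h2
    rcases hmax J' ⟨hJ', h2⟩ with h | ⟨h, h'⟩
    · left
      rwa [div_lt_div_iff₀ (hpos J' hJ' h2) (hpos J hJE hJ2)] at h
    · right
      rw [div_eq_div_iff (hpos J' hJ' h2).ne' (hpos J hJE hJ2).ne'] at h
      exact ⟨h, by omega⟩
  obtain ⟨a, ha⟩ : ∃ a, #(edgeVerts J) = a + 2 := ⟨_, (Nat.sub_add_cancel (by omega)).symm⟩
  obtain ⟨b, hb⟩ : ∃ b, #J = b + 1 := ⟨_, (Nat.sub_add_cancel (by omega)).symm⟩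
  have hle : ∀ J' ⊆ E, 2 ≤ #J' → a * #J' + 2 * b ≤ b * #(edgeVerts J') + a := by
    intro J' hJ' h2
    have h : (#J' - 1 : ℚ) * (#(edgeVerts J) - 2) ≤ (#J - 1) * (#(edgeVerts J') - 2) := by
      rcases key J' hJ' h2 with h | h
      exacts [h.le, h.1.le]
    rw [ha, hb] at h
    push_cast at h
    have : (a * #J' + 2 * b : ℚ) ≤ b * #(edgeVerts J') + a := by linarith
    exact_mod_cast this
  have hlt : a < b := by
    by_contra! hba
    have h1 := hle J₀ hJ₀E (by omega)
    have h2 := hthree J₀ hJ₀E (by omega)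
    nlinarith
  refine ⟨J, a, b, hJE, by omega, by omega, hlt, by rw [ha, hb]; ring, hle, ?_⟩
  intro J' hJ' hne h2
  rcases key J' (hJ'.trans hJE) h2 with h | h
  · rw [ha, hb] at h
    push_cast at h
    have : (a * #J' + 2 * b : ℚ) < b * #(edgeVerts J') + a := by linarith
    exact_mod_cast this
  · exact absurd (eq_of_subset_of_card_le hJ' h.2) hne

end density

section localColouring

open Finset

/-- Every nonempty set of edges of `G` on at most `n` vertices is no denser than `b / a`. -/
def IsLocallySparse {V : Type*} [DecidableEq V] (a b n : ℕ) (G : Finset (Sym2 V)) : Prop :=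
  ∀ B ⊆ G, B.Nonempty → (∀ e ∈ B, ¬ e.IsDiag) → #(edgeVerts B) ≤ n →
    a * #B + 2 * b ≤ b * #(edgeVerts B) + a

lemma card_edgeVerts_union_add_inter_le {V : Type*} [DecidableEq V] (A B : Finset (Sym2 V)) :
    #(edgeVerts (A ∪ B)) + #(edgeVerts (A ∩ B)) ≤ #(edgeVerts A) + #(edgeVerts B) := by
  have h1 : edgeVerts (A ∪ B) = edgeVerts A ∪ edgeVerts B := by
    ext x; simp only [mem_edgeVerts, mem_union]; grind
  have h2 : edgeVerts (A ∩ B) ⊆ edgeVerts A ∩ edgeVerts B := by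
    intro x; simp only [mem_edgeVerts, mem_inter]; grind
  rw [h1, ← card_union_add_card_inter (edgeVerts A)]
  exact Nat.add_le_add_left (card_le_card h2) _

lemma IsDensestPart.isBalancedFamily {α V : Type*} [DecidableEq α] [DecidableEq V]
    {E J : Finset (Sym2 α)} {a b : ℕ} (hJ : IsDensestPart E J a b) (hE : ∀ e ∈ E, ¬ e.IsDiag) :
    TightColouring.IsBalancedFamily (fun B : Finset (Sym2 V) => #(edgeVerts B)) a b #J
      {A | ∃ f : α → V, Function.Injective f ∧ J.image (Sym2.map f) = A} where
  card := by
    rintro _ ⟨f, hf, rfl⟩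
    exact card_image_of_injective _ (Sym2.map.injective hf)
  tight := by
    rintro _ ⟨f, hf, rfl⟩
    rw [TightColouring.IsTight, edgeVerts_image, card_image_of_injective _ (Sym2.map.injective hf),
      card_image_of_injective _ hf, hJ.tight]
  strict := by
    rintro _ ⟨f, hf, rfl⟩ J' hJ' hne h2
    obtain ⟨J'', hJ'', rfl⟩ := subset_image_iff.1 hJ'
    rw [card_image_of_injective _ (Sym2.map.injective hf)] at h2 ⊢
    rw [edgeVerts_image, card_image_of_injective _ hf]
    exact hJ.strict J'' hJ'' (by rintro rfl; exact hne rfl) h2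
  two_le := by
    rintro _ ⟨f, hf, rfl⟩ e he
    obtain ⟨e', he', rfl⟩ := mem_image.1 he
    rw [edgeVerts, singleton_biUnion, Sym2.card_toFinset_of_not_isDiag]
    exact fun hd => hE e' (hJ.subset he') (hd.of_map_injective hf)

theorem not_arrowNNI_of_isLocallySparse {α U V : Type*} [DecidableEq α] [DecidableEq V] [Fintype U]
    {F : SimpleGraph α} {E J : Finset (Sym2 α)} (hE : (E : Set (Sym2 α)) = F.edgeSet) {a b n : ℕ}
    (hJ : IsDensestPart E J a b) {G : Finset (Sym2 V)} (hG : IsLocallySparse a b n G)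
    (H : SimpleGraph U) (i : U → V) (hi : Function.Injective i)
    (hHG : ∀ e ∈ H.edgeSet, e.map i ∈ G) (hU : Fintype.card U ≤ n) : ¬ ArrowNNI H F 2 := by
  classical
  have hEF : ∀ e, e ∈ E ↔ e ∈ F.edgeSet := fun e => by rw [← hE, mem_coe]
  have hdiag : ∀ e ∈ E, ¬ e.IsDiag := fun e he => F.not_isDiag_of_mem_edgeSet ((hEF e).1 he)
  obtain ⟨c, hc⟩ := (hJ.isBalancedFamily (V := V) hdiag).exists_isGood hJ.three_le
    card_edgeVerts_union_add_inter_le (H.edgeFinset.image (Sym2.map i)) (by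
      intro B hB hne
      refine hG B (fun e he => ?_) hne (fun e he hd => ?_) ?_
      · obtain ⟨e', he', rfl⟩ := mem_image.1 (hB he)
        exact hHG e' (mem_edgeFinset.1 he')
      · obtain ⟨e', he', rfl⟩ := mem_image.1 (hB he)
        exact H.not_isDiag_of_mem_edgeSet (mem_edgeFinset.1 he') (hd.of_map_injective hi)
      · refine le_trans (card_le_card (t := univ.image i) fun x hx => ?_)
          (card_image_le.trans hU)
        obtain ⟨e, he, hx⟩ := mem_edgeVerts.1 hx
        obtain ⟨e', -, rfl⟩ := mem_image.1 (hB he)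
        obtain ⟨u, -, rfl⟩ := Sym2.mem_map.1 hx
        exact mem_image_of_mem _ (mem_univ u))
  intro harrow
  obtain ⟨f, hf, k, hk⟩ := harrow fun e => c (e.map i)
  refine hc _ ⟨i ∘ f, hi.comp hf, rfl⟩ ?_ ⟨k, ?_⟩
  · intro e he
    obtain ⟨e', he', rfl⟩ := mem_image.1 he
    refine mem_image.2 ⟨e'.map f, mem_edgeFinset.2 ?_, Sym2.map_map e'⟩
    have := (hEF e').1 (hJ.subset he')
    induction e' with
    | _ x y => exact f.map_adj this
  · intro e he
    obtain ⟨e', he', rfl⟩ := mem_image.1 he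
    have := (hEF e').1 (hJ.subset he')
    induction e' with
    | _ x y => exact hk x y this

end localColouring

namespace RandomSubset

open Finset

variable {U : Type*} [Fintype U] [DecidableEq U]

/-- The probability that a `p`-random subset of `U` equals `G`. -/
def prob (p : ℝ) (G : Finset U) : ℝ := p ^ #G * (1 - p) ^ #Gᶜ

lemma prob_nonneg {p : ℝ} (hp : 0 ≤ p) (hp1 : p ≤ 1) (G : Finset U) : 0 ≤ prob p G :=
  mul_nonneg (pow_nonneg hp _) (pow_nonneg (by linarith) _)

lemma sum_prob_superset (p : ℝ) {B D : Finset U} (hBD : Disjoint B D) :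
    ∑ G : Finset U, (if B ⊆ G then prob p G * (1 / 2) ^ #(G ∩ D) else 0) =
      p ^ #B * (1 - p / 2) ^ #D := by
  have h := prod_add (fun e => p * if e ∈ D then 1 / 2 else 1)
    (fun e => if e ∈ B then (0 : ℝ) else 1 - p) (univ : Finset U)
  rw [powerset_univ] at h
  have hl : ∏ e : U, ((p * if e ∈ D then 1 / 2 else 1) + if e ∈ B then (0 : ℝ) else 1 - p) =
      p ^ #B * (1 - p / 2) ^ #D := by
    have hsplit : ∀ e : U, ((p * if e ∈ D then 1 / 2 else 1) + if e ∈ B then (0 : ℝ) else 1 - p) =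
        (if e ∈ B then p else 1) * (if e ∈ D then 1 - p / 2 else 1) := by
      intro e
      have : e ∈ B → e ∉ D := fun h => Finset.disjoint_left.1 hBD h
      by_cases hB : e ∈ B
      · simp [hB, this hB]
      · by_cases hD : e ∈ D
        · simp only [hB, hD, if_true, if_false]; ring
        · simp [hB, hD]
    rw [prod_congr rfl fun e _ => hsplit e, prod_mul_distrib, prod_ite, prod_ite]
    simp
  rw [← hl, h]
  refine sum_congr rfl fun G _ => ?_
  rw [prod_mul_distrib, prod_const, prod_ite, prod_const, prod_const_one, mul_one,
    filter_mem_eq_inter]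
  split_ifs with hB
  · have : ∏ e ∈ univ \ G, (if e ∈ B then (0 : ℝ) else 1 - p) = (1 - p) ^ #Gᶜ := by
      rw [← compl_eq_univ_sdiff, prod_congr rfl (g := fun _ => 1 - p), prod_const]
      intro e he
      exact if_neg fun h => mem_compl.1 he (hB h)
    rw [this, prob]
    ring
  · obtain ⟨e, he, heG⟩ := not_subset.1 hB
    have : ∏ e ∈ univ \ G, (if e ∈ B then (0 : ℝ) else 1 - p) = 0 :=
      Finset.prod_eq_zero (show e ∈ univ \ G by simpa using heG) (if_pos he)
    rw [this, mul_zero]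

lemma sum_prob (p : ℝ) : ∑ G : Finset U, prob p G = 1 := by
  simpa using sum_prob_superset (U := U) p (disjoint_empty_left ∅)

lemma sum_prob_subset (p : ℝ) (B : Finset U) :
    ∑ G : Finset U, (if B ⊆ G then prob p G else 0) = p ^ #B := by
  simpa using sum_prob_superset p (disjoint_empty_right B)

/-- The first moment method: a set containing few members of `𝔅` and, whenever it contains
`b i`, many elements of `d i`. -/
theorem exists_subset {ι : Type*} {p : ℝ} (hp : 0 ≤ p) (hp1 : p ≤ 1) (x : ℕ)
    (𝔅 : Finset (Finset U)) (T : Finset ι) (b d : ι → Finset U)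
    (hbd : ∀ i ∈ T, Disjoint (b i) (d i)) (h𝔅 : ∑ B ∈ 𝔅, p ^ #B ≤ x / 2)
    (hT : ∑ i ∈ T, p ^ #(b i) * (1 - p / 2) ^ #(d i) * 2 ^ x ≤ 1 / 2) :
    ∃ G : Finset U, #{B ∈ 𝔅 | B ⊆ G} ≤ x ∧ ∀ i ∈ T, b i ⊆ G → x < #(G ∩ d i) := by
  by_contra hcon
  push Not at hcon
  have key : ∀ G : Finset U, prob p G ≤
      (∑ B ∈ 𝔅, if B ⊆ G then prob p G else 0) / (x + 1) +
        ∑ i ∈ T, (if b i ⊆ G then prob p G * (1 / 2) ^ #(G ∩ d i) else 0) * 2 ^ x := by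
    intro G
    have hG := prob_nonneg hp hp1 G
    have h1 : 0 ≤ (∑ B ∈ 𝔅, if B ⊆ G then prob p G else 0) / ((x : ℝ) + 1) := by
      refine div_nonneg (sum_nonneg fun B _ => ?_) (by positivity)
      split_ifs
      exacts [hG, le_rfl]
    have h2 : ∀ i ∈ T,
        0 ≤ (if b i ⊆ G then prob p G * (1 / 2) ^ #(G ∩ d i) else 0) * (2 : ℝ) ^ x := by
      intro i _
      split_ifs <;> positivity
    by_cases hx : #{B ∈ 𝔅 | B ⊆ G} ≤ x
    · obtain ⟨i, hi, hbG, hle⟩ := hcon G hx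
      have h3 := single_le_sum h2 hi
      rw [if_pos hbG] at h3
      have h4 : prob p G ≤ prob p G * (1 / 2) ^ #(G ∩ d i) * 2 ^ x := by
        rw [mul_assoc]
        refine le_mul_of_one_le_right hG ?_
        rw [one_div, inv_pow, inv_mul_eq_div, one_le_div (by positivity)]
        exact pow_le_pow_right₀ one_le_two hle
      linarith
    · have h3 := sum_nonneg h2
      have h4 : prob p G ≤ (∑ B ∈ 𝔅, if B ⊆ G then prob p G else 0) / ((x : ℝ) + 1) := by
        rw [← sum_filter, sum_const, nsmul_eq_mul, le_div_iff₀ (by positivity), mul_comm]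
        refine mul_le_mul_of_nonneg_right ?_ hG
        exact_mod_cast not_le.1 hx
      linarith
  have htot := sum_le_sum fun G (_ : G ∈ (univ : Finset (Finset U))) => key G
  rw [sum_prob, sum_add_distrib, ← sum_div, sum_comm, sum_comm (s := univ) (t := T)] at htot
  simp_rw [← sum_mul, sum_prob_subset] at htot
  have hprob : ∑ i ∈ T, ∑ G : Finset U,
      (if b i ⊆ G then prob p G * (1 / 2) ^ #(G ∩ d i) else 0) =
        ∑ i ∈ T, p ^ #(b i) * (1 - p / 2) ^ #(d i) :=
    sum_congr rfl fun i hi => sum_prob_superset p (hbd i hi)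
  rw [hprob] at htot
  rw [← sum_mul] at hT
  have h5 : (∑ B ∈ 𝔅, p ^ #B) / ((x : ℝ) + 1) < 1 / 2 := by
    rw [div_lt_iff₀ (by positivity)]
    linarith
  linarith

end RandomSubset

namespace SparseRamsey

open Finset BlowUp

/-- The nonempty sets of edges on at most `n` vertices violating local sparsity. -/
def denseSets (V : Type*) [Fintype V] [DecidableEq V] (a b n : ℕ) : Finset (Finset (Sym2 V)) :=
  {B | B.Nonempty ∧ #(edgeVerts B) ≤ n ∧ b * #(edgeVerts B) + a < a * #B + 2 * b}

lemma subset_sym2_edgeVerts {V : Type*} [DecidableEq V] (B : Finset (Sym2 V)) :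
    B ⊆ (edgeVerts B).sym2 := fun e he =>
  Finset.mem_sym2_iff.2 fun _ hx => mem_edgeVerts.2 ⟨e, he, hx⟩

lemma sum_denseSets_le {V : Type*} [Fintype V] [DecidableEq V] (a b n : ℕ) {t : ℕ} (ht : 1 ≤ t)
    {l : ℝ} (hl : 1 ≤ l) :
    ∑ B ∈ denseSets V a b n, (l / t ^ a) ^ #B ≤
      (2 * l) ^ (n + 1).choose 2 * (t ^ (2 * b) / t ^ (a + 1)) *
        Real.exp (Fintype.card V / t ^ b) := by
  have ht' : (1 : ℝ) ≤ t := by exact_mod_cast ht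
  have ht0 : (0 : ℝ) < t := by linarith
  set M := (n + 1).choose 2 with hM
  have hsym : ∀ Y : Finset V, #Y ≤ n → #Y.sym2 ≤ M := fun Y hY => by
    rw [Finset.card_sym2]
    exact Nat.choose_le_choose _ (by omega)
  have hterm : ∀ B ∈ denseSets V a b n, (l / (t : ℝ) ^ a) ^ #B ≤
      l ^ M * (t ^ (2 * b) / t ^ (a + 1)) * ((t : ℝ) ^ b)⁻¹ ^ #(edgeVerts B) := by
    intro B hB
    simp only [denseSets, mem_filter, mem_univ, true_and] at hB
    have hBM : #B ≤ M := (card_le_card (subset_sym2_edgeVerts B)).trans (hsym _ hB.2.1)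
    have h1 : l ^ #B ≤ l ^ M := pow_le_pow_right₀ hl hBM
    have h2 : (t : ℝ) ^ (b * #(edgeVerts B) + (a + 1)) ≤ t ^ (a * #B + 2 * b) :=
      pow_le_pow_right₀ ht' (by omega)
    rw [div_pow, inv_pow, ← pow_mul, ← pow_mul, mul_assoc, div_mul_eq_mul_div, ← div_eq_mul_inv,
      div_div, mul_div_assoc']
    rw [div_le_div_iff₀ (by positivity) (by positivity)]
    rw [mul_assoc]
    refine mul_le_mul h1 ?_ (by positivity) (by positivity)
    rw [← pow_add, ← pow_add]
    refine le_trans (le_of_eq ?_) (h2.trans (le_of_eq ?_)) <;> ring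
  calc ∑ B ∈ denseSets V a b n, (l / (t : ℝ) ^ a) ^ #B
      ≤ ∑ B ∈ denseSets V a b n,
        l ^ M * (t ^ (2 * b) / t ^ (a + 1)) * ((t : ℝ) ^ b)⁻¹ ^ #(edgeVerts B) := sum_le_sum hterm
    _ = l ^ M * (t ^ (2 * b) / t ^ (a + 1)) *
        ∑ B ∈ denseSets V a b n, ((t : ℝ) ^ b)⁻¹ ^ #(edgeVerts B) := by rw [mul_sum]
    _ ≤ l ^ M * (t ^ (2 * b) / t ^ (a + 1)) *
        (2 ^ M * Real.exp (Fintype.card V / t ^ b)) := by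
        refine mul_le_mul_of_nonneg_left ?_ (by positivity)
        rw [← sum_fiberwise_of_maps_to (t := {Y : Finset V | #Y ≤ n}) (g := edgeVerts)
          fun B hB => by
            simp only [denseSets, mem_filter, mem_univ, true_and] at hB ⊢
            exact hB.2.1]
        calc _ ≤ ∑ Y : Finset V with #Y ≤ n, 2 ^ M * ((t : ℝ) ^ b)⁻¹ ^ #Y := by
              refine sum_le_sum fun Y hY => ?_
              have hY' := (mem_filter.1 hY).2
              rw [sum_congr rfl (g := fun _ => ((t : ℝ) ^ b)⁻¹ ^ #Y)
                fun B hB => by rw [(mem_filter.1 hB).2], sum_const, nsmul_eq_mul]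
              refine mul_le_mul_of_nonneg_right ?_ (by positivity)
              have h3 : #{B ∈ denseSets V a b n | edgeVerts B = Y} ≤ #(Y.sym2.powerset) := by
                refine card_le_card fun B hB => mem_powerset.2 ?_
                rw [← (mem_filter.1 hB).2]
                exact subset_sym2_edgeVerts B
              rw [card_powerset] at h3
              exact_mod_cast h3.trans (Nat.pow_le_pow_right two_pos (hsym Y hY'))
          _ ≤ 2 ^ M * Real.exp (Fintype.card V / t ^ b) := by
              rw [← mul_sum]
              refine mul_le_mul_of_nonneg_left ?_ (by positivity)
              have := sum_pow_card_le_exp (X := V) n (y := ((t : ℝ) ^ b)⁻¹) (by positivity)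
                one_pos le_rfl
              refine this.trans (le_of_eq ?_)
              simp only [inv_one, Real.log_one, mul_zero, one_mul, zero_add]
              rw [div_eq_inv_mul]
    _ = _ := by rw [mul_pow]; ring

/-- Deleting one edge from every dense set makes `G` locally sparse. -/
lemma exists_isLocallySparse {V : Type*} [Fintype V] [DecidableEq V] (a b n : ℕ)
    (G : Finset (Sym2 V)) : ∃ G' ⊆ G, IsLocallySparse a b n G' ∧
      #(G \ G') ≤ #{B ∈ denseSets V a b n | B ⊆ G} := by
  have hne : ∀ B ∈ denseSets V a b n, ∃ e, e ∈ B := fun B hB =>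
    (mem_filter.1 hB).2.1
  rcases isEmpty_or_nonempty (Sym2 V) with hV | hV
  · refine ⟨G, Subset.rfl, fun B _ hB => ?_, by simp⟩
    exact isEmptyElim hB.choose
  choose! f hf using hne
  refine ⟨G \ {B ∈ denseSets V a b n | B ⊆ G}.image f, sdiff_subset, ?_, ?_⟩
  · intro B hB hBne _ hBn
    by_contra! hlt
    have hBd : B ∈ denseSets V a b n := by
      simp only [denseSets, mem_filter, mem_univ, true_and]
      exact ⟨hBne, hBn, hlt⟩
    exact (mem_sdiff.1 (hB (hf B hBd))).2
      (mem_image_of_mem _ (mem_filter.2 ⟨hBd, hB.trans sdiff_subset⟩))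
  · refine (card_le_card (t := {B ∈ denseSets V a b n | B ⊆ G}.image f) fun e he => ?_).trans
      card_image_le
    by_contra h
    exact (mem_sdiff.1 he).2 (mem_sdiff.2 ⟨(mem_sdiff.1 he).1, h⟩)

lemma sum_pow_mul_pow_le {X U : Type*} [Fintype X] [DecidableEq X] {T : Finset (Finset X)}
    {s x : ℕ} {p z M : ℝ} (u : Finset X → Finset U) (d : Finset X → Finset U) (hp : 0 ≤ p)
    (hp1 : p ≤ 1) (hz : 0 < z) (hz1 : z ≤ 1) (hT : ∀ S ∈ T, #S ≤ s) (hu : ∀ S ∈ T, #(u S) = #S)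
    (hd : ∀ S ∈ T, 2 * M ≤ p * #(d S))
    (hM : s * Real.log z⁻¹ + z * p * Fintype.card X + x + 1 ≤ M) :
    ∑ S ∈ T, p ^ #(u S) * (1 - p / 2) ^ #(d S) * 2 ^ x ≤ 1 / 2 := by
  have h1 : ∀ S ∈ T, p ^ #(u S) * (1 - p / 2) ^ #(d S) * 2 ^ x ≤
      p ^ #S * Real.exp (-M) * Real.exp x := by
    intro S hS
    rw [hu S hS]
    have h2 : (1 - p / 2) ^ #(d S) ≤ Real.exp (-M) := by
      calc (1 - p / 2) ^ #(d S) ≤ Real.exp (-(p / 2)) ^ #(d S) := by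
            refine pow_le_pow_left₀ (by linarith) ?_ _
            have := Real.add_one_le_exp (-(p / 2))
            linarith
        _ = Real.exp (#(d S) * -(p / 2)) := (Real.exp_nat_mul _ _).symm
        _ ≤ _ := Real.exp_le_exp.2 (by linarith [hd S hS])
    have h3 : (2 : ℝ) ^ x ≤ Real.exp x := by
      rw [← mul_one (x : ℝ), Real.exp_nat_mul]
      exact pow_le_pow_left₀ two_pos.le (by linarith [Real.add_one_le_exp (1 : ℝ)]) _
    gcongr
  calc _ ≤ ∑ S ∈ T, p ^ #S * Real.exp (-M) * Real.exp x := sum_le_sum h1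
    _ = (∑ S ∈ T, p ^ #S) * Real.exp (-M) * Real.exp x := by rw [sum_mul, sum_mul]
    _ ≤ Real.exp (s * Real.log z⁻¹ + z * p * Fintype.card X) * Real.exp (-M) * Real.exp x := by
        gcongr
        refine le_trans ?_ (sum_pow_card_le_exp s hp hz hz1)
        exact sum_le_sum_of_subset_of_nonneg
          (fun S hS => mem_filter.2 ⟨mem_univ _, hT S hS⟩) fun S _ _ => by positivity
    _ ≤ Real.exp (-1) := by
        rw [← Real.exp_add, ← Real.exp_add]
        exact Real.exp_le_exp.2 (by linarith)
    _ ≤ 1 / 2 := by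
        rw [Real.exp_neg, one_div]
        exact inv_anti₀ two_pos (by linarith [Real.add_one_le_exp (1 : ℝ)])

theorem exists_sparse {α W Γ : Type*} [DecidableEq α] [Fintype W] [DecidableEq W] [Fintype Γ]
    {E J : Finset (Sym2 α)} {a b : ℕ} (hE : ∀ e ∈ E, ¬ e.IsDiag) (hJ : IsDensestPart E J a b)
    (g : Γ → α → W) (hg : ∀ γ, Function.Injective (g γ)) {r : ℕ} (hr : 0 < r)
    (hR : ∀ c : Sym2 W → Fin r, ∃ γ, ∃ k, ∀ e ∈ E, c (e.map (g γ)) = k) (n : ℕ) :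
    ∃ (m : ℕ) (G : Finset (Sym2 (W × Fin m))), IsLocallySparse a b n G ∧
      ∀ c : Sym2 (W × Fin m) → Fin r, ∃ γ φ k, ∀ e ∈ E,
        e.map (place (g γ) φ) ∈ G ∧ c (e.map (place (g γ) φ)) = k := by
  have : NeZero r := ⟨hr.ne'⟩
  have hEne : E.Nonempty := by
    have h1 := hJ.three_le
    have h2 := card_le_card hJ.subset
    exact card_pos.1 (by omega)
  have hab := hJ.lt
  obtain ⟨γ₀, -⟩ := hR fun _ => 0
  have hΓ : 1 ≤ Fintype.card Γ := Fintype.card_pos_iff.2 ⟨γ₀⟩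
  have hW : 1 ≤ Fintype.card W := by
    obtain ⟨e, -⟩ := hEne
    induction e with
    | _ x y => exact Fintype.card_pos_iff.2 ⟨g γ₀ x⟩
  set K₁ : ℕ := 2 * Fintype.card Γ with hK₁
  set A : ℕ := Fintype.card W ^ 2 * r with hA
  have hA1 : 1 ≤ A := Nat.one_le_iff_ne_zero.2 (by positivity)
  have hA1' : (1 : ℝ) ≤ A := by exact_mod_cast hA1
  have hK1' : (1 : ℝ) ≤ K₁ := by exact_mod_cast (show 1 ≤ K₁ by omega)
  set z : ℝ := (8 * A * K₁)⁻¹ with hz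
  have hz0 : 0 < z := by positivity
  have hz1 : z ≤ 1 := inv_le_one_of_one_le₀ (by nlinarith)
  obtain ⟨q, hq⟩ := exists_nat_ge (max 1 (#E * 3 ^ #E * A * Real.log z⁻¹))
  have hq1 : (1 : ℝ) ≤ q := (le_max_left _ _).trans hq
  have hq2 := (le_max_right _ _).trans hq
  set l : ℝ := 8 * K₁ * q with hl
  have hl1 : 1 ≤ l := by nlinarith
  set κ : ℕ := 2 * (#E * Fintype.card W ^ 2 * r * Fintype.card Γ * r) + 1 with hκ
  obtain ⟨t, ht⟩ := exists_nat_ge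
    (max l (2 * ((2 * l) ^ (n + 1).choose 2 * Real.exp (Fintype.card W * κ))))
  have htl := (le_max_left _ _).trans ht
  have htM := (le_max_right _ _).trans ht
  have ht1' : (1 : ℝ) ≤ t := hl1.trans htl
  have ht1 : 1 ≤ t := by exact_mod_cast ht1'
  have ht0 : (0 : ℝ) < t := by linarith
  set m : ℕ := κ * t ^ b with hm
  have hm1 : 1 ≤ m := Nat.one_le_iff_ne_zero.2 (by positivity)
  set ζ : ℕ := κ ^ 2 * t ^ (2 * b - a) with hζ
  have hζ1 : 1 ≤ ζ := Nat.one_le_iff_ne_zero.2 (by positivity)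
  have hζ1' : (1 : ℝ) ≤ ζ := by exact_mod_cast hζ1
  have hm2 : m ^ 2 = ζ * t ^ a := by
    rw [hm, hζ, mul_assoc, ← pow_add, show 2 * b - a + a = b * 2 by omega, mul_pow, pow_mul]
  set p : ℝ := l / t ^ a with hp
  have hta : (0 : ℝ) < t ^ a := by positivity
  have hp0 : 0 ≤ p := by positivity
  have hp1 : p ≤ 1 := by
    rw [hp, div_le_one hta]
    exact htl.trans (le_self_pow₀ ht1' (by have := hJ.pos; omega))
  have hpm : p * m ^ 2 = l * ζ := by
    have : (m : ℝ) ^ 2 = ζ * t ^ a := by exact_mod_cast hm2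
    rw [this, hp]
    field_simp
  obtain ⟨C, hC, hI⟩ := BlowUp.exists_container (K := Fin r) hE hEne g hg hr hm1 hR
    (fun _ c => c) (Q := t ^ a) (κ := κ) (Nat.one_le_pow _ _ ht1)
    (by rw [Fintype.card_fin]) (by
      intro J' hJ' hJ2
      have h3 := three_le_card_edgeVerts (fun e he => hE e (hJ' he)) hJ2
      have hle := hJ.le J' hJ' hJ2
      have hexp : a * (#J' - 1) + 2 * b ≤ b * #(edgeVerts J') := by
        obtain ⟨j, hj⟩ : ∃ j, #J' = j + 1 := ⟨#J' - 1, by omega⟩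
        rw [hj] at hle ⊢
        rw [Nat.add_sub_cancel]
        linarith
      calc κ * (t ^ a) ^ (#J' - 1) * m ^ 2 = κ ^ 3 * t ^ (a * (#J' - 1) + 2 * b) := by
            rw [hm, pow_add, pow_mul, pow_mul, mul_pow, ← pow_mul, ← pow_mul, ← pow_mul]; ring
        _ ≤ κ ^ #(edgeVerts J') * t ^ (b * #(edgeVerts J')) :=
            Nat.mul_le_mul (Nat.pow_le_pow_right (by omega) h3) (Nat.pow_le_pow_right ht1 hexp)
        _ = m ^ #(edgeVerts J') := by rw [hm, mul_pow, pow_mul])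
  rw [Fintype.card_fin, ← hA] at hI
  rw [← hK₁] at hC
  set D := fun S => badEdges E (fun _ (c : Fin r) => c) (C S) with hD
  set s : ℕ := #E * 3 ^ #E * A * ζ with hs
  set T : Finset (Finset (Sym2 (W × Fin m) × Fin r)) :=
    {S | #S ≤ s ∧ Set.InjOn Prod.fst (S : Set (Sym2 (W × Fin m) × Fin r)) ∧
      Disjoint (S.image Prod.fst) (D S)} with hT
  have hX : (Fintype.card (Sym2 (W × Fin m) × Fin r) : ℝ) ≤ A * m ^ 2 := by
    have := card_sym2_prod_le (W := W) (K := Fin r) (m := m)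
    rw [Fintype.card_fin, ← hA] at this
    exact_mod_cast this
  obtain ⟨G, hGx, hGT⟩ := RandomSubset.exists_subset hp0 hp1 (q * ζ)
    (denseSets (W × Fin m) a b n) T (fun S => S.image Prod.fst) D
    (fun S hS => (mem_filter.1 hS).2.2.2)
    (by
      refine (sum_denseSets_le a b n ht1 hl1).trans ?_
      have h1 : (Fintype.card (W × Fin m) : ℝ) / t ^ b = Fintype.card W * κ := by
        rw [Fintype.card_prod, Fintype.card_fin, hm]
        push_cast
        field_simp
      have h2 : (t : ℝ) ^ (2 * b) / t ^ (a + 1) = t ^ (2 * b - a) / t := by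
        rw [div_eq_div_iff (by positivity) (by positivity), ← pow_succ, ← pow_add]
        congr 1
        omega
      rw [h1, h2]
      have h3 : (t : ℝ) ^ (2 * b - a) ≤ (q * ζ : ℕ) := by
        have h4 : t ^ (2 * b - a) ≤ ζ := Nat.le_mul_of_pos_left _ (by positivity)
        have h5 : ζ ≤ q * ζ := Nat.le_mul_of_pos_left _ (by exact_mod_cast hq1)
        exact_mod_cast h4.trans h5
      calc _ = (t : ℝ) ^ (2 * b - a) *
            ((2 * l) ^ (n + 1).choose 2 * Real.exp (Fintype.card W * κ) / t) := by ring
        _ ≤ (q * ζ : ℕ) * (1 / 2) := by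
            refine mul_le_mul h3 ?_ (by positivity) (by positivity)
            rw [div_le_div_iff₀ ht0 two_pos]
            linarith
        _ = _ := by ring)
    (by
      refine sum_pow_mul_pow_le (s := s) (z := z) (M := 4 * q * ζ) _ _ hp0 hp1 hz0 hz1
        (fun S hS => (mem_filter.1 hS).2.1)
        (fun S hS => card_image_of_injOn (mem_filter.1 hS).2.2.1) (fun S _ => ?_) ?_
      · have h1 : (m : ℝ) ^ 2 ≤ K₁ * #(D S) := by exact_mod_cast hC S
        have h2 := mul_le_mul_of_nonneg_left h1 hp0
        rw [hpm, hl] at h2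
        have h3 : (K₁ : ℝ) * (2 * (4 * q * ζ)) ≤ K₁ * (p * #(D S)) := by linarith
        exact le_of_mul_le_mul_left h3 (by linarith)
      · have h1 : (s : ℝ) * Real.log z⁻¹ ≤ q * ζ := by
          rw [hs]
          push_cast
          have := mul_le_mul_of_nonneg_right hq2 (Nat.cast_nonneg (α := ℝ) ζ)
          linarith
        have h2 : z * p * Fintype.card (Sym2 (W × Fin m) × Fin r) ≤ q * ζ := by
          calc _ ≤ z * p * (A * m ^ 2) := by gcongr
            _ = z * A * (p * m ^ 2) := by ring
            _ = q * ζ := by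
              rw [hpm, hl, hz]
              field_simp
        have h3 : (1 : ℝ) ≤ q * ζ := by nlinarith
        push_cast
        linarith)
  obtain ⟨G', hG'G, hsparse, hG'⟩ := exists_isLocallySparse a b n G
  refine ⟨m, G', hsparse, fun c => ?_⟩
  by_contra! hcon
  obtain ⟨S, hSI, hS, hSC⟩ := hI (G'.image fun e => (e, c e)) fun γ φ k => by
    obtain ⟨e, he, hne⟩ := hcon γ φ k
    refine ⟨e, he, fun hmem => ?_⟩
    obtain ⟨e', he', heq⟩ := mem_image.1 hmem
    simp only [Prod.mk.injEq] at heq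
    obtain ⟨rfl, hk⟩ := heq
    exact hne he' hk
  have hSG : ∀ y ∈ S, y.1 ∈ G' ∧ c y.1 = y.2 := by
    intro y hy
    obtain ⟨e, he, rfl⟩ := mem_image.1 (hSI hy)
    exact ⟨he, rfl⟩
  have hdisj : Disjoint G' (D S) := by
    refine Finset.disjoint_left.2 fun e he heD => ?_
    obtain ⟨e', -, hne⟩ := (mem_filter.1 heD).2 (c e)
    exact hne (hSC (mem_image_of_mem _ he))
  have hsub : S.image Prod.fst ⊆ G' := by
    intro e he
    obtain ⟨y, hy, rfl⟩ := mem_image.1 he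
    exact (hSG y hy).1
  have hST : S ∈ T := by
    refine mem_filter.2 ⟨mem_univ _, ?_, ?_, ?_⟩
    · refine Nat.le_of_mul_le_mul_right (hS.trans (le_of_eq ?_)) (Nat.pow_pos ht1 (n := a))
      rw [hm2, hs]
      ring
    · intro y hy y' hy' h
      refine Prod.ext h ?_
      rw [← (hSG y hy).2, ← (hSG y' hy').2, h]
    · exact disjoint_of_subset_left hsub hdisj
  have hlt := hGT S hST (hsub.trans hG'G)
  have hle : #(G ∩ D S) ≤ #(G \ G') := by
    refine card_le_card fun e he => ?_
    rw [mem_inter] at he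
    exact mem_sdiff.2 ⟨he.1, fun h => Finset.disjoint_left.1 hdisj h he.2⟩
  omega

end SparseRamsey

lemma exists_arrowInd_forall_subgraph {α V : Type*} [Fintype α] [Nontrivial α] [Fintype V]
    (F : SimpleGraph α) (hF : ¬ F.IsAcyclic) {r : ℕ} (hr : 0 < r) (n : ℕ) (R : SimpleGraph V)
    (hR : ArrowInd R F r) : ∃ (M : ℕ) (G : SimpleGraph (Fin M)), ArrowInd G F r ∧
      ∀ H : G.Subgraph, H.verts.ncard ≤ n → ¬ ArrowNNI H.coe F 2 := by
  classical
  have hE : (F.edgeFinset : Set (Sym2 α)) = F.edgeSet := F.coe_edgeFinset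
  have hdiag : ∀ e ∈ F.edgeFinset, ¬ e.IsDiag := fun e he =>
    F.not_isDiag_of_mem_edgeSet (mem_edgeFinset.1 he)
  obtain ⟨J, a, b, hJ⟩ := exists_isDensestPart F F.edgeFinset hE hF
  have : Fintype (F ↪g R) := Fintype.ofInjective (fun f : F ↪g R => (f : α → V))
    DFunLike.coe_injective
  obtain ⟨m, G, hG, hmono⟩ := SparseRamsey.exists_sparse hdiag hJ (fun f : F ↪g R => (f : α → V))
    (fun f => f.injective) hr (fun c => by
      obtain ⟨f, k, hk⟩ := hR c
      refine ⟨f, k, fun e he => ?_⟩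
      induction e with
      | _ x y => exact hk x y (by simpa using he)) n
  let S : SimpleGraph (V × Fin m) := R.comap Prod.fst ⊓ fromEdgeSet G
  have hS : ArrowInd S F r := by
    intro c
    obtain ⟨f, φ, k, hk⟩ := hmono c
    have hk' : ∀ x y, F.Adj x y → s(BlowUp.place f φ x, BlowUp.place f φ y) ∈ G ∧
        c s(BlowUp.place f φ x, BlowUp.place f φ y) = k := fun x y hxy =>
      hk s(x, y) (by simpa using hxy)
    have hinj := BlowUp.place_injective f.injective φ
    refine ⟨⟨⟨BlowUp.place f φ, hinj⟩, fun {x y} => ?_⟩, k, fun x y hxy => (hk' x y hxy).2⟩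
    constructor
    · intro h
      exact f.map_adj_iff.1 h.1
    · intro h
      exact ⟨f.map_adj_iff.2 h, (fromEdgeSet_adj _).2 ⟨(hk' x y h).1, hinj.ne h.ne⟩⟩
  let i := Fintype.equivFin (V × Fin m)
  refine ⟨_, S.comap i.symm, ?_, fun H hH => ?_⟩
  · intro c
    obtain ⟨f, k, hk⟩ := hS fun e => c (e.map i)
    exact ⟨f.trans (Iso.comap i.symm S).symm.toEmbedding, k, hk⟩
  · refine not_arrowNNI_of_isLocallySparse hE hJ hG H.coe (fun x => i.symm x)
      (i.symm.injective.comp Subtype.val_injective) (fun e he => ?_) ?_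
    · induction e with
      | _ x y =>
        have hadj : (S.comap i.symm).Adj x y := H.adj_sub he
        exact ((fromEdgeSet_adj _).1 hadj.2).1
    · rwa [← Nat.card_eq_fintype_card, Nat.card_coe_set_eq]

/-- For every graph `F` containing a cycle and all `r ≥ 2`, `n ≥ 1` there is a Ramsey
graph `G → (F)_r` all of whose subgraphs on at most `n` vertices fail to arrow `F`
with two colours. -/
theorem locally_non_ramsey {α : Type} [Fintype α] (F : SimpleGraph α)
    (hF : ¬ F.IsAcyclic) (r n : ℕ) (hr : 2 ≤ r) (hn : 1 ≤ n) :
    ∃ (m : ℕ) (G : SimpleGraph (Fin m)),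
      ArrowInd G F r ∧
      ∀ H : G.Subgraph, H.verts.ncard ≤ n → ¬ ArrowNNI H.coe F 2 := by
  have : Nontrivial α := by
    by_contra h
    rw [not_nontrivial_iff_subsingleton] at h
    exact hF (IsAcyclic.of_subsingleton)
  obtain ⟨N, m, R, hR⟩ := InducedRamsey.exists_arrowInd F (r := r) (by omega)
  exact exists_arrowInd_forall_subgraph F hF (by omega) n R hR
end
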